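/- arXiv:math/0608666 — 4 statements merged into one kernel-verified Lean document; each statement's English description precedes it below -/
import Mathlib

section
/- Let k be a field and let n be a natural number with 1 ≤ n ≤ 5. Then the number of isomorphism classes of indecomposable objects of S_k(n) is exactly 2 + 2(n−1)·6/(6−n); that is, exactly 2, 5, 10, 20, 50 for n = 1, 2, 3, 4, 5 respectively. In particular, for n ≤ 5 the category S_k(n) has only finitely many isomorphism classes of indecomposable objects. -/
universe u

/-- An object of the category `S_k(n)`: a finite-dimensional `k`-vector space `V`,
a `k`-subspace `U ⊆ V`, and a linear operator `T : V → V` with `T ^ n = 0` and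
`T (U) ⊆ U`. -/
structure SObj (k : Type u) [Field k] (n : ℕ) : Type (u + 1) where
  carrier : Type u
  [instAddCommGroup : AddCommGroup carrier]
  [instModule : Module k carrier]
  [instFin : FiniteDimensional k carrier]
  U : Submodule k carrier
  T : carrier →ₗ[k] carrier
  pow_eq_zero : T ^ n = 0
  maps_U : ∀ x ∈ U, T x ∈ U

namespace SObj

attribute [instance] instAddCommGroup instModule instFin

variable {k : Type u} [Field k] {n : ℕ}

/-- Isomorphism of objects of `S_k(n)`: a linear bijection intertwining the operators
and carrying one invariant subspace onto the other. -/
def Iso (X Y : SObj k n) : Prop :=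
  ∃ e : X.carrier ≃ₗ[k] Y.carrier,
    (∀ v, e (X.T v) = Y.T (e v)) ∧ X.U.map e.toLinearMap = Y.U

/-- Indecomposability: the object is nonzero and there is no decomposition
`V = V₁ ⊕ V₂` into two nonzero `T`-invariant subspaces with
`U = (U ∩ V₁) ⊕ (U ∩ V₂)`. -/
def Indec (X : SObj k n) : Prop :=
  (∃ v : X.carrier, v ≠ 0) ∧
    ¬∃ V₁ V₂ : Submodule k X.carrier,
        V₁ ≠ ⊥ ∧ V₂ ≠ ⊥ ∧ IsCompl V₁ V₂ ∧
          (∀ x ∈ V₁, X.T x ∈ V₁) ∧ (∀ x ∈ V₂, X.T x ∈ V₂) ∧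
            X.U = X.U ⊓ V₁ ⊔ X.U ⊓ V₂

/-- The dimension pair `(dim_k V, dim_k U)` of an object of `S_k(n)`. -/
noncomputable def dimPair (X : SObj k n) : ℕ × ℕ :=
  (Module.finrank k X.carrier, Module.finrank k X.U)

end SObj


namespace SClass

/-! ### Formal integral combinations `∑ c T^a x_g` -/

/-- A formal combination: a term `(c, a, g)` stands for `c • T^a x_g`. -/
abbrev Lin := List (ℤ × ℕ × ℕ)

section Lin

variable {W' : Type*} [AddCommGroup W'] {W : Type*} [AddCommGroup W]

/-- Evaluation of a formal combination. -/
def ev (x : ℕ → ℕ → W) : Lin → W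
  | [] => 0
  | t :: l => t.1 • x t.2.1 t.2.2 + ev x l

/-- Insert a term, merging equal monomials. -/
def ins (c : ℤ) (a g : ℕ) : Lin → Lin
  | [] => [(c, a, g)]
  | (c', a', g') :: l =>
      if a = a' ∧ g = g' then (c + c', a, g) :: l else (c', a', g') :: ins c a g l

/-- Collect terms. -/
def nrm : Lin → Lin
  | [] => []
  | (c, a, g) :: l => ins c a g (nrm l)

/-- Check that a combination vanishes modulo the monomials declared null. -/
def zchk (null : ℕ → ℕ → Bool) (l : Lin) : Bool :=
  (nrm l).all fun t => t.1 == 0 || null t.2.1 t.2.2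

/-- Multiply by `c T^b`. -/
def sc (c : ℤ) (b : ℕ) (l : Lin) : Lin := l.map fun t => (c * t.1, t.2.1 + b, t.2.2)

/-- Substitute combinations for the symbols. -/
def sub (σ : ℕ → Lin) (l : Lin) : Lin := l.flatMap fun t => sc t.1 t.2.1 (σ t.2.2)

/-- Negation. -/
def ng (l : Lin) : Lin := sc (-1) 0 l

@[simp] theorem ev_nil (x : ℕ → ℕ → W) : ev x [] = 0 := rfl

@[simp] theorem ev_cons (x : ℕ → ℕ → W) (t) (l : Lin) :
    ev x (t :: l) = t.1 • x t.2.1 t.2.2 + ev x l := rfl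

@[simp] theorem ev_append (x : ℕ → ℕ → W) (l l' : Lin) :
    ev x (l ++ l') = ev x l + ev x l' := by
  induction l with
  | nil => simp
  | cons t l ih => simp [ih, add_assoc]

theorem ev_ins (x : ℕ → ℕ → W) (c : ℤ) (a g : ℕ) (l : Lin) :
    ev x (ins c a g l) = c • x a g + ev x l := by
  induction l with
  | nil => simp [ins]
  | cons t l ih =>
    obtain ⟨c', a', g'⟩ := t
    by_cases h : a = a' ∧ g = g'
    · obtain ⟨rfl, rfl⟩ := h
      simp [ins, add_smul, add_assoc]
    · simp only [ins, if_neg h, ev_cons, ih]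
      abel

theorem ev_nrm (x : ℕ → ℕ → W) (l : Lin) : ev x (nrm l) = ev x l := by
  induction l with
  | nil => rfl
  | cons t l ih =>
    obtain ⟨c, a, g⟩ := t
    simp [nrm, ev_ins, ih]

theorem ev_zero_of (x : ℕ → ℕ → W) (l : Lin)
    (h : ∀ t ∈ l, t.1 = 0 ∨ x t.2.1 t.2.2 = 0) : ev x l = 0 := by
  induction l with
  | nil => rfl
  | cons t l ih =>
    have h1 := h t (by simp)
    have h2 := ih fun s hs => h s (by simp [hs])
    rcases h1 with h1 | h1 <;> simp [h1, h2]

theorem zchk_sound {null : ℕ → ℕ → Bool} {l : Lin} (hl : zchk null l = true)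
    (x : ℕ → ℕ → W) (hx : ∀ a g, null a g = true → x a g = 0) : ev x l = 0 := by
  rw [← ev_nrm]
  apply ev_zero_of
  intro t ht
  have := List.all_eq_true.1 hl t ht
  rw [Bool.or_eq_true] at this
  rcases this with h | h
  · left; simpa using h
  · right; exact hx _ _ h

theorem ev_sc (x : ℕ → ℕ → W) (c : ℤ) (b : ℕ) (l : Lin) :
    ev x (sc c b l) = c • ev (fun a g => x (a + b) g) l := by
  induction l with
  | nil => simp [sc]
  | cons t l ih =>
    have : sc c b (t :: l) = (c * t.1, t.2.1 + b, t.2.2) :: sc c b l := rfl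
    rw [this, ev_cons, ih, ev_cons, smul_add, mul_smul]

theorem ev_ng (x : ℕ → ℕ → W) (l : Lin) : ev x (ng l) = - ev x l := by
  simp [ng, ev_sc]

theorem map_ev (f : W →+ W') (x : ℕ → ℕ → W) (l : Lin) :
    f (ev x l) = ev (fun a g => f (x a g)) l := by
  induction l with
  | nil => simp
  | cons t l ih => simp [ih]

theorem ev_congr {x y : ℕ → ℕ → W} (l : Lin)
    (h : ∀ t ∈ l, x t.2.1 t.2.2 = y t.2.1 t.2.2) : ev x l = ev y l := by
  induction l with
  | nil => rfl
  | cons t l ih =>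
    rw [ev_cons, ev_cons, h t (by simp), ih fun s hs => h s (by simp [hs])]

theorem ev_flatMap {β : Type*} (x : ℕ → ℕ → W) (l : List β) (F : β → Lin) :
    ev x (l.flatMap F) = (l.map fun t => ev x (F t)).sum := by
  induction l with
  | nil => simp
  | cons t l ih => simp [ih]

theorem ev_eq_sum (x : ℕ → ℕ → W) (l : Lin) :
    ev x l = (l.map fun t => t.1 • x t.2.1 t.2.2).sum := by
  induction l with
  | nil => simp
  | cons t l ih => simp [ih]

theorem ev_zero_fun (l : Lin) : ev (fun _ _ => (0 : W)) l = 0 :=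
  ev_zero_of _ _ fun _ _ => Or.inr rfl

end Lin

section LinT

variable {K : Type*} [Field K] {V : Type*} [AddCommGroup V] [Module K V]

/-- Evaluation with `T^a y_g` as monomials. -/
def evT (T : V →ₗ[K] V) (y : ℕ → V) (l : Lin) : V := ev (fun a g => (T ^ a) (y g)) l

theorem evT_sc (T : V →ₗ[K] V) (y : ℕ → V) (c : ℤ) (b : ℕ) (l : Lin) :
    evT T y (sc c b l) = c • (T ^ b) (evT T y l) := by
  unfold evT
  rw [ev_sc]
  congr 1
  rw [← LinearMap.toAddMonoidHom_coe, map_ev]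
  congr 1
  funext a g
  simp [add_comm a b, pow_add]

theorem evT_sub (T : V →ₗ[K] V) (y : ℕ → V) (σ : ℕ → Lin) (l : Lin) :
    evT T y (sub σ l) = evT T (fun g => evT T y (σ g)) l := by
  show ev _ _ = ev _ l
  rw [sub, ev_flatMap, ev_eq_sum]
  congr 1
  apply List.map_congr_left
  intro t _
  exact evT_sc T y t.1 t.2.1 (σ t.2.2)

theorem evT_ng (T : V →ₗ[K] V) (y : ℕ → V) (l : Lin) : evT T y (ng l) = - evT T y l :=
  ev_ng _ _

theorem evT_append (T : V →ₗ[K] V) (y : ℕ → V) (l l' : Lin) :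
    evT T y (l ++ l') = evT T y l + evT T y l' := ev_append _ _ _

theorem pow_mem {T : V →ₗ[K] V} {U : Submodule K V} (h : ∀ x ∈ U, T x ∈ U) (b : ℕ) :
    ∀ x ∈ U, (T ^ b) x ∈ U := by
  induction b with
  | zero => intro x hx; simpa using hx
  | succ b ih => intro x hx; rw [pow_succ]; exact ih _ (h x hx)

theorem evT_mem {T : V →ₗ[K] V} {U : Submodule K V} (h : ∀ x ∈ U, T x ∈ U)
    (y : ℕ → V) (l : Lin) (hy : ∀ t ∈ l, y t.2.2 ∈ U) : evT T y l ∈ U := by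
  induction l with
  | nil => exact U.zero_mem
  | cons t l ih =>
    refine U.add_mem ?_ (ih fun s hs => hy s (by simp [hs]))
    exact zsmul_mem (pow_mem h _ _ (hy t (by simp))) _

variable {V' : Type*} [AddCommGroup V'] [Module K V']

theorem comm_pow {T : V →ₗ[K] V} {T' : V' →ₗ[K] V'} {f : V →ₗ[K] V'}
    (h : ∀ v, f (T v) = T' (f v)) (b : ℕ) (v : V) : f ((T ^ b) v) = (T' ^ b) (f v) := by
  induction b generalizing v with
  | zero => simp
  | succ b ih => rw [pow_succ, pow_succ]; simp [ih, h]

theorem map_evT {T : V →ₗ[K] V} {T' : V' →ₗ[K] V'} {f : V →ₗ[K] V'}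
    (h : ∀ v, f (T v) = T' (f v)) (y : ℕ → V) (l : Lin) :
    f (evT T y l) = evT T' (fun g => f (y g)) l := by
  unfold evT
  rw [← LinearMap.toAddMonoidHom_coe, map_ev]
  congr 1
  funext a g
  exact comm_pow h _ _

end LinT


/-! ### Combinatorial data describing an object, with certificates -/

/-- Decode a term: `n = sign + 2 a + 16 g`. -/
def dec (n : ℕ) : ℤ × ℕ × ℕ := (if n % 2 = 0 then 1 else -1, n / 2 % 8, n / 16)

/-- Look up an entry in an association list, with default `[]`. -/
def look (n : ℕ) : List (ℕ × List ℕ) → Lin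
  | [] => []
  | (m, l) :: r => if m = n then l.map dec else look n r

/-- The data: Jordan block sizes `p`, degrees `dg` of the generators, generators `us` of the
subspace, equations `ks` of the subspace, and the certificates. -/
structure Dat where
  p : List ℕ
  dg : List ℕ
  w : List ℕ
  es : List ℕ
  us : List (List ℕ)
  ks : List (List ℕ)
  sp : List (ℕ × List ℕ)
  zc : List (ℕ × List ℕ)
  ec : List (ℕ × List ℕ)
  f : List (List ℕ)
  s : List (ℕ × List ℕ)
  cz : List (ℕ × List ℕ)
  cu : List (ℕ × List ℕ)
  cf : List (ℕ × List ℕ)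
  bt : List ℕ

namespace Dat

variable (d : Dat)

/-- Size of the Jordan block number `i`. -/
def P (i : ℕ) : ℕ := if i < 3 then d.p.getD i 0 else 0

/-- Degree of generator number `i`. -/
def G (i : ℕ) : ℕ := d.dg.getD i 0

/-- Generator number `j` of the subspace. -/
def u (j : ℕ) : Lin := (d.us.getD j []).map dec

/-- Equation number `j` of the subspace. -/
def q (j : ℕ) : Lin := (d.ks.getD j []).map dec

/-- Coefficient of the element described by `l` at the coordinate `(i, a)`. -/
def coef (i a : ℕ) : Lin → ℤ
  | [] => 0
  | t :: l => (if t.2.2 = i ∧ a + t.2.1 + 1 = d.P i then t.1 else 0) + coef i a l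

/-- Value of the equation `m` at the element described by `l`. -/
def val (l : Lin) : Lin → ℤ
  | [] => 0
  | t :: m => t.1 * d.coef t.2.2 t.2.1 l + val l m

/-- Null monomials in coordinates. -/
def nullC (a i : ℕ) : Bool := decide (d.P i ≤ a)

/-- Null monomials for matrix entries of endomorphisms. -/
def nullE (a g : ℕ) : Bool := decide (d.P (g / 3) ≤ a) || decide (d.P (g % 3) ≤ a)

/-- Equation satisfied by the matrix entries of an endomorphism. -/
def eqn (i j c : ℕ) : Lin :=
  (d.u i).flatMap fun t => (d.q j).map fun r =>
    (t.1 * r.1, t.2.1 + (r.2.1 + c), 3 * t.2.2 + r.2.2)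

/-- Null monomials in the almost split certificates. -/
def nullA (a g : ℕ) : Bool := decide (5 ≤ a) || (decide (g < 3) && decide (d.P g ≤ a))

/-- The relations available in the almost split certificates. -/
def rel (i : ℕ) : Lin :=
  (if i = 0 then [(1, d.P 0 - 1, 0)] else []) ++
    ((-1, d.P i, 3 + i) :: (List.range 3).flatMap fun j =>
      ((d.q j).filter fun t => t.2.2 = i).map fun t => (-t.1, t.2.1, 6 + j))

/-- Symbols used in certificates: relations, subspace elements. -/
def rho (r : ℕ) : Lin :=
  if r < 3 then d.rel r else if r < 6 then d.u (r - 3) else [(1, 0, r)]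

/-- Basic sanity conditions. -/
def Ok1 : Prop :=
  (d.us.length ≤ 3 ∧ d.ks.length ≤ 3 ∧ 0 < d.P 0) ∧
  (∀ i < 3, d.P i ≤ 5 ∧ d.w.getD i 0 ≤ 39) ∧
  (∀ j < 3, ∀ t ∈ d.q j, t.2.2 < 3) ∧
  (∀ i < 3, ∀ j < 3, ∀ c < 5, d.val (d.u i) (sc 1 c (d.q j)) = 0) ∧
  (∀ j < 3, ∀ t ∈ d.u j, t.2.2 < 3)

/-- The elements `T^c u_j` span the subspace. -/
def Ok2 : Prop :=
  ∀ i < 3, ∀ a < 5, a < d.P i →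
    zchk d.nullC ([(1, a, i)] ++
      (d.sp.flatMap fun e =>
        sc (-(d.coef i a (sc 1 (e.1 / 3) (d.u (e.1 % 3))))) 0 (e.2.map dec)) ++
      (look (5 * i + a) d.zc).flatMap fun t => sc (-t.1) t.2.1 (d.q t.2.2)) = true

/-- The endomorphism ring is local, of a special kind. -/
def Ok3 : Prop :=
  ∀ i < 3, ∀ i' < 3, ∀ a < 5,
    (a < d.P i ∧ a < d.P i' ∧ d.G i' + d.P i' ≤ d.G i + a + 1) →
    zchk d.nullE ([(1, a, 3 * i + i')] ++
      (if i' = i ∧ a + 1 = d.P i then [(-1, d.P 0 - 1, 0)] else []) ++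
      (look (15 * i + 5 * i' + a) d.ec).flatMap fun t =>
        sc (-t.1) 0 (d.eqn (t.2.2 / 3) (t.2.2 % 3) t.2.1)) = true

/-- The almost split certificates; `D` is the whole table. -/
def Ok4 (D : ℕ → Dat) : Prop :=
  (∀ t < d.es.length, d.es.getD t 0 < 50 ∧
    (∀ i < 3, (∀ r ∈ look (3 * t + i) d.cz, r.2.2 < 3) ∧
      zchk d.nullA (sc 1 ((D (d.es.getD t 0)).P i) (look (3 * t + i) d.s) ++
        ng (sub d.rho (look (3 * t + i) d.cz))) = true) ∧
    (∀ j < 3,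
      zchk d.nullA (sub (fun i => look (3 * t + i) d.s) ((D (d.es.getD t 0)).u j) ++
        ng (sub d.rho (look (3 * t + j) d.cu))) = true)) ∧
  (∀ i < 3, (∀ r ∈ look i d.cf, r.2.2 < 3) ∧
    (∀ r ∈ (d.f.getD i []).map dec, r.2.2 / 3 < d.es.length ∧
      d.w.getD i 0 + 1 ≤ (D (d.es.getD (r.2.2 / 3) 0)).w.getD (r.2.2 % 3) 0 + 12 * r.2.1) ∧
    zchk d.nullA ([(1, 0, i)] ++ ng (sub (fun g => look g d.s) ((d.f.getD i []).map dec)) ++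
      sub d.rho (look i d.cf)) = true)

/-- Invariant `β`, positive test. -/
def betaT (a b : ℕ) : Bool :=
  (List.range 3).all fun j => (List.range 5).all fun c =>
    (d.q j).all fun t => decide (d.P t.2.2 ≤ t.2.1 + c + b ∨ a ≤ t.2.1 + c + b)

/-- Invariant `β`, negative test. -/
def BetaF (a b : ℕ) : Prop :=
  ∃ i < 3, ∃ s < 5, d.P i ≤ s + a ∧ ∃ j < 3, ∃ c < 5,
    (d.val [(1, s + b, i)] (sc 1 c (d.q j))).natAbs = 1

/-- Invariant `δ`, positive test. -/
def deltaT (a b : ℕ) : Bool :=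
  (List.range 3).all fun j => (List.range 5).all fun c => (List.range 3).all fun i =>
    (List.range 5).all fun x =>
      decide (a ≤ x → d.P i ≤ x + b → d.coef i x (sc 1 c (d.u j)) = 0)

/-- Invariant `δ`, negative test. -/
def DeltaF (a b : ℕ) : Prop :=
  ∃ j < 3, ∃ c < 5, ∃ i < 3, ∃ x < 5, a ≤ x ∧ d.P i ≤ x + b ∧
    (d.coef i x (sc 1 c (d.u j))).natAbs = 1

/-- The list of parameters for the invariants: type and exponents. -/
def Q : List (ℕ × ℕ × ℕ) :=
  [(0, 1, 0), (0, 3, 1), (0, 5, 2), (0, 5, 3), (0, 3, 0), (0, 3, 2), (0, 4, 2), (0, 2, 1),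
    (0, 5, 4), (1, 0, 1), (1, 1, 2), (1, 3, 2), (1, 2, 1), (1, 1, 4), (1, 1, 1), (1, 2, 2),
    (1, 4, 1)]

/-- Value of an invariant. -/
def bit (x : ℕ × ℕ × ℕ) : Bool := if x.1 = 0 then d.betaT x.2.1 x.2.2 else d.deltaT x.2.1 x.2.2

/-- Negative value of an invariant. -/
def BitF (x : ℕ × ℕ × ℕ) : Prop :=
  (x.1 = 0 ∧ d.BetaF x.2.1 x.2.2) ∨ (x.1 ≠ 0 ∧ d.DeltaF x.2.1 x.2.2)

/-- Invariants computed correctly; `bt` lists those which are false. -/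
def Ok5 : Prop :=
  d.bt = (List.range 17).filter (fun i => !(d.bit (Q.getD i (0, 0, 0)))) ∧
  ∀ i ∈ d.bt, d.BitF (Q.getD i (0, 0, 0))

instance : Decidable d.Ok1 := by unfold Ok1; infer_instance
instance : Decidable d.Ok2 := by unfold Ok2; infer_instance
instance : Decidable d.Ok3 := by unfold Ok3; infer_instance
instance (D : ℕ → Dat) : Decidable (d.Ok4 D) := by unfold Ok4; infer_instance
instance (a b : ℕ) : Decidable (d.BetaF a b) := by unfold BetaF; infer_instance
instance (a b : ℕ) : Decidable (d.DeltaF a b) := by unfold DeltaF; infer_instance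
instance (x : ℕ × ℕ × ℕ) : Decidable (d.BitF x) := by unfold BitF; infer_instance
instance : Decidable d.Ok5 := by unfold Ok5; infer_instance

end Dat


/-- The table of the fifty objects, ordered so that the block sizes grow. -/
def tbl : List Dat := [
  { p := [1], dg := [0], w := [39], es := [2],
    us := [[0]], ks := [],
    sp := [(0, [0])],
    zc := [],
    ec := [], f := [[3]],
    s := [(0, [49])],
    cz := [(0, [2])],
    cu := [(0, [0, 49])], cf := [(0, [1])],
    bt := [9] },
  { p := [1], dg := [0], w := [29], es := [27],
    us := [], ks := [[0]],
    sp := [],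
    zc := [(0, [0])],
    ec := [], f := [[17]],
    s := [(0, [49]), (1, [51, 97])],
    cz := [(1, [2])],
    cu := [(0, [96])], cf := [(0, [1])],
    bt := [0, 4] },
  { p := [2], dg := [0], w := [28], es := [30, 1],
    us := [[2]], ks := [[2]],
    sp := [(0, [0])],
    zc := [(1, [0])],
    ec := [], f := [[17, 49]],
    s := [(0, [49]), (1, [51, 97]), (3, [1, 50, 96])],
    cz := [(1, [2]), (3, [1])],
    cu := [(0, [96]), (1, [0, 49, 98])], cf := [],
    bt := [4] },
  { p := [2], dg := [0], w := [33], es := [9],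
    us := [[0]], ks := [],
    sp := [(0, [2]), (3, [0])],
    zc := [],
    ec := [], f := [[3, 17]],
    s := [(0, [49]), (1, [1, 50])],
    cz := [(0, [2]), (1, [1])],
    cu := [(0, [49])], cf := [],
    bt := [9, 10, 13, 14] },
  { p := [2], dg := [0], w := [23], es := [33],
    us := [], ks := [[0]],
    sp := [],
    zc := [(0, [0]), (1, [2])],
    ec := [], f := [[17]],
    s := [(0, [48]), (1, [1])],
    cz := [],
    cu := [(0, [1, 97])], cf := [],
    bt := [0, 1, 4, 7] },
  { p := [3], dg := [0], w := [20], es := [42],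
    us := [[4]], ks := [[2]],
    sp := [(0, [0])],
    zc := [(1, [0]), (2, [2])],
    ec := [], f := [[17]],
    s := [(0, [49]), (1, [1]), (2, [3, 52, 96])],
    cz := [(2, [1])],
    cu := [(0, [96]), (1, [0, 49, 98])], cf := [],
    bt := [1, 4] },
  { p := [3], dg := [0], w := [24], es := [46],
    us := [[2]], ks := [[4]],
    sp := [(0, [2]), (3, [0])],
    zc := [(2, [0])],
    ec := [], f := [[17, 32]],
    s := [(0, [49]), (1, [51, 97]), (2, [0, 51, 97])],
    cz := [(1, [2]), (2, [0])],
    cu := [(0, [96]), (1, [49, 98])], cf := [],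
    bt := [4, 10, 13] },
  { p := [3], dg := [0], w := [27], es := [19],
    us := [[0]], ks := [],
    sp := [(0, [4]), (3, [2]), (6, [0])],
    zc := [],
    ec := [], f := [[3, 17]],
    s := [(0, [49]), (1, [1, 50])],
    cz := [(0, [2]), (1, [1])],
    cu := [(0, [49])], cf := [],
    bt := [9, 10, 12, 13, 14, 15] },
  { p := [3], dg := [0], w := [17], es := [35],
    us := [], ks := [[0]],
    sp := [],
    zc := [(0, [0]), (1, [2]), (2, [4])],
    ec := [], f := [[17]],
    s := [(0, [48]), (1, [1])],
    cz := [],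
    cu := [(0, [1, 97])], cf := [],
    bt := [0, 1, 2, 4, 5, 6, 7] },
  { p := [3, 1], dg := [0, 1], w := [22, 34], es := [4, 43],
    us := [[2, 16]], ks := [[3, 16]],
    sp := [(0, [16]), (3, [0])],
    zc := [(1, [1]), (2, [3])],
    ec := [(20, [0])], f := [[0, 64], [3, 81]],
    s := [(0, [0, 51, 65]), (3, [48]), (4, [50, 64]), (5, [3, 52, 17, 97])],
    cz := [(0, [0, 18]), (4, [3, 21]), (5, [1])],
    cu := [(3, [48, 96]), (4, [17, 48])], cf := [(1, [17])],
    bt := [0, 1, 4, 9, 10, 13] },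
  { p := [4], dg := [0], w := [20], es := [36, 11],
    us := [[2]], ks := [[6]],
    sp := [(0, [4]), (3, [2]), (6, [0])],
    zc := [(3, [0])],
    ec := [], f := [[3, 17, 49]],
    s := [(0, [49]), (1, [1, 50, 96]), (3, [97])],
    cz := [(1, [1]), (3, [2])],
    cu := [(0, [49, 98]), (3, [97])], cf := [],
    bt := [10, 13, 15] },
  { p := [4], dg := [0], w := [21], es := [38],
    us := [[0]], ks := [],
    sp := [(0, [6]), (3, [4]), (6, [2]), (9, [0])],
    zc := [],
    ec := [], f := [[3, 17]],
    s := [(0, [49]), (1, [1, 50])],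
    cz := [(1, [1])],
    cu := [(0, [49])], cf := [],
    bt := [9, 10, 11, 12, 13, 14, 15] },
  { p := [4], dg := [0], w := [11], es := [20, 13],
    us := [], ks := [[0]],
    sp := [],
    zc := [(0, [0]), (1, [2]), (2, [4]), (3, [6])],
    ec := [], f := [[3, 49]],
    s := [(0, [49]), (3, [1, 50])],
    cz := [],
    cu := [(3, [1, 97])], cf := [],
    bt := [0, 1, 2, 3, 4, 5, 6, 7] },
  { p := [4], dg := [0], w := [12], es := [21, 16],
    us := [[6]], ks := [[2]],
    sp := [(0, [0])],
    zc := [(1, [0]), (2, [2]), (3, [4])],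
    ec := [], f := [[3, 49]],
    s := [(0, [49]), (3, [1, 50]), (4, [5, 54, 96])],
    cz := [(4, [1])],
    cu := [(0, [0, 49, 98]), (3, [97])], cf := [],
    bt := [1, 2, 4, 6] },
  { p := [4], dg := [0], w := [16], es := [47],
    us := [[4]], ks := [[4]],
    sp := [(0, [2]), (3, [0])],
    zc := [(2, [0]), (3, [2])],
    ec := [], f := [[17]],
    s := [(0, [49]), (1, [1]), (2, [3, 52, 96])],
    cz := [(2, [1])],
    cu := [(0, [96]), (1, [49, 98])], cf := [],
    bt := [4, 13] },
  { p := [4, 1], dg := [0, 1], w := [19, 31], es := [41, 10],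
    us := [[2, 17]], ks := [[4, 16]],
    sp := [(0, [17]), (3, [2]), (6, [0])],
    zc := [(2, [0]), (3, [2])],
    ec := [(20, [1])], f := [[2, 17, 49], [33]],
    s := [(0, [48]), (1, [1, 50, 65]), (2, [17]), (3, [64])],
    cz := [(1, [1, 20]), (3, [2, 23])],
    cu := [(0, [17, 48, 97]), (3, [17, 97])], cf := [],
    bt := [0, 4, 9, 10, 13, 15] },
  { p := [4, 1], dg := [0, 2], w := [13, 37], es := [18, 26],
    us := [[4, 17]], ks := [[2, 16]],
    sp := [(0, [17]), (3, [0])],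
    zc := [(1, [0]), (2, [2]), (3, [4])],
    ec := [(20, [1])], f := [[1, 50], [19, 65]],
    s := [(0, [1, 50]), (1, [3, 52, 65]), (3, [48]), (4, [4, 55, 17, 97])],
    cz := [(1, [1, 18]), (4, [0])],
    cu := [(0, [17, 97]), (3, [48, 97])], cf := [(1, [17])],
    bt := [0, 1, 2, 4, 6, 9, 13] },
  { p := [4, 2], dg := [0, 1], w := [18, 30], es := [45, 15],
    us := [[2, 17], [4]], ks := [[4, 18]],
    sp := [(0, [19]), (3, [17]), (1, [2, 16]), (4, [0])],
    zc := [(2, [0]), (3, [2])],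
    ec := [(21, [1])], f := [[3, 16, 49], [33, 65]],
    s := [(0, [49]), (1, [0, 51, 64]), (2, [17, 67, 97]), (3, [64]), (4, [66, 96])],
    cz := [(1, [0, 19]), (2, [18]), (3, [2, 21]), (4, [17])],
    cu := [(0, [49, 96]), (1, [16, 65, 98]), (3, [97])], cf := [],
    bt := [4, 9, 10, 13, 14, 15] },
  { p := [4, 2], dg := [0, 1], w := [14, 26], es := [48, 29],
    us := [[4, 19]], ks := [[4], [2, 16]],
    sp := [(0, [17]), (3, [0])],
    zc := [(1, [16]), (2, [0]), (3, [20]), (6, [1, 18])],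
    ec := [(21, [17])], f := [[16, 50], [33, 65]],
    s := [(0, [64]), (1, [0, 51]), (2, [3, 52, 67, 96]), (3, [48]), (4, [2, 53, 17, 66, 97])],
    cz := [(2, [1, 18]), (4, [0, 19])],
    cu := [(0, [96]), (1, [17, 113]), (3, [17, 48, 99, 113])], cf := [],
    bt := [0, 1, 2, 4, 6, 7, 13] },
  { p := [4, 2], dg := [0, 1], w := [16, 28], es := [47, 8],
    us := [[2, 16]], ks := [[3, 16]],
    sp := [(0, [18]), (3, [16]), (6, [0])],
    zc := [(1, [1]), (2, [3]), (3, [5])],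
    ec := [(21, [2])], f := [[3, 16, 48], [33, 51]],
    s := [(0, [49]), (1, [64]), (2, [3, 52, 17, 66]), (3, [0, 51, 65])],
    cz := [(1, [3, 21]), (2, [1, 19]), (3, [0, 18])],
    cu := [(0, [49]), (1, [17, 51, 97])], cf := [],
    bt := [0, 1, 2, 4, 6, 7, 9, 10, 13, 14, 15] },
  { p := [5], dg := [0], w := [0], es := [21],
    us := [], ks := [[0]],
    sp := [],
    zc := [(0, [0]), (1, [2]), (2, [4]), (3, [6]), (4, [8])],
    ec := [], f := [[1]],
    s := [(0, [1])],
    cz := [],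
    cu := [(0, [1, 97])], cf := [],
    bt := [0, 1, 2, 3, 4, 5, 6, 7, 8] },
  { p := [5], dg := [0], w := [1], es := [26],
    us := [[8]], ks := [[2]],
    sp := [(0, [0])],
    zc := [(1, [0]), (2, [2]), (3, [4]), (4, [6])],
    ec := [], f := [[1]],
    s := [(0, [1]), (1, [6, 97])],
    cz := [(1, [0])],
    cu := [(0, [97])], cf := [],
    bt := [1, 2, 3, 4, 6] },
  { p := [5], dg := [0], w := [7], es := [32],
    us := [[6]], ks := [[4]],
    sp := [(0, [2]), (3, [0])],
    zc := [(2, [0]), (3, [2]), (4, [4])],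
    ec := [], f := [[1]],
    s := [(0, [1]), (1, [5, 96])],
    cz := [(1, [1])],
    cu := [(0, [97]), (1, [49])], cf := [],
    bt := [2, 4, 13] },
  { p := [5], dg := [0], w := [19], es := [10, 24],
    us := [[2]], ks := [[8]],
    sp := [(0, [6]), (3, [4]), (6, [2]), (9, [0])],
    zc := [(4, [0])],
    ec := [], f := [[1, 49]],
    s := [(0, [1, 96]), (3, [97])],
    cz := [(0, [1])],
    cu := [(0, [49, 98]), (3, [97])], cf := [],
    bt := [10, 11, 13, 15] },
  { p := [5], dg := [0], w := [20], es := [11],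
    us := [[0]], ks := [],
    sp := [(0, [8]), (3, [6]), (6, [4]), (9, [2]), (12, [0])],
    zc := [],
    ec := [], f := [[1]],
    s := [(0, [1])],
    cz := [(0, [1])],
    cu := [(0, [49])], cf := [],
    bt := [9, 10, 11, 12, 13, 14, 15, 16] },
  { p := [5], dg := [0], w := [13], es := [40],
    us := [[4]], ks := [[6]],
    sp := [(0, [4]), (3, [2]), (6, [0])],
    zc := [(3, [0]), (4, [2])],
    ec := [], f := [[1]],
    s := [(0, [1]), (1, [3, 96])],
    cz := [(1, [1])],
    cu := [(0, [97]), (1, [49])], cf := [],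
    bt := [13] },
  { p := [5, 1], dg := [0, 3], w := [2, 38], es := [29, 0],
    us := [[6, 16]], ks := [[3, 16]],
    sp := [(0, [16]), (3, [0])],
    zc := [(1, [1]), (2, [3]), (3, [5]), (4, [7])],
    ec := [(20, [0])], f := [[1], [19, 49]],
    s := [(0, [1]), (1, [4, 65]), (3, [7, 17, 97])],
    cz := [(1, [0, 18]), (3, [1])],
    cu := [(0, [16, 96]), (3, [49, 97])], cf := [(1, [17])],
    bt := [0, 1, 2, 3, 4, 6, 9, 13] },
  { p := [5, 1], dg := [0, 1], w := [18, 30], es := [15, 23],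
    us := [[2, 17]], ks := [[6, 16]],
    sp := [(0, [17]), (3, [4]), (6, [2]), (9, [0])],
    zc := [(3, [0]), (4, [2])],
    ec := [(20, [1])], f := [[1, 49], [17]],
    s := [(0, [1, 65]), (1, [17]), (3, [64])],
    cz := [(0, [1, 22])],
    cu := [(0, [16, 49, 96]), (3, [17, 97])], cf := [],
    bt := [0, 4, 9, 10, 11, 13, 15] },
  { p := [5, 1], dg := [0, 2], w := [10, 34], es := [43],
    us := [[4, 17]], ks := [[4, 16]],
    sp := [(0, [17]), (3, [2]), (6, [0])],
    zc := [(2, [0]), (3, [2]), (4, [4])],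
    ec := [(20, [1])], f := [[1], [33]],
    s := [(0, [1]), (1, [3, 65]), (2, [17])],
    cz := [(1, [1, 20])],
    cu := [(0, [49]), (1, [16, 49, 96])], cf := [],
    bt := [0, 2, 4, 9, 13] },
  { p := [5, 2], dg := [0, 2], w := [3, 27], es := [49, 2],
    us := [[6, 18]], ks := [[4], [3, 16]],
    sp := [(0, [16]), (3, [0])],
    zc := [(1, [17]), (2, [0]), (3, [21]), (4, [23]), (6, [0, 18])],
    ec := [(21, [16])], f := [[1], [33, 49]],
    s := [(0, [1]), (1, [65]), (2, [4, 67, 97]), (3, [5, 17, 66, 96])],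
    cz := [(2, [0, 18]), (3, [1, 19])],
    cu := [(0, [97]), (1, [16, 99, 112]), (3, [17, 49, 98, 113])], cf := [],
    bt := [0, 1, 2, 3, 4, 6, 7, 13] },
  { p := [5, 2], dg := [0, 1], w := [17, 29], es := [17, 27],
    us := [[2, 17], [4]], ks := [[6, 18]],
    sp := [(0, [19]), (3, [17]), (1, [4, 16]), (4, [2]), (7, [0])],
    zc := [(3, [0]), (4, [2])],
    ec := [(21, [1])], f := [[1, 49], [17, 65]],
    s := [(0, [1, 65]), (1, [17, 67, 97]), (3, [64]), (4, [66, 96])],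
    cz := [(0, [1, 20]), (1, [18]), (4, [17])],
    cu := [(0, [49, 96]), (1, [16, 65, 98]), (3, [97])], cf := [],
    bt := [4, 9, 10, 11, 13, 14, 15] },
  { p := [5, 2], dg := [0, 2], w := [6, 30], es := [45],
    us := [[4, 17]], ks := [[2, 16]],
    sp := [(0, [19]), (3, [17]), (6, [0])],
    zc := [(1, [0]), (2, [2]), (3, [4]), (4, [6])],
    ec := [(21, [3])], f := [[1], [19, 33]],
    s := [(0, [1]), (1, [3, 65]), (2, [4, 17, 66])],
    cz := [(1, [1, 18]), (2, [0, 19])],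
    cu := [(0, [49]), (1, [17, 97])], cf := [],
    bt := [0, 1, 2, 3, 4, 6, 7, 9, 10, 13, 14] },
  { p := [5, 2], dg := [0, 2], w := [8, 32], es := [42, 3],
    us := [[4, 17], [6]], ks := [[4, 18]],
    sp := [(0, [19]), (3, [17]), (1, [2, 16]), (4, [0])],
    zc := [(2, [0]), (3, [2]), (4, [4])],
    ec := [(21, [1])], f := [[1], [19, 32, 49]],
    s := [(0, [1]), (1, [3, 65]), (2, [67, 97]), (3, [4, 17, 97])],
    cz := [(1, [1, 18]), (2, [16]), (3, [0])],
    cu := [(0, [97]), (1, [65]), (3, [48, 97])], cf := [],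
    bt := [2, 4, 9, 10, 13, 14] },
  { p := [5, 2], dg := [0, 1], w := [12, 24], es := [25, 46],
    us := [[4, 18]], ks := [[6], [5, 16]],
    sp := [(0, [16]), (3, [2]), (6, [0])],
    zc := [(2, [17]), (3, [0]), (4, [21]), (6, [0, 18])],
    ec := [(21, [16])], f := [[1, 48], [81]],
    s := [(0, [65]), (3, [0, 65]), (4, [2, 67, 97]), (5, [17])],
    cz := [(4, [0, 20])],
    cu := [(0, [16, 112]), (3, [96]), (4, [16, 48, 112])], cf := [],
    bt := [0, 1, 2, 4, 7, 13] },
  { p := [5, 2], dg := [0, 1], w := [14, 26], es := [48],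
    us := [[2, 17]], ks := [[4, 16]],
    sp := [(0, [19]), (3, [17]), (6, [2]), (9, [0])],
    zc := [(2, [0]), (3, [2]), (4, [4])],
    ec := [(21, [3])], f := [[0, 16], [33]],
    s := [(0, [65]), (1, [0, 64]), (2, [17])],
    cz := [(1, [0, 21])],
    cu := [(0, [48]), (1, [16, 96])], cf := [],
    bt := [0, 1, 2, 4, 7, 9, 10, 11, 13, 14, 15] },
  { p := [5, 3], dg := [0, 1], w := [6, 18], es := [22, 45],
    us := [[6, 20]], ks := [[4], [3, 16]],
    sp := [(0, [16]), (3, [0])],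
    zc := [(1, [17]), (2, [0]), (3, [2]), (4, [23]), (6, [0, 18]), (7, [2, 20])],
    ec := [(22, [16])], f := [[1, 48], [65]],
    s := [(0, [65]), (3, [0, 65]), (4, [17]), (5, [4, 18, 69, 97])],
    cz := [(5, [0, 18])],
    cu := [(0, [16, 112]), (3, [96]), (4, [16, 48, 112])], cf := [],
    bt := [0, 1, 2, 3, 4, 5, 6, 7, 13] },
  { p := [5, 3], dg := [0, 1], w := [9, 21], es := [37, 38],
    us := [[4, 18]], ks := [[6], [3, 16]],
    sp := [(0, [18]), (3, [16]), (6, [0])],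
    zc := [(1, [17]), (2, [19]), (3, [0]), (4, [23]), (7, [0, 20])],
    ec := [(22, [18])], f := [[1, 49], [17, 65]],
    s := [(0, [65]), (1, [3, 17, 66, 96]), (3, [1, 64]), (4, [2, 67, 97])],
    cz := [(1, [1, 19]), (4, [0, 18])],
    cu := [(0, [49, 98]), (1, [16, 112]), (3, [97])], cf := [],
    bt := [0, 1, 2, 3, 4, 5, 6, 7, 10, 13] },
  { p := [5, 3], dg := [0, 1], w := [10, 22], es := [43, 39],
    us := [[4, 18], [6]], ks := [[6], [5, 18]],
    sp := [(0, [18]), (3, [16]), (1, [2, 17]), (4, [0])],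
    zc := [(2, [17]), (3, [0]), (4, [21]), (7, [0, 18])],
    ec := [(22, [16])], f := [[0, 49], [17, 65]],
    s := [(0, [64]), (1, [3, 17, 66, 96]), (2, [68, 112]), (3, [1, 64]), (4, [2, 67, 97])],
    cz := [(1, [1, 19]), (2, [17]), (4, [0, 18])],
    cu := [(0, [113]), (1, [49, 98, 113]), (3, [97]), (4, [17, 65, 115])], cf := [],
    bt := [1, 2, 4, 10, 13] },
  { p := [5, 3], dg := [0, 1], w := [10, 22], es := [39, 12],
    us := [[2, 16]], ks := [[3, 16]],
    sp := [(0, [20]), (3, [18]), (6, [16]), (9, [0])],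
    zc := [(1, [1]), (2, [3]), (3, [5]), (4, [7])],
    ec := [(22, [4])], f := [[1, 48], [17, 51]],
    s := [(0, [65]), (1, [3, 17, 66]), (3, [0, 65])],
    cz := [(1, [1, 19]), (3, [0, 18])],
    cu := [(0, [49]), (1, [16, 96])], cf := [],
    bt := [0, 1, 2, 3, 4, 5, 6, 7, 9, 10, 11, 12, 13, 14, 15] },
  { p := [5, 3], dg := [0, 1], w := [11, 23], es := [13, 44],
    us := [[2, 16], [6]], ks := [[5, 18]],
    sp := [(0, [20]), (3, [18]), (6, [16]), (1, [2, 17]), (4, [0])],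
    zc := [(2, [1]), (3, [3]), (4, [5])],
    ec := [(22, [2])], f := [[0, 49], [3, 65]],
    s := [(0, [0, 65]), (3, [65]), (4, [3, 17, 66]), (5, [69, 97])],
    cz := [(0, [0, 18]), (4, [1, 19]), (5, [16])],
    cu := [(0, [16, 64, 98]), (3, [49]), (4, [96])], cf := [],
    bt := [1, 2, 4, 9, 10, 11, 12, 13, 14, 15] },
  { p := [5, 3], dg := [0, 1], w := [14, 26], es := [7, 48],
    us := [[2, 17], [4]], ks := [[6, 20]],
    sp := [(0, [21]), (3, [19]), (6, [17]), (1, [4, 18]), (4, [2, 16]), (7, [0])],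
    zc := [(3, [0]), (4, [2])],
    ec := [(22, [1])], f := [[48], [1, 67, 81]],
    s := [(0, [2, 17, 97]), (3, [0]), (4, [1, 65]), (5, [66, 96])],
    cz := [(0, [0]), (4, [1, 18]), (5, [17])],
    cu := [(0, [48, 97]), (3, [96]), (4, [64])], cf := [],
    bt := [4, 9, 10, 11, 12, 13, 14, 15] },
  { p := [5, 3, 1], dg := [0, 1, 2], w := [8, 20, 32], es := [42, 36],
    us := [[4, 19, 32]], ks := [[5, 32], [2, 16]],
    sp := [(0, [32]), (3, [17]), (6, [0])],
    zc := [(1, [16]), (2, [1]), (3, [3]), (4, [22]), (6, [0, 18]), (7, [2, 20])],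
    ec := [(22, [19]), (40, [0])], f := [[1, 48], [17, 65], [33]],
    s := [(0, [64]), (1, [2, 17, 66, 81]), (2, [33]), (3, [0, 64]), (4, [3, 67, 80])],
    cz := [(1, [0, 19, 36]), (4, [1, 18, 37])],
    cu := [(0, [33, 49, 97]), (1, [17, 113]), (3, [33, 97])], cf := [],
    bt := [0, 1, 2, 3, 4, 5, 6, 7, 9, 10, 13] },
  { p := [5, 3, 1], dg := [0, 1, 2], w := [9, 21, 33], es := [28, 37, 9],
    us := [[4, 19, 32], [6]], ks := [[4, 18], [5, 32]],
    sp := [(0, [32]), (3, [17]), (1, [2, 16]), (4, [0])],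
    zc := [(2, [17]), (3, [19]), (4, [21]), (6, [0, 16]), (7, [2, 18])],
    ec := [(22, [1]), (40, [16])], f := [[0, 48], [65, 96], [17, 113]],
    s := [(0, [65]), (1, [69, 97]), (3, [0, 64]), (4, [3, 67, 80]), (6, [3, 16, 67, 80]), (7, [68, 33, 96])],
    cz := [(1, [16]), (4, [1, 18, 37]), (6, [1, 18, 37]), (7, [17])],
    cu := [(0, [96]), (3, [33, 113]), (4, [17, 64, 99]), (6, [33, 49, 96, 113])], cf := [],
    bt := [0, 1, 2, 4, 9, 10, 13] },
  { p := [5, 3, 1], dg := [0, 1, 2], w := [11, 23, 35], es := [44, 33, 6],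
    us := [[4, 33], [18, 33]], ks := [[6], [4, 18, 32]],
    sp := [(0, [19, 33]), (3, [2]), (6, [0]), (1, [18]), (4, [16])],
    zc := [(2, [16]), (3, [0]), (4, [20]), (7, [1, 18])],
    ec := [(22, [17, 64]), (40, [17])], f := [[1, 48], [16, 65, 97], [33, 67]],
    s := [(0, [1, 65]), (1, [2, 66, 97]), (2, [69, 33, 113]), (3, [65]), (4, [66, 81]), (6, [2, 17, 80, 97])],
    cz := [(1, [0, 19]), (2, [16]), (4, [17, 34]), (6, [0, 37])],
    cu := [(0, [97]), (1, [49, 112]), (3, [32, 112]), (6, [33, 48, 65, 99, 113])], cf := [(2, [33])],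
    bt := [0, 1, 2, 4, 9, 10, 13] },
  { p := [5, 3, 1], dg := [0, 1, 2], w := [12, 24, 36], es := [16, 46],
    us := [[2, 16], [4, 33]], ks := [[4, 19, 32]],
    sp := [(0, [20]), (3, [18]), (6, [16]), (1, [33]), (4, [2, 17]), (7, [0])],
    zc := [(2, [0]), (3, [2]), (4, [4])],
    ec := [(22, [3]), (40, [49])], f := [[1, 49], [2, 64], [17, 83]],
    s := [(0, [1, 64]), (1, [68, 33, 97]), (3, [65]), (4, [2, 16, 67]), (5, [67, 81])],
    cz := [(0, [1, 19]), (1, [17]), (4, [0, 18]), (5, [16, 34])],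
    cu := [(0, [65, 96]), (3, [49]), (4, [33, 97])], cf := [(2, [33])],
    bt := [0, 1, 2, 4, 9, 10, 11, 12, 13, 14, 15] },
  { p := [5, 3, 2], dg := [0, 1, 2], w := [7, 19, 31], es := [32, 5, 41],
    us := [[4, 19, 33], [6, 21]], ks := [[4, 34], [2, 16]],
    sp := [(0, [35]), (3, [33]), (1, [17, 32]), (4, [0])],
    zc := [(1, [16]), (2, [0]), (3, [2]), (4, [22]), (6, [1, 18]), (7, [3, 20])],
    ec := [(22, [65]), (36, [19, 64]), (41, [1])], f := [[1, 96], [48, 112], [17, 51, 129]],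
    s := [(0, [64]), (1, [4, 19, 68, 33, 97]), (3, [3, 16, 67, 81]), (6, [0, 64]), (7, [2, 66, 80]), (8, [82, 96])],
    cz := [(1, [0, 19]), (3, [1, 18, 34]), (7, [0, 19, 35]), (8, [33])],
    cu := [(0, [49, 96]), (1, [17, 113]), (3, [16, 32, 65, 98, 112]), (6, [96])], cf := [],
    bt := [0, 1, 2, 3, 4, 5, 6, 7, 9, 10, 13, 14] },
  { p := [5, 3, 2], dg := [0, 1, 1], w := [13, 25, 25], es := [34, 40, 18],
    us := [[2, 17], [4, 35]], ks := [[6, 20], [4, 18, 32]],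
    sp := [(0, [21]), (3, [19]), (6, [17]), (1, [33]), (4, [2, 16]), (7, [0])],
    zc := [(2, [16]), (3, [0]), (4, [20]), (11, [1, 18])],
    ec := [(22, [1]), (26, [0, 19]), (41, [65])], f := [[1, 49, 97], [17, 65, 99], [17, 113]],
    s := [(0, [64, 81]), (1, [66, 83, 96]), (3, [80]), (4, [2, 17, 82, 97]), (6, [1, 65]), (7, [67, 33, 82, 97])],
    cz := [(1, [17, 34]), (4, [0, 37]), (6, [1, 18]), (7, [16, 35])],
    cu := [(0, [97]), (3, [49, 96]), (4, [33, 113]), (6, [32, 65, 98, 112])], cf := [],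
    bt := [0, 1, 2, 4, 7, 9, 10, 11, 12, 13, 14, 15] },
  { p := [5, 4, 2], dg := [0, 1, 2], w := [5, 17, 29], es := [17, 35, 31],
    us := [[4, 19, 32], [6, 34]], ks := [[4, 20], [3, 32]],
    sp := [(0, [34]), (3, [19]), (6, [17]), (1, [18, 32]), (4, [0, 16])],
    zc := [(1, [17]), (2, [19]), (3, [21]), (4, [23]), (7, [0, 18]), (8, [2, 20])],
    ec := [(18, [18, 65]), (23, [1, 19, 64]), (41, [64])], f := [[49, 96], [1, 51, 65], [17, 67, 113]],
    s := [(0, [17, 80]), (1, [5, 33, 82, 96]), (3, [1, 65]), (4, [2, 66, 81]), (6, [65]), (7, [69, 97])],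
    cz := [(0, [3, 18, 37]), (1, [1, 35]), (4, [0, 17, 34]), (7, [16])],
    cu := [(0, [48, 97]), (1, [33, 50, 65, 113]), (3, [32, 112]), (6, [96])], cf := [],
    bt := [0, 1, 2, 3, 4, 6, 7, 9, 10, 13, 14, 15] },
  { p := [5, 4, 2], dg := [0, 0, 1], w := [15, 15, 27], es := [14, 19, 49],
    us := [[2, 18, 32], [4]], ks := [[7, 20], [19, 32]],
    sp := [(0, [34]), (3, [32]), (6, [16]), (1, [4, 33]), (4, [2, 17]), (7, [0])],
    zc := [(3, [1, 19]), (4, [3, 21]), (6, [17]), (7, [19]), (8, [21])],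
    ec := [(8, [65]), (23, [0, 64]), (41, [0, 18])], f := [[0, 112], [1, 49, 99], [65, 129]],
    s := [(0, [0, 81]), (3, [1, 17, 66, 80]), (4, [69, 33, 83, 97]), (6, [65]), (7, [80]), (8, [68, 82, 96])],
    cz := [(0, [0, 18, 36]), (3, [1, 19, 37]), (4, [16, 34]), (8, [17, 35])],
    cu := [(0, [32, 64, 112]), (3, [49, 97]), (6, [96]), (7, [33, 98, 113])], cf := [],
    bt := [0, 1, 2, 4, 6, 7, 9, 10, 11, 13, 14, 15] },
  { p := [5, 5, 2], dg := [0, 1, 2], w := [4, 16, 28], es := [47, 30],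
    us := [[4, 19, 32], [6, 34]], ks := [[4, 22], [3, 32]],
    sp := [(0, [34]), (3, [21]), (6, [19]), (9, [17]), (1, [20, 32]), (4, [0, 18])],
    zc := [(1, [17]), (2, [19]), (3, [21]), (4, [23]), (8, [0, 18]), (9, [2, 20])],
    ec := [(18, [18, 65]), (19, [20]), (24, [1, 19, 64]), (41, [64])], f := [[1], [17, 49], [33, 65]],
    s := [(0, [1]), (1, [81]), (2, [4, 83, 97]), (3, [17, 80]), (4, [5, 33, 82, 96])],
    cz := [(1, [2, 17, 36]), (2, [0, 34]), (4, [1, 35])],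
    cu := [(0, [97]), (1, [32, 99, 112]), (3, [48, 97]), (4, [33, 50, 65, 113])], cf := [],
    bt := [0, 1, 2, 3, 4, 6, 7, 9, 10, 11, 13, 14, 15] }]

/-- Entry of the table. -/
def D (i : ℕ) : Dat := tbl.getD i (tbl.headD { p := [], dg := [], w := [], es := [], us := [], ks := [], sp := [], zc := [], ec := [], f := [], s := [], cz := [], cu := [], cf := [], bt := [] })


theorem ok1 : ∀ d ∈ tbl, d.Ok1 := by decide +kernel

theorem ok2 : ∀ d ∈ tbl, d.Ok2 := by decide +kernel

theorem ok3 : ∀ d ∈ tbl, d.Ok3 := by decide +kernel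

theorem ok4 : ∀ d ∈ tbl, d.Ok4 D := by decide +kernel

theorem ok5 : ∀ d ∈ tbl, d.Ok5 := by decide +kernel

theorem bt_inj : ∀ i < 50, ∀ j < 50, (D i).bt = (D j).bt →
    i = j ∨ (i = 42 ∧ j = 43) ∨ (i = 43 ∧ j = 42) := by decide +kernel

theorem sizes : ∀ i < 50, (i < 2 ↔ ∀ r < 3, (D i).P r ≤ 1) ∧ (i < 5 ↔ ∀ r < 3, (D i).P r ≤ 2) ∧
    (i < 10 ↔ ∀ r < 3, (D i).P r ≤ 3) ∧ (i < 20 ↔ ∀ r < 3, (D i).P r ≤ 4) := by decide +kernel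


/-! ### The objects attached to the data -/

section Obj

universe v

variable (K : Type v) [Field K] (d : Dat)

/-- The space: families of coordinates `v i a`, zero for `a ≥ P i`. -/
def VS : Submodule K (ℕ → ℕ → K) where
  carrier := {v | ∀ i a, d.P i ≤ a → v i a = 0}
  zero_mem' := fun _ _ _ => rfl
  add_mem' := fun {v w} hv hw i a h => by simp [hv i a h, hw i a h]
  smul_mem' := fun c v hv i a h => by simp [hv i a h]

/-- The operator: shift of coordinates. -/
def TD : VS K d →ₗ[K] VS K d where
  toFun v := ⟨fun i a => v.1 i (a + 1), fun i a h => v.2 i (a + 1) (by omega)⟩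
  map_add' _ _ := rfl
  map_smul' _ _ := rfl

/-- The coordinate functional. -/
def crd (i a : ℕ) : VS K d →ₗ[K] K where
  toFun v := v.1 i a
  map_add' _ _ := rfl
  map_smul' _ _ := rfl

variable {K} {d}

theorem VS_ext {v w : VS K d} (h : ∀ i a, crd K d i a v = crd K d i a w) : v = w := by
  apply Subtype.ext
  funext i a
  exact h i a

theorem crd_null (v : VS K d) {i a : ℕ} (h : d.P i ≤ a) : crd K d i a v = 0 := v.2 i a h

theorem crd_T (v : VS K d) (i a : ℕ) : crd K d i a (TD K d v) = crd K d i (a + 1) v := rfl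

theorem crd_Tpow (v : VS K d) (b i a : ℕ) :
    crd K d i a ((TD K d ^ b) v) = crd K d i (a + b) v := by
  induction b generalizing v with
  | zero => simp
  | succ b ih =>
    rw [pow_succ]
    show crd K d i a ((TD K d ^ b) (TD K d v)) = _
    rw [ih, crd_T]
    congr 1

theorem P_ge {d : Dat} {i : ℕ} (h : 3 ≤ i) : d.P i = 0 := by
  unfold Dat.P; rw [if_neg (by omega)]

variable (K) (d)

instance finVS : FiniteDimensional K (VS K d) := by
  let F : VS K d →ₗ[K] ((i : Fin 3) → Fin (d.P i) → K) :=
    LinearMap.pi fun i => LinearMap.pi fun a => crd K d i a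
  apply FiniteDimensional.of_injective F
  intro v w h
  apply VS_ext
  intro i a
  by_cases hi : i < 3
  · by_cases ha : a < d.P i
    · exact congrFun (congrFun h ⟨i, hi⟩) ⟨a, ha⟩
    · rw [crd_null v (by omega), crd_null w (by omega)]
  · have := P_ge (d := d) (i := i) (by omega)
    rw [crd_null v (by omega), crd_null w (by omega)]

/-- The subspace: solutions of the equations. -/
def UD : Submodule K (VS K d) where
  carrier := {v | ∀ j c, ev (fun a i => crd K d i a v) (sc 1 c (d.q j)) = 0}
  zero_mem' := fun j c => by simpa using ev_zero_fun _
  add_mem' := fun {v w} hv hw j c => by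
    have h1 := hv j c
    have h2 := hw j c
    have : ∀ l : Lin, ev (fun a i => crd K d i a (v + w)) l =
        ev (fun a i => crd K d i a v) l + ev (fun a i => crd K d i a w) l := by
      intro l
      induction l with
      | nil => simp
      | cons t l ih => rw [ev_cons, ev_cons, ev_cons, ih, map_add, smul_add]; abel
    rw [this, h1, h2, add_zero]
  smul_mem' := fun x v hv j c => by
    have h1 := hv j c
    have : ∀ l : Lin, ev (fun a i => crd K d i a (x • v)) l =
        x • ev (fun a i => crd K d i a v) l := by
      intro l
      induction l with
      | nil => simp
      | cons t l ih => rw [ev_cons, ev_cons, ih, map_smul, smul_add, smul_comm x]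
    rw [this, h1, smul_zero]

/-- The generators. -/
def gD (i : ℕ) : VS K d :=
  ⟨fun i' a => if i' = i ∧ a + 1 = d.P i then 1 else 0, fun i' a h => by
    show (if _ then _ else _) = _
    rw [if_neg]
    rintro ⟨rfl, h'⟩
    omega⟩

variable {K} {d}

theorem mem_UD {v : VS K d} :
    v ∈ UD K d ↔ ∀ j c, ev (fun a i => crd K d i a v) (sc 1 c (d.q j)) = 0 := Iff.rfl

theorem sc_sc (c c' : ℤ) (b b' : ℕ) (l : Lin) :
    sc c b (sc c' b' l) = sc (c * c') (b' + b) l := by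
  simp [sc, mul_assoc, add_assoc, Function.comp_def]

theorem ev_crd_Tpow (v : VS K d) (b : ℕ) (l : Lin) :
    ev (fun a i => crd K d i a ((TD K d ^ b) v)) l = ev (fun a i => crd K d i a v) (sc 1 b l) := by
  rw [ev_sc, one_smul]
  congr 1
  funext a i
  rw [crd_Tpow]

theorem TD_U : ∀ x ∈ UD K d, TD K d x ∈ UD K d := by
  intro x hx j c
  have := ev_crd_Tpow x 1 (sc 1 c (d.q j))
  rw [pow_one] at this
  rw [this, sc_sc]
  exact hx j (c + 1)

theorem crd_g (i a r : ℕ) :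
    crd K d i a (gD K d r) = if i = r ∧ a + 1 = d.P r then 1 else 0 := rfl

theorem crd_ev (i a : ℕ) (l : Lin) :
    crd K d i a (evT (TD K d) (gD K d) l) = (d.coef i a l : K) := by
  unfold evT
  rw [← LinearMap.toAddMonoidHom_coe, map_ev]
  induction l with
  | nil => simp [Dat.coef]
  | cons t l ih =>
    rw [ev_cons, ih, Dat.coef]
    push_cast
    congr 1
    simp only [LinearMap.toAddMonoidHom_coe, crd_Tpow, crd_g]
    by_cases h : t.2.2 = i
    · subst h
      simp
    · rw [if_neg, if_neg]
      · simp
      · tauto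
      · rintro ⟨rfl, _⟩; exact h rfl

theorem ev_crd_ev (m l : Lin) :
    ev (fun a i => crd K d i a (evT (TD K d) (gD K d) l)) m = (d.val l m : K) := by
  induction m with
  | nil => simp [Dat.val]
  | cons t m ih =>
    rw [ev_cons, ih, Dat.val, crd_ev]
    push_cast
    simp

theorem Tpow_g (i : ℕ) : (TD K d ^ d.P i) (gD K d i) = 0 := by
  apply VS_ext
  intro i' a
  rw [crd_Tpow, crd_g, if_neg (by omega), map_zero]

/-- Standard expansion. -/
theorem expand (v : VS K d) :
    v = ∑ i ∈ Finset.range 3, ∑ a ∈ Finset.range (d.P i),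
      crd K d i a v • (TD K d ^ (d.P i - 1 - a)) (gD K d i) := by
  apply VS_ext
  intro i a
  simp only [map_sum, map_smul, crd_Tpow, crd_g, smul_eq_mul]
  by_cases h : a < d.P i
  · have hi : i < 3 := by
      by_contra h'
      rw [P_ge (by omega)] at h
      omega
    rw [Finset.sum_eq_single_of_mem i (by simpa using hi), Finset.sum_eq_single_of_mem a (by simpa using h)]
    · rw [if_pos ⟨rfl, by omega⟩, mul_one]
    · intro b hb hba
      rw [Finset.mem_range] at hb
      rw [if_neg (by omega), mul_zero]
    · intro r _ hr
      apply Finset.sum_eq_zero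
      intro b _
      rw [if_neg (by tauto), mul_zero]
  · rw [crd_null v (by omega)]
    symm
    apply Finset.sum_eq_zero
    intro r _
    apply Finset.sum_eq_zero
    intro b hb
    rw [Finset.mem_range] at hb
    rw [if_neg, mul_zero]
    rintro ⟨rfl, h'⟩
    omega

theorem uD_mem (h : d.Ok1) (j : ℕ) : evT (TD K d) (gD K d) (d.u j) ∈ UD K d := by
  obtain ⟨⟨hu, hk, -⟩, hp, -, hv, -⟩ := h
  intro j' c
  by_cases hj : j < 3
  · by_cases hj' : j' < 3
    · by_cases hc : c < 5
      · rw [ev_crd_ev, hv j hj j' hj' c hc]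
        simp
      · rw [ev_sc, one_smul]
        apply ev_zero_of
        intro t _
        right
        apply crd_null
        by_cases hi : t.2.2 < 3
        · have := (hp _ hi).1; omega
        · rw [P_ge (by omega)]; omega
    · have : d.q j' = [] := by
        unfold Dat.q
        rw [List.getD_eq_default _ _ (by omega)]; rfl
      rw [this]; rfl
  · have : d.u j = [] := by
      unfold Dat.u
      rw [List.getD_eq_default _ _ (by omega)]; rfl
    rw [this]
    exact (UD K d).zero_mem j' c

theorem span_U (h : d.Ok1) (h2 : d.Ok2) {v : VS K d} (hv : v ∈ UD K d) :
    v = (d.sp.map fun e => ev (fun a i => crd K d i a v) (e.2.map dec) •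
      (TD K d ^ (e.1 / 3)) (evT (TD K d) (gD K d) (d.u (e.1 % 3)))).sum := by
  apply VS_ext
  intro i a
  rw [map_list_sum, List.map_map]
  by_cases ha : a < d.P i
  · have hi : i < 3 := by
      by_contra h'
      rw [P_ge (by omega)] at ha
      omega
    have ha5 : a < 5 := by have := (h.2.1 i hi).1; omega
    have := zchk_sound (h2 i hi a ha5 ha) (fun a i => crd K d i a v)
      (fun a i hn => crd_null v (by simpa [Dat.nullC] using hn))
    rw [ev_append, ev_append, ev_flatMap, ev_flatMap] at this
    have hz : ((look (5 * i + a) d.zc).map fun t => ev (fun a i => crd K d i a v)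
        (sc (-t.1) t.2.1 (d.q t.2.2))).sum = 0 := by
      apply List.sum_eq_zero
      intro x hx
      obtain ⟨t, _, rfl⟩ := List.mem_map.1 hx
      have h3 := hv t.2.2 t.2.1
      have h4 : sc (-t.1) t.2.1 (d.q t.2.2) = sc (-t.1) 0 (sc 1 t.2.1 (d.q t.2.2)) := by
        simp [sc_sc]
      rw [h4, ev_sc]
      show (-t.1) • ev (fun a i => crd K d i a v) _ = 0
      rw [h3, smul_zero]
    rw [hz, add_zero] at this
    simp only [ev_cons, ev_nil, add_zero, one_smul] at this
    rw [eq_neg_of_add_eq_zero_left this, List.sum_neg]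
    congr 1
    rw [List.map_map]
    apply List.map_congr_left
    intro e _
    simp only [Function.comp_apply, map_smul]
    rw [ev_sc]
    have h5 : (TD K d ^ (e.1 / 3)) (evT (TD K d) (gD K d) (d.u (e.1 % 3))) =
        evT (TD K d) (gD K d) (sc 1 (e.1 / 3) (d.u (e.1 % 3))) := by
      rw [evT_sc, one_smul]
    rw [h5, crd_ev]
    simp only [add_zero, neg_smul, neg_neg]
    rw [zsmul_eq_mul, smul_eq_mul, mul_comm]
  · rw [crd_null v (by omega)]
    symm
    apply List.sum_eq_zero
    intro x hx
    obtain ⟨t, _, rfl⟩ := List.mem_map.1 hx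
    exact crd_null _ (by omega)

end Obj


/-! ### Morphisms out of the objects -/

section Hom

universe v

variable {K : Type v} [Field K] {d : Dat}
variable {V : Type*} [AddCommGroup V] [Module K V] {T : V →ₗ[K] V} {U : Submodule K V}

/-- Morphisms of triples. -/
structure IsMor {V : Type*} [AddCommGroup V] [Module K V] {V' : Type*} [AddCommGroup V']
    [Module K V'] (T : V →ₗ[K] V) (U : Submodule K V) (T' : V' →ₗ[K] V') (Z : Submodule K V')
    (f : V →ₗ[K] V') : Prop where
  comm : ∀ v, f (T v) = T' (f v)
  sub : ∀ v ∈ U, f v ∈ Z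

/-- The linear map determined by images of generators. -/
def outM (T : V →ₗ[K] V) (d : Dat) (y : ℕ → V) : VS K d →ₗ[K] V :=
  ∑ i ∈ Finset.range 3, ∑ a ∈ Finset.range (d.P i),
    (crd K d i a).smulRight ((T ^ (d.P i - 1 - a)) (y i))

theorem outM_apply (y : ℕ → V) (v : VS K d) :
    outM T d y v = ∑ i ∈ Finset.range 3, ∑ a ∈ Finset.range (d.P i),
      crd K d i a v • (T ^ (d.P i - 1 - a)) (y i) := by
  simp [outM, LinearMap.sum_apply]

theorem outM_comm {y : ℕ → V} (hy : ∀ i < 3, (T ^ d.P i) (y i) = 0) (v : VS K d) :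
    outM T d y (TD K d v) = T (outM T d y v) := by
  rw [outM_apply, outM_apply, map_sum]
  apply Finset.sum_congr rfl
  intro i hi
  rw [Finset.mem_range] at hi
  have h0 := hy i hi
  have hn : ∀ a, d.P i ≤ a → crd K d i a v = 0 := fun a h => crd_null v h
  rw [map_sum]
  simp only [map_smul, crd_T]
  generalize d.P i = p at *
  cases p with
  | zero => simp
  | succ p =>
    rw [Finset.sum_range_succ, Finset.sum_range_succ', hn (p + 1) le_rfl, zero_smul, add_zero]
    have h1 : T ((T ^ (p + 1 - 1 - 0)) (y i)) = 0 := by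
      rw [← h0, pow_succ']; rfl
    rw [h1, smul_zero, add_zero]
    apply Finset.sum_congr rfl
    intro a ha
    rw [Finset.mem_range] at ha
    have h2 : p + 1 - 1 - a = (p + 1 - 1 - (a + 1)) + 1 := by omega
    rw [h2, pow_succ']
    rfl

theorem outM_g {y : ℕ → V} (hy : ∀ i < 3, (T ^ d.P i) (y i) = 0) {i : ℕ} (hi : i < 3) :
    outM T d y (gD K d i) = y i := by
  rw [outM_apply, Finset.sum_eq_single_of_mem i (by simpa using hi)]
  · have h0 := hy i hi
    by_cases hp : d.P i = 0
    · rw [hp] at h0 ⊢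
      simpa using h0.symm
    · rw [Finset.sum_eq_single_of_mem (d.P i - 1) (by simp; omega)]
      · rw [crd_g, if_pos ⟨rfl, by omega⟩]
        simp
      · intro a _ ha
        rw [crd_g, if_neg (by omega), zero_smul]
  · intro r _ hr
    apply Finset.sum_eq_zero
    intro a _
    rw [crd_g, if_neg (by tauto), zero_smul]

theorem u_lt (h : d.Ok1) {j : ℕ} (hj : ¬ j < 3) : d.u j = [] := by
  have := h.1.1
  unfold Dat.u
  rw [List.getD_eq_default _ _ (by omega)]; rfl

theorem q_lt (h : d.Ok1) {j : ℕ} (hj : ¬ j < 3) : d.q j = [] := by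
  have := h.1.2.1
  unfold Dat.q
  rw [List.getD_eq_default _ _ (by omega)]; rfl

/-- A linear map commuting with the operators and sending generators of the subspace into the
subspace is a morphism. -/
theorem mor_of_u (h : d.Ok1) (h2 : d.Ok2) (hU : ∀ x ∈ U, T x ∈ U) {f : VS K d →ₗ[K] V}
    (hf : ∀ v, f (TD K d v) = T (f v))
    (hu : ∀ j, evT T (fun i => f (gD K d i)) (d.u j) ∈ U) :
    IsMor (TD K d) (UD K d) T U f := by
  refine ⟨hf, fun v hv => ?_⟩
  rw [span_U h h2 hv, map_list_sum]
  apply list_sum_mem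
  intro x hx
  rw [List.map_map] at hx
  obtain ⟨e, _, rfl⟩ := List.mem_map.1 hx
  simp only [Function.comp_apply, map_smul]
  apply U.smul_mem
  rw [comm_pow hf, map_evT hf]
  exact pow_mem hU _ _ (hu _)

/-- The endomorphism lemma. -/
theorem end_local (h : d.Ok1) (h3 : d.Ok3) {e : VS K d →ₗ[K] VS K d}
    (he : IsMor (TD K d) (UD K d) (TD K d) (UD K d) e)
    (hl : crd K d 0 (d.P 0 - 1) (e (gD K d 0)) ≠ 0) : Function.Injective e := by
  set lam := crd K d 0 (d.P 0 - 1) (e (gD K d 0)) with hlam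
  set x : ℕ → ℕ → K := fun a g => crd K d (g % 3) a (e (gD K d (g / 3))) with hx
  have hnull1 : ∀ i i' a, d.P i ≤ a → crd K d i' a (e (gD K d i)) = 0 := by
    intro i i' a hia
    obtain ⟨b, rfl⟩ := Nat.exists_eq_add_of_le hia
    rw [add_comm, ← crd_Tpow, ← comm_pow he.comm, Tpow_g, map_zero, map_zero]
  have hnull : ∀ a g, d.nullE a g = true → x a g = 0 := by
    intro a g hn
    simp only [Dat.nullE, Bool.or_eq_true, decide_eq_true_eq] at hn
    rcases hn with hn | hn
    · exact hnull1 _ _ _ hn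
    · exact crd_null _ hn
  have heq : ∀ i j c, ev x (d.eqn i j c) = 0 := by
    intro i j c
    by_cases hj : j < 3
    swap
    · unfold Dat.eqn
      rw [q_lt h hj, ev_flatMap]
      simp
    have h1 := he.sub _ (uD_mem (K := K) h i) j c
    rw [map_evT he.comm] at h1
    have h2 : ∀ (l m : Lin), (∀ t ∈ m, t.2.2 < 3) →
        ev x (l.flatMap fun t => m.map fun r =>
          (t.1 * r.1, t.2.1 + (r.2.1 + c), 3 * t.2.2 + r.2.2)) =
        ev (fun a i => crd K d i a (evT (TD K d) (fun g => e (gD K d g)) l)) (sc 1 c m) := by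
      intro l m hm
      induction m with
      | nil => rw [ev_flatMap]; simp [sc]
      | cons r m ih =>
        have hs : sc 1 c (r :: m) = (1 * r.1, r.2.1 + c, r.2.2) :: sc 1 c m := rfl
        rw [hs, ev_cons, ← ih fun t ht => hm t (by simp [ht])]
        have h5 : crd K d r.2.2 (r.2.1 + c) (evT (TD K d) (fun g => e (gD K d g)) l) =
            (l.map fun t => t.1 • x (t.2.1 + (r.2.1 + c)) (3 * t.2.2 + r.2.2)).sum := by
          unfold evT
          rw [← LinearMap.toAddMonoidHom_coe, map_ev, ev_eq_sum]
          congr 1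
          apply List.map_congr_left
          intro t _
          have h6 := hm r (by simp)
          have h7 : (3 * t.2.2 + r.2.2) % 3 = r.2.2 := by omega
          have h8 : (3 * t.2.2 + r.2.2) / 3 = t.2.2 := by omega
          simp only [hx, h7, h8, LinearMap.toAddMonoidHom_coe, crd_Tpow]
          rw [add_comm t.2.1]
        simp only [h5]
        rw [ev_flatMap, ev_flatMap, List.smul_sum, List.map_map, ← List.sum_map_add]
        congr 1
        apply List.map_congr_left
        intro t _
        simp [mul_smul, mul_comm]
    rw [← h2 _ _ (h.2.2.1 j hj)] at h1
    exact h1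
  have key : ∀ i < 3, ∀ i' < 3, ∀ a, d.G i' + d.P i' ≤ d.G i + a + 1 → a < d.P i → a < d.P i' →
      crd K d i' a (e (gD K d i)) = if i' = i ∧ a + 1 = d.P i then lam else 0 := by
    intro i hi i' hi' a h1 h2 h4
    have ha : a < 5 := by have := (h.2.1 i hi).1; omega
    have := zchk_sound (h3 i hi i' hi' a ha ⟨h2, h4, h1⟩) x hnull
    rw [ev_append, ev_append, ev_flatMap] at this
    have hz : ((look (15 * i + 5 * i' + a) d.ec).map fun t =>
        ev x (sc (-t.1) 0 (d.eqn (t.2.2 / 3) (t.2.2 % 3) t.2.1))).sum = 0 := by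
      apply List.sum_eq_zero
      intro y hy
      obtain ⟨t, _, rfl⟩ := List.mem_map.1 hy
      rw [ev_sc]
      show (-t.1) • ev x _ = 0
      rw [heq, smul_zero]
    rw [hz, add_zero] at this
    have h7 : (3 * i + i') % 3 = i' := by omega
    have h8 : (3 * i + i') / 3 = i := by omega
    split_ifs at this ⊢ with hc
    · simp only [ev_cons, ev_nil, hx, h7, h8, one_smul, add_zero, neg_smul] at this
      exact eq_of_sub_eq_zero (by rw [sub_eq_add_neg]; exact this)
    · simp only [ev_cons, ev_nil, hx, h7, h8, one_smul, add_zero] at this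
      exact this
  rw [← LinearMap.ker_eq_bot, LinearMap.ker_eq_bot']
  intro v hv
  have main : ∀ N i a, i < 3 → a < d.P i → d.G i + d.P i - 1 - a = N → crd K d i a v = 0 := by
    intro N
    induction N using Nat.strong_induction_on with
    | _ N ih =>
      intro i a hi ha hN
      have h1 : crd K d i a (e v) = 0 := by rw [hv, map_zero]
      rw [expand v] at h1
      simp only [map_sum, map_smul, comm_pow he.comm, crd_Tpow, smul_eq_mul] at h1
      rw [Finset.sum_eq_single_of_mem i (by simpa using hi),
        Finset.sum_eq_single_of_mem a (by simpa using ha)] at h1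
      · rw [key i hi i hi _ (by omega) (by omega) (by omega), if_pos ⟨rfl, by omega⟩] at h1
        exact (mul_eq_zero.1 h1).resolve_right hl
      · intro b hb hba
        rw [Finset.mem_range] at hb
        by_cases hlt : d.G i + d.P i - 1 - b < N
        · rw [ih _ hlt i b hi hb rfl, zero_mul]
        · by_cases hn : d.P i ≤ a + (d.P i - 1 - b)
          · rw [crd_null _ hn, mul_zero]
          · rw [key i hi i hi _ (by omega) (by omega) (by omega), if_neg (by omega), mul_zero]
      · intro r hr hri
        rw [Finset.mem_range] at hr
        apply Finset.sum_eq_zero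
        intro b hb
        rw [Finset.mem_range] at hb
        by_cases hlt : d.G r + d.P r - 1 - b < N
        · rw [ih _ hlt r b hr hb rfl, zero_mul]
        · by_cases hn : d.P i ≤ a + (d.P r - 1 - b)
          · rw [crd_null _ hn, mul_zero]
          · by_cases hn' : d.P r ≤ a + (d.P r - 1 - b)
            · rw [hnull1 _ _ _ hn', mul_zero]
            · rw [key r hr i hi _ (by omega) (by omega) (by omega),
                if_neg (fun hh => hri hh.1.symm), mul_zero]
  apply VS_ext
  intro i a
  rw [map_zero]
  by_cases ha : a < d.P i
  · have hi : i < 3 := by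
      by_contra h'
      rw [P_ge (by omega)] at ha
      omega
    exact main _ i a hi ha rfl
  · exact crd_null _ (by omega)

end Hom


/-! ### The main lemma -/

section Main

universe v

variable {K : Type v} [Field K] {d : Dat} {n : ℕ}

/-- `Y` is isomorphic to the object described by `d`. -/
def IsoTo (Y : SObj K n) (d : Dat) : Prop :=
  ∃ e : Y.carrier ≃ₗ[K] VS K d,
    (∀ v, e (Y.T v) = TD K d (e v)) ∧ Y.U.map e.toLinearMap = UD K d

/-- If a composition `X → Y → X` is injective and `Y` is indecomposable, then `Y ≅ X`. -/
theorem iso_of_split (Y : SObj K n) (hY : Y.Indec) {f : VS K d →ₗ[K] Y.carrier}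
    (hf : IsMor (TD K d) (UD K d) Y.T Y.U f) {t : Y.carrier →ₗ[K] VS K d}
    (ht : IsMor Y.T Y.U (TD K d) (UD K d) t) (hinj : Function.Injective (t ∘ₗ f))
    (hne : ∃ x, f x ≠ 0) : IsoTo Y d := by
  have hsurj : Function.Surjective (t ∘ₗ f) := LinearMap.injective_iff_surjective.1 hinj
  have hUe : (UD K d).map (t ∘ₗ f) = UD K d := by
    apply Submodule.eq_of_le_of_finrank_eq
    · rintro _ ⟨x, hx, rfl⟩
      exact ht.sub _ (hf.sub _ hx)
    · exact (LinearEquiv.finrank_eq (Submodule.equivMapOfInjective _ hinj _)).symm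
  have hker : LinearMap.ker t = ⊥ := by
    by_contra hk
    apply hY.2
    refine ⟨LinearMap.range f, LinearMap.ker t, ?_, hk, ?_, ?_, ?_, ?_⟩
    · obtain ⟨x, hx⟩ := hne
      intro hr
      apply hx
      have : f x ∈ LinearMap.range f := ⟨x, rfl⟩
      rw [hr] at this
      simpa using this
    · constructor
      · rw [Submodule.disjoint_def]
        rintro _ ⟨x, rfl⟩ hx
        have : (t ∘ₗ f) x = (t ∘ₗ f) 0 := by
          rw [map_zero]; exact hx
        rw [hinj this, map_zero]
      · rw [codisjoint_iff, eq_top_iff]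
        intro y _
        obtain ⟨x, hx⟩ := hsurj (t y)
        rw [Submodule.mem_sup]
        refine ⟨f x, ⟨x, rfl⟩, y - f x, ?_, by abel⟩
        rw [LinearMap.mem_ker, map_sub, ← hx]
        simp
    · rintro _ ⟨x, rfl⟩
      exact ⟨TD K d x, hf.comm x⟩
    · intro x hx
      rw [LinearMap.mem_ker] at hx ⊢
      rw [ht.comm, hx, map_zero]
    · apply le_antisymm
      · intro y hy
        have h1 : t y ∈ (UD K d).map (t ∘ₗ f) := by rw [hUe]; exact ht.sub _ hy
        obtain ⟨x, hx, hxy⟩ := h1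
        rw [Submodule.mem_sup]
        refine ⟨f x, ⟨hf.sub _ hx, ⟨x, rfl⟩⟩, y - f x, ⟨?_, ?_⟩, by abel⟩
        · exact Y.U.sub_mem hy (hf.sub _ hx)
        · show t (y - f x) = 0
          rw [map_sub, ← hxy]
          simp
      · exact sup_le inf_le_left inf_le_left
  have hb : Function.Bijective t := by
    refine ⟨LinearMap.ker_eq_bot.1 hker, fun x => ?_⟩
    obtain ⟨z, hz⟩ := hsurj x
    exact ⟨f z, hz⟩
  refine ⟨LinearEquiv.ofBijective t hb, ht.comm, ?_⟩
  apply le_antisymm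
  · rintro _ ⟨x, hx, rfl⟩
    exact ht.sub _ hx
  · intro x hx
    rw [← hUe] at hx
    obtain ⟨z, hz, rfl⟩ := hx
    exact ⟨f z, hf.sub _ hz, rfl⟩

theorem main_lemma (h1 : d.Ok1) (h3 : d.Ok3) (Y : SObj K n) (hY : Y.Indec)
    {f : VS K d →ₗ[K] Y.carrier} (hf : IsMor (TD K d) (UD K d) Y.T Y.U f)
    (hni : ¬ IsoTo Y d) :
    ∃ a b : ℕ → Y.carrier, (∀ j, b j ∈ Y.U) ∧
      ∀ i, (if i = 0 then (Y.T ^ (d.P 0 - 1)) (f (gD K d 0)) else 0) =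
        (Y.T ^ d.P i) (a i) + ∑ j ∈ Finset.range 3,
          ev (fun c i' => if i' = i then (Y.T ^ c) (b j) else 0) (d.q j) := by
  classical
  let A : (ℕ → Y.carrier) →ₗ[K] (ℕ → Y.carrier) :=
    LinearMap.pi fun i => (Y.T ^ d.P i) ∘ₗ LinearMap.proj i
  let x : ℕ → ℕ → (Y.U →ₗ[K] (ℕ → Y.carrier)) := fun c i =>
    LinearMap.single K (fun _ => Y.carrier) i ∘ₗ (Y.T ^ c) ∘ₗ Y.U.subtype
  let B : ℕ → (Y.U →ₗ[K] (ℕ → Y.carrier)) := fun j => ev x (d.q j)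
  have hB : ∀ j (u : Y.U), B j u = ev (fun c i => Pi.single i ((Y.T ^ c) (u : Y.carrier))) (d.q j) := by
    intro j u
    have := map_ev (LinearMap.applyₗ (R := K) u : (Y.U →ₗ[K] (ℕ → Y.carrier)) →ₗ[K] _).toAddMonoidHom x (d.q j)
    exact this
  let Z : Submodule K (ℕ → Y.carrier) :=
    LinearMap.range A ⊔ (LinearMap.range (B 0) ⊔ (LinearMap.range (B 1) ⊔ LinearMap.range (B 2)))
  let w : ℕ → Y.carrier := Pi.single 0 ((Y.T ^ (d.P 0 - 1)) (f (gD K d 0)))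
  by_cases hw : w ∈ Z
  · obtain ⟨_, ⟨a, rfl⟩, _, hw1, hs⟩ := Submodule.mem_sup.1 hw
    obtain ⟨_, ⟨b0, rfl⟩, _, hw2, rfl⟩ := Submodule.mem_sup.1 hw1
    obtain ⟨_, ⟨b1, rfl⟩, _, ⟨b2, rfl⟩, rfl⟩ := Submodule.mem_sup.1 hw2
    let b : ℕ → Y.U := fun j => if j = 0 then b0 else if j = 1 then b1 else b2
    refine ⟨a, fun j => (b j : Y.carrier), fun j => (b j).2, fun i => ?_⟩
    have h5 := congrFun hs i
    have h6 : w i = if i = 0 then (Y.T ^ (d.P 0 - 1)) (f (gD K d 0)) else 0 := by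
      by_cases hi : i = 0
      · subst hi; simp [w]
      · simp [w, hi]
    rw [h6] at h5
    rw [← h5]
    have h7 : ∀ j, B j (b j) i =
        ev (fun c i' => if i' = i then (Y.T ^ c) (b j : Y.carrier) else 0) (d.q j) := by
      intro j
      rw [hB]
      have := map_ev (LinearMap.proj (R := K) (φ := fun _ : ℕ => Y.carrier) i).toAddMonoidHom
        (fun c i => Pi.single i ((Y.T ^ c) (b j : Y.carrier))) (d.q j)
      refine this.trans ?_
      apply ev_congr
      intro t _
      show (Pi.single t.2.2 ((Y.T ^ t.2.1) (b j : Y.carrier)) : ℕ → Y.carrier) i = _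
      by_cases hti : t.2.2 = i
      · rw [if_pos hti, ← hti, Pi.single_eq_same]
      · rw [if_neg hti, Pi.single_eq_of_ne (fun hh => hti hh.symm)]
    rw [Finset.sum_range_succ, Finset.sum_range_succ, Finset.sum_range_one, ← h7, ← h7, ← h7]
    show (Y.T ^ d.P i) (a i) + (B 0 b0 i + (B 1 b1 i + B 2 b2 i)) =
      (Y.T ^ d.P i) (a i) + (B 0 b0 i + B 1 b1 i + B 2 b2 i)
    abel
  · exfalso
    obtain ⟨γ, hγ, hZ⟩ := Submodule.exists_le_ker_of_notMem hw
    apply hni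
    have hA : ∀ i v, γ (Pi.single i ((Y.T ^ d.P i) v)) = 0 := by
      intro i v
      have h5 : A (Pi.single i v) = Pi.single i ((Y.T ^ d.P i) v) := by
        funext r
        show (Y.T ^ d.P r) ((Pi.single i v : ℕ → Y.carrier) r) = _
        by_cases hr : r = i
        · subst hr; simp
        · simp [hr]
      rw [← h5]
      exact hZ (Submodule.mem_sup_left ⟨_, rfl⟩)
    have hBz : ∀ j (u : Y.U), γ (B j u) = 0 := by
      intro j u
      by_cases hj : j < 3
      · apply hZ
        interval_cases j
        · exact Submodule.mem_sup_right (Submodule.mem_sup_left ⟨_, rfl⟩)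
        · exact Submodule.mem_sup_right (Submodule.mem_sup_right (Submodule.mem_sup_left ⟨_, rfl⟩))
        · exact Submodule.mem_sup_right (Submodule.mem_sup_right (Submodule.mem_sup_right ⟨_, rfl⟩))
      · rw [hB, q_lt h1 hj, ev_nil, map_zero]
    let t : Y.carrier →ₗ[K] VS K d :=
      { toFun := fun v => ⟨fun i a => γ (Pi.single i ((Y.T ^ a) v)), fun i a hia => by
          obtain ⟨c, rfl⟩ := Nat.exists_eq_add_of_le hia
          show γ (Pi.single i ((Y.T ^ (d.P i + c)) v)) = 0
          rw [pow_add]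
          exact hA i _⟩
        map_add' := fun v v' => by
          apply VS_ext
          intro i a
          show γ (Pi.single i ((Y.T ^ a) (v + v'))) =
            γ (Pi.single i ((Y.T ^ a) v)) + γ (Pi.single i ((Y.T ^ a) v'))
          rw [map_add, Pi.single_add, map_add]
        map_smul' := fun c v => by
          apply VS_ext
          intro i a
          show γ (Pi.single i ((Y.T ^ a) (c • v))) = c • γ (Pi.single i ((Y.T ^ a) v))
          rw [map_smul, Pi.single_smul, map_smul] }
    have htc : ∀ i a v, crd K d i a (t v) = γ (Pi.single i ((Y.T ^ a) v)) := fun _ _ _ => rfl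
    have ht : IsMor Y.T Y.U (TD K d) (UD K d) t := by
      constructor
      · intro v
        apply VS_ext
        intro i a
        rw [crd_T, htc, htc, pow_succ]
        rfl
      · intro v hv j c
        have h5 := hBz j ⟨(Y.T ^ c) v, pow_mem Y.maps_U c v hv⟩
        rw [hB] at h5
        have h6 := map_ev γ.toAddMonoidHom
          (fun c' i => Pi.single i ((Y.T ^ c') ((Y.T ^ c) v))) (d.q j)
        rw [ev_sc, one_smul]
        refine Eq.trans ?_ (h6.symm.trans h5)
        apply ev_congr
        intro r _
        show crd K d r.2.2 (r.2.1 + c) (t v) = γ _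
        rw [htc, pow_add]
        rfl
    have he : IsMor (TD K d) (UD K d) (TD K d) (UD K d) (t ∘ₗ f) :=
      ⟨fun v => by simp [hf.comm, ht.comm], fun v hv => ht.sub _ (hf.sub _ hv)⟩
    have hl : crd K d 0 (d.P 0 - 1) ((t ∘ₗ f) (gD K d 0)) ≠ 0 := by
      show crd K d 0 (d.P 0 - 1) (t (f (gD K d 0))) ≠ 0
      rw [htc]
      exact hγ
    refine iso_of_split Y hY hf ht (end_local h1 h3 he hl) ⟨gD K d 0, fun h0 => hl ?_⟩
    show crd K d 0 (d.P 0 - 1) (t (f (gD K d 0))) = 0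
    rw [h0, map_zero, map_zero]

end Main


/-! ### Completeness of the list -/

section Complete

universe v

variable {K : Type v} [Field K] {n : ℕ}

theorem tbl_length : tbl.length = 50 := by decide +kernel

theorem D_mem {i : ℕ} (h : i < 50) : D i ∈ tbl := by
  have h' : i < tbl.length := by rw [tbl_length]; exact h
  unfold D
  rw [List.getD_eq_getElem _ _ h']
  exact List.getElem_mem h'

theorem ev_filter {W : Type*} [AddCommGroup W] (x : ℕ → ℕ → W) (i j : ℕ) (l : Lin) :
    ev x ((l.filter fun t => t.2.2 = i).map fun t => (-t.1, t.2.1, j)) =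
      - ev (fun c i' => if i' = i then x c j else 0) l := by
  induction l with
  | nil => simp
  | cons t l ih =>
    by_cases h : t.2.2 = i
    · simp [h, ih, add_comm]
    · simp [h, ih]

theorem ar_step (Y : SObj K n) (hT : Y.T ^ 5 = 0) (hY : Y.Indec) {d : Dat} (hd : d ∈ tbl)
    {f : VS K d →ₗ[K] Y.carrier} (hf : IsMor (TD K d) (UD K d) Y.T Y.U f)
    (hni : ¬ IsoTo Y d) :
    ∃ z : ℕ → Y.carrier,
      (∀ t < d.es.length, ∃ s : VS K (D (d.es.getD t 0)) →ₗ[K] Y.carrier,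
        IsMor (TD K _) (UD K _) Y.T Y.U s ∧ ∀ i < 3, s (gD K _ i) = z (3 * t + i)) ∧
      ∀ i < 3, f (gD K d i) = evT Y.T z ((d.f.getD i []).map dec) := by
  have h1 := ok1 d hd
  obtain ⟨a, b, hb, hab⟩ := main_lemma h1 (ok3 d hd) Y hY hf hni
  let y : ℕ → Y.carrier := fun g =>
    if g < 3 then f (gD K d g) else if g < 6 then a (g - 3) else b (g - 6)
  have hnull : ∀ c g, d.nullA c g = true → (Y.T ^ c) (y g) = 0 := by
    intro c g h
    simp only [Dat.nullA, Bool.or_eq_true, Bool.and_eq_true, decide_eq_true_eq] at h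
    rcases h with h | ⟨h, h'⟩
    · obtain ⟨e, rfl⟩ := Nat.exists_eq_add_of_le h
      rw [pow_add, hT]; simp
    · obtain ⟨e, rfl⟩ := Nat.exists_eq_add_of_le h'
      simp only [y, if_pos h]
      rw [← comm_pow hf.comm, add_comm, pow_add]
      show f ((TD K d ^ e) ((TD K d ^ d.P g) (gD K d g))) = 0
      rw [Tpow_g, map_zero, map_zero]
  have hrel : ∀ i < 3, evT Y.T y (d.rel i) = 0 := by
    intro i hi
    have h2 := hab i
    unfold Dat.rel
    rw [evT_append]
    have h3 : evT Y.T y (if i = 0 then [(1, d.P 0 - 1, 0)] else []) =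
        if i = 0 then (Y.T ^ (d.P 0 - 1)) (f (gD K d 0)) else 0 := by
      split_ifs
      · simp [evT, y]
      · rfl
    rw [h3, h2]
    unfold evT
    rw [ev_cons, ev_flatMap]
    simp only [ev_filter]
    have h4 : y (3 + i) = a i := by
      simp only [y]
      rw [if_neg (by omega), if_pos (by omega)]
      congr 1
      omega
    have h5 : ∀ j, y (6 + j) = b j := by
      intro j
      simp only [y]
      rw [if_neg (by omega), if_neg (by omega)]
      congr 1
      omega
    simp only [h4, h5]
    simp only [Finset.sum_range_succ, Finset.sum_range_zero, List.range_succ, List.range_zero]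
    simp
    abel
  have hrho3 : ∀ r < 3, evT Y.T y (d.rho r) = 0 := by
    intro r hr
    unfold Dat.rho
    rw [if_pos hr]
    exact hrel r hr
  have hrho : ∀ r, evT Y.T y (d.rho r) ∈ Y.U := by
    intro r
    by_cases hr : r < 3
    · rw [hrho3 r hr]; exact Y.U.zero_mem
    · unfold Dat.rho
      rw [if_neg hr]
      by_cases hr6 : r < 6
      · rw [if_pos hr6]
        have h2 := hf.sub _ (uD_mem (K := K) h1 (r - 3))
        rw [map_evT hf.comm] at h2
        have h3 : evT Y.T y (d.u (r - 3)) = evT Y.T (fun g => f (gD K d g)) (d.u (r - 3)) := by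
          apply ev_congr
          intro t ht
          have := h1.2.2.2.2 (r - 3) (by omega) t ht
          simp only [y, if_pos this]
        rw [h3]
        exact h2
      · rw [if_neg hr6]
        simp only [evT, ev_cons, ev_nil, one_smul, pow_zero, add_zero, y, if_neg hr, if_neg hr6]
        exact hb _
  have hsub0 : ∀ l : Lin, (∀ r ∈ l, r.2.2 < 3) → evT Y.T y (sub d.rho l) = 0 := by
    intro l hl
    rw [evT_sub]
    apply ev_zero_of
    intro t ht
    right
    show (Y.T ^ t.2.1) (evT Y.T y (d.rho t.2.2)) = 0
    rw [hrho3 _ (hl t ht), map_zero]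
  obtain ⟨h4, h5⟩ := ok4 d hd
  refine ⟨fun g => evT Y.T y (look g d.s), fun t ht => ?_, fun i hi => ?_⟩
  · obtain ⟨he, hz, hu⟩ := h4 t ht
    have hm := D_mem he
    set e := D (d.es.getD t 0) with hee
    have hy : ∀ i < 3, (Y.T ^ e.P i) (evT Y.T y (look (3 * t + i) d.s)) = 0 := by
      intro i hi
      obtain ⟨hz1, hz2⟩ := hz i hi
      have h6 : evT Y.T y _ = 0 := zchk_sound hz2 _ hnull
      rw [evT_append, evT_ng, hsub0 _ hz1, evT_sc, one_smul, neg_zero, add_zero] at h6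
      exact h6
    have hg : ∀ i < 3, outM Y.T e (fun i => evT Y.T y (look (3 * t + i) d.s)) (gD K e i) =
        evT Y.T y (look (3 * t + i) d.s) := fun i hi => outM_g hy hi
    refine ⟨outM Y.T e (fun i => evT Y.T y (look (3 * t + i) d.s)), ?_, hg⟩
    refine mor_of_u (ok1 e hm) (ok2 e hm) Y.maps_U (outM_comm hy) fun j => ?_
    by_cases hj : j < 3
    · have h6 : evT Y.T y _ = 0 := zchk_sound (hu j hj) _ hnull
      rw [evT_append, evT_ng, evT_sub, evT_sub] at h6
      have h7 : evT Y.T (fun i => outM Y.T e (fun i => evT Y.T y (look (3 * t + i) d.s))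
          (gD K e i)) (e.u j) = evT Y.T (fun i => evT Y.T y (look (3 * t + i) d.s)) (e.u j) := by
        apply ev_congr
        intro r hr
        simp only
        rw [hg _ ((ok1 e hm).2.2.2.2 j hj r hr)]
      have h8 : evT Y.T (fun i => evT Y.T y (look (3 * t + i) d.s)) (e.u j) =
          evT Y.T (fun g => evT Y.T y (d.rho g)) (look (3 * t + j) d.cu) :=
        eq_of_sub_eq_zero (by rw [sub_eq_add_neg]; exact h6)
      rw [h7, h8]
      exact evT_mem Y.maps_U _ _ fun r _ => hrho _
    · rw [u_lt (ok1 e hm) hj]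
      exact Y.U.zero_mem
  · obtain ⟨hc, -, hz⟩ := h5 i hi
    have h6 : evT Y.T y _ = 0 := zchk_sound hz _ hnull
    rw [evT_append, evT_append, evT_ng, hsub0 _ hc, evT_sub, add_zero] at h6
    have h7 : evT Y.T y [(1, 0, i)] = f (gD K d i) := by
      simp [evT, y, hi]
    rw [h7] at h6
    exact eq_of_sub_eq_zero (by rw [sub_eq_add_neg]; exact h6)

theorem vanish (Y : SObj K n) (hT : Y.T ^ 5 = 0) (hY : Y.Indec)
    (hni : ∀ i < 50, ¬ IsoTo Y (D i)) (N : ℕ) :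
    ∀ i < 50, ∀ r < 3, ∀ b, 100 ≤ (D i).w.getD r 0 + 12 * b + N →
      ∀ f : VS K (D i) →ₗ[K] Y.carrier, IsMor (TD K _) (UD K _) Y.T Y.U f →
        (Y.T ^ b) (f (gD K (D i) r)) = 0 := by
  induction N with
  | zero =>
    intro i hi r hr b hb f _
    have h1 := ((ok1 _ (D_mem hi)).2.1 r hr).2
    obtain ⟨e, rfl⟩ := Nat.exists_eq_add_of_le (show 5 ≤ b by omega)
    rw [pow_add, hT]; simp
  | succ N ih =>
    intro i hi r hr b hb f hf
    obtain ⟨z, hz, hfz⟩ := ar_step Y hT hY (D_mem hi) hf (hni i hi)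
    rw [hfz r hr]
    unfold evT
    rw [← LinearMap.toAddMonoidHom_coe, map_ev]
    apply ev_zero_of
    intro t ht
    right
    obtain ⟨h4, h5⟩ := ok4 _ (D_mem hi)
    obtain ⟨-, h6, -⟩ := h5 r hr
    obtain ⟨h7, h8⟩ := h6 t ht
    obtain ⟨s, hs, hsz⟩ := hz _ h7
    have h9 := ih _ (h4 _ h7).1 (t.2.2 % 3) (Nat.mod_lt _ (by norm_num)) (b + t.2.1)
      (by omega) s hs
    rw [hsz _ (Nat.mod_lt _ (by norm_num)), Nat.div_add_mod, pow_add] at h9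
    exact h9

theorem d20 : (D 20).us = [] ∧ (D 20).P 0 = 5 := by decide +kernel

theorem complete (Y : SObj K n) (hT : Y.T ^ 5 = 0) (hY : Y.Indec) : ∃ i < 50, IsoTo Y (D i) := by
  by_contra hni
  push Not at hni
  obtain ⟨v, hv⟩ := hY.1
  apply hv
  let y : ℕ → Y.carrier := fun i => if i = 0 then v else 0
  have hy : ∀ i < 3, (Y.T ^ (D 20).P i) (y i) = 0 := by
    intro i _
    by_cases hi : i = 0
    · subst hi
      rw [d20.2, hT]; simp
    · simp [y, hi]
  have hm := D_mem (i := 20) (by norm_num)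
  have hmor : IsMor (TD K (D 20)) (UD K (D 20)) Y.T Y.U (outM Y.T (D 20) y) := by
    refine mor_of_u (ok1 _ hm) (ok2 _ hm) Y.maps_U (outM_comm hy) fun j => ?_
    have : (D 20).u j = [] := by
      unfold Dat.u
      rw [d20.1]; rfl
    rw [this]
    exact Y.U.zero_mem
  have := vanish Y hT hY hni 100 20 (by norm_num) 0 (by norm_num) 0 (by omega) _ hmor
  rw [outM_g hy (by norm_num)] at this
  simpa [y] using this

end Complete

/-! ### Indecomposability -/

section Ind

universe v

variable (K : Type v) [Field K] (n : ℕ)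

/-- The object of `S_K(n)` attached to the data. -/
def obj (d : Dat) (h : ∀ r < 3, d.P r ≤ n) : SObj K n where
  carrier := VS K d
  U := UD K d
  T := TD K d
  pow_eq_zero := by
    ext1 v
    apply VS_ext
    intro i a
    rw [crd_Tpow]
    show crd K d i (a + n) v = crd K d i a 0
    rw [map_zero]
    apply crd_null
    by_cases hi : i < 3
    · have := h i hi; omega
    · rw [P_ge (by omega)]; omega
  maps_U := TD_U

variable {K n}

theorem g0_ne {d : Dat} (h1 : d.Ok1) : crd K d 0 (d.P 0 - 1) (gD K d 0) = 1 := by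
  have := h1.1.2.2
  rw [crd_g, if_pos ⟨rfl, by omega⟩]

theorem obj_indec {d : Dat} (h : ∀ r < 3, d.P r ≤ n) (h1 : d.Ok1) (h3 : d.Ok3) :
    (obj K n d h).Indec := by
  refine ⟨⟨gD K d 0, fun h0 => ?_⟩, ?_⟩
  · have := g0_ne (K := K) h1
    have h0' : gD K d 0 = 0 := h0
    rw [h0', map_zero] at this
    exact zero_ne_one this
  · rintro ⟨V₁, V₂, hV1, hV2, hc, hT1, hT2, hU⟩
    change Submodule K (VS K d) at V₁ V₂
    have hc' : @IsCompl (Submodule K (VS K d)) _ _ V₁ V₂ := hc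
    clear hc
    have hc := hc'
    clear hc'
    change ∀ x ∈ V₁, TD K d x ∈ V₁ at hT1
    change ∀ x ∈ V₂, TD K d x ∈ V₂ at hT2
    change UD K d = UD K d ⊓ V₁ ⊔ UD K d ⊓ V₂ at hU
    have key : ∀ W₁ W₂ : Submodule K (VS K d), ∀ hc : IsCompl W₁ W₂, W₂ ≠ ⊥ →
        (∀ x ∈ W₁, TD K d x ∈ W₁) → (∀ x ∈ W₂, TD K d x ∈ W₂) →
        UD K d = UD K d ⊓ W₁ ⊔ UD K d ⊓ W₂ →
        crd K d 0 (d.P 0 - 1) (W₁.subtype (W₁.projectionOnto W₂ hc (gD K d 0))) = 0 := by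
      intro W₁ W₂ hc hW2 hT1 hT2 hU
      by_contra hne
      have hdec : ∀ x ∈ W₁, ∀ y ∈ W₂,
          (W₁.subtype ∘ₗ W₁.projectionOnto W₂ hc) (x + y) = x := by
        intro x hx y hy
        have e1 := Submodule.projectionOnto_apply_left hc ⟨x, hx⟩
        have e2 := Submodule.projectionOnto_apply_right hc ⟨y, hy⟩
        simp only at e1 e2
        rw [map_add]
        simp [e1, e2]
      have hmor : IsMor (TD K d) (UD K d) (TD K d) (UD K d)
          (W₁.subtype ∘ₗ W₁.projectionOnto W₂ hc) := by
        constructor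
        · intro v
          have hv : v ∈ W₁ ⊔ W₂ := by rw [hc.sup_eq_top]; trivial
          obtain ⟨x, hx, y, hy, rfl⟩ := Submodule.mem_sup.1 hv
          rw [hdec x hx y hy, map_add (TD K d), hdec _ (hT1 x hx) _ (hT2 y hy)]
        · intro v hv
          rw [hU] at hv
          obtain ⟨x, hx, y, hy, rfl⟩ := Submodule.mem_sup.1 hv
          rw [hdec x hx.2 y hy.2]
          exact hx.1
      have hinj := end_local h1 h3 hmor hne
      apply hW2
      rw [Submodule.eq_bot_iff]
      intro y hy
      apply hinj
      have := hdec 0 W₁.zero_mem y hy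
      rw [zero_add] at this
      rw [this, map_zero]
    have k1 := key V₁ V₂ hc hV2 hT1 hT2 hU
    have k2 := key V₂ V₁ hc.symm hV1 hT2 hT1 (by rw [sup_comm]; exact hU)
    have hs : V₁.subtype (V₁.projectionOnto V₂ hc (gD K d 0)) +
        V₂.subtype (V₂.projectionOnto V₁ hc.symm (gD K d 0)) = gD K d 0 := by
      have hv : gD K d 0 ∈ V₁ ⊔ V₂ := by rw [hc.sup_eq_top]; trivial
      obtain ⟨x, hx, y, hy, hxy⟩ := Submodule.mem_sup.1 hv
      have e1 := Submodule.projectionOnto_apply_left hc ⟨x, hx⟩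
      have e2 := Submodule.projectionOnto_apply_right hc ⟨y, hy⟩
      have e3 := Submodule.projectionOnto_apply_left hc.symm ⟨y, hy⟩
      have e4 := Submodule.projectionOnto_apply_right hc.symm ⟨x, hx⟩
      simp only at e1 e2 e3 e4
      rw [← hxy]
      simp [e1, e2, e3, e4]
    have := g0_ne (K := K) h1
    rw [← hs, map_add, k1, k2, add_zero] at this
    exact zero_ne_one this

end Ind


/-! ### The objects are pairwise non-isomorphic -/

section NonIso

universe v

variable {K : Type v} [Field K]

/-- An isomorphism between the objects attached to two data. -/
def Eqv (K : Type v) [Field K] (d d' : Dat) : Prop :=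
  ∃ e : VS K d ≃ₗ[K] VS K d', (∀ v, e (TD K d v) = TD K d' (e v)) ∧
    ∀ v, v ∈ UD K d ↔ e v ∈ UD K d'

theorem Eqv.symm {d d' : Dat} (h : Eqv K d d') : Eqv K d' d := by
  obtain ⟨e, h1, h2⟩ := h
  refine ⟨e.symm, fun v => ?_, fun v => ?_⟩
  · rw [LinearEquiv.symm_apply_eq, h1, LinearEquiv.apply_symm_apply]
  · rw [h2, LinearEquiv.apply_symm_apply]

/-- The property measured by the invariant `β`. -/
def BetaP (K : Type v) [Field K] (d : Dat) (a b : ℕ) : Prop :=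
  ∀ v : VS K d, (TD K d ^ a) v = 0 → (TD K d ^ b) v ∈ UD K d

/-- The property measured by the invariant `δ`. -/
def DeltaP (K : Type v) [Field K] (d : Dat) (a b : ℕ) : Prop :=
  ∀ v ∈ UD K d, ∃ x, (TD K d ^ a) v = (TD K d ^ (a + b)) x

/-- A property separating the last two objects. -/
def ThetaP (K : Type v) [Field K] (d : Dat) : Prop :=
  ∀ v : VS K d, TD K d v ∈ UD K d → (TD K d ^ 3) v = 0

theorem Eqv.beta {d d' : Dat} (h : Eqv K d d') {a b : ℕ} (hb : BetaP K d' a b) :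
    BetaP K d a b := by
  obtain ⟨e, h1, h2⟩ := h
  have hp := comm_pow (f := e.toLinearMap) h1
  simp only [LinearEquiv.coe_coe] at hp
  intro v hv
  rw [h2, hp]
  apply hb
  rw [← hp, hv, map_zero]

theorem Eqv.delta {d d' : Dat} (h : Eqv K d d') {a b : ℕ} (hb : DeltaP K d' a b) :
    DeltaP K d a b := by
  obtain ⟨e, h1, h2⟩ := h
  have hp := comm_pow (f := e.toLinearMap) h1
  simp only [LinearEquiv.coe_coe] at hp
  intro v hv
  obtain ⟨x, hx⟩ := hb _ ((h2 v).1 hv)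
  refine ⟨e.symm x, e.injective ?_⟩
  rw [hp, hp, hx, LinearEquiv.apply_symm_apply]

theorem Eqv.theta {d d' : Dat} (h : Eqv K d d') (hb : ThetaP K d') : ThetaP K d := by
  obtain ⟨e, h1, h2⟩ := h
  have hp := comm_pow (f := e.toLinearMap) h1
  simp only [LinearEquiv.coe_coe] at hp
  intro v hv
  apply e.injective
  rw [hp, map_zero]
  apply hb
  rw [← h1]
  exact (h2 _).1 hv

theorem P_le {d : Dat} (h1 : d.Ok1) (i : ℕ) : d.P i ≤ 5 := by
  by_cases hi : i < 3
  · exact (h1.2.1 i hi).1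
  · rw [P_ge (by omega)]; omega

theorem q_nil {d : Dat} (h1 : d.Ok1) {j : ℕ} (hj : ¬ j < 3) : d.q j = [] := by
  have := h1.1.2.1
  unfold Dat.q
  rw [List.getD_eq_default _ _ (by omega)]; rfl

theorem mem_UD_of {d : Dat} (h1 : d.Ok1) {v : VS K d}
    (h : ∀ j < 3, ∀ c < 5, ev (fun a i => crd K d i a v) (sc 1 c (d.q j)) = 0) :
    v ∈ UD K d := by
  intro j c
  by_cases hj : j < 3
  · by_cases hc : c < 5
    · exact h j hj c hc
    · rw [ev_sc, one_smul]
      apply ev_zero_of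
      intro t _
      right
      apply crd_null
      have := P_le h1 t.2.2
      omega
  · rw [q_nil h1 hj]; rfl

theorem beta_true {d : Dat} (h1 : d.Ok1) {a b : ℕ} (h : d.betaT a b = true) :
    BetaP K d a b := by
  intro v hv
  apply mem_UD_of h1
  intro j hj c hc
  simp only [Dat.betaT, List.all_eq_true, List.mem_range, decide_eq_true_eq] at h
  rw [ev_sc, one_smul]
  apply ev_zero_of
  intro t ht
  right
  rw [crd_Tpow]
  rcases h j hj c hc t ht with h | h
  · exact crd_null _ h
  · obtain ⟨x, hx⟩ := Nat.exists_eq_add_of_le' h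
    rw [hx, ← crd_Tpow, hv, map_zero]

theorem ne_zero_of_natAbs {z : ℤ} (h : z.natAbs = 1) : (z : K) ≠ 0 := by
  rcases Int.natAbs_eq z with h' | h' <;> rw [h', h] <;> simp

theorem beta_false {d : Dat} {a b : ℕ} (h : d.BetaF a b) : ¬ BetaP K d a b := by
  obtain ⟨i, hi, s, hs, hp, j, hj, c, hc, hv⟩ := h
  intro hb
  have h2 := hb ((TD K d ^ s) (gD K d i)) (by
    apply VS_ext
    intro i' a'
    rw [crd_Tpow, crd_Tpow, crd_g, map_zero, if_neg]
    omega)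
  have h3 : (TD K d ^ b) ((TD K d ^ s) (gD K d i)) =
      evT (TD K d) (gD K d) [(1, s + b, i)] := by
    simp [evT, add_comm s b, pow_add]
  rw [h3] at h2
  have h4 := h2 j c
  rw [ev_crd_ev] at h4
  exact ne_zero_of_natAbs hv h4

theorem Tu_eq {d : Dat} (c j : ℕ) : (TD K d ^ c) (evT (TD K d) (gD K d) (d.u j)) =
    evT (TD K d) (gD K d) (sc 1 c (d.u j)) := by
  rw [evT_sc, one_smul]

theorem delta_true {d : Dat} (h1 : d.Ok1) (h2 : d.Ok2) {a b : ℕ} (h : d.deltaT a b = true) :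
    DeltaP K d a b := by
  simp only [Dat.deltaT, List.all_eq_true, List.mem_range, decide_eq_true_eq] at h
  intro v hv
  have h0 : ∀ i x, a ≤ x → d.P i ≤ x + b → crd K d i x v = 0 := by
    intro i x hx hpx
    by_cases hp : d.P i ≤ x
    · exact crd_null _ hp
    have hi : i < 3 := by
      by_contra hi
      rw [P_ge (by omega)] at hp
      omega
    have h5 := P_le h1 i
    rw [span_U h1 h2 hv, map_list_sum, List.map_map]
    apply List.sum_eq_zero
    intro y hy
    obtain ⟨e, _, rfl⟩ := List.mem_map.1 hy
    simp only [Function.comp_apply, map_smul]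
    by_cases hc : e.1 / 3 < 5
    · rw [Tu_eq, crd_ev, h (e.1 % 3) (Nat.mod_lt _ (by norm_num)) _ hc i hi x (by omega) hx hpx]
      simp
    · rw [crd_Tpow, crd_null _ (by omega), smul_zero]
  refine ⟨⟨fun i e => if d.P i ≤ e ∨ e < b then 0 else crd K d i (e - b) v, ?_⟩, ?_⟩
  · intro i e he
    show (if _ then _ else _) = _
    rw [if_pos (Or.inl he)]
  · apply VS_ext
    intro i x
    rw [crd_Tpow, crd_Tpow]
    show _ = if d.P i ≤ x + (a + b) ∨ x + (a + b) < b then 0 else crd K d i (x + (a + b) - b) v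
    by_cases hp : d.P i ≤ x + (a + b)
    · rw [if_pos (Or.inl hp)]
      exact h0 _ _ (by omega) (by omega)
    · rw [if_neg (by omega), show x + (a + b) - b = x + a by omega]

theorem delta_false {d : Dat} (h1 : d.Ok1) {a b : ℕ} (h : d.DeltaF a b) :
    ¬ DeltaP K d a b := by
  obtain ⟨j, hj, c, hc, i, hi, x, hx, hax, hp, hv⟩ := h
  intro hb
  obtain ⟨y, hy⟩ := hb _ (pow_mem TD_U c _ (uD_mem (K := K) h1 j))
  have h2 := congrArg (crd K d i (x - a)) hy
  rw [Tu_eq, crd_Tpow, crd_Tpow, crd_ev, Nat.sub_add_cancel hax, crd_null y (by omega)] at h2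
  exact ne_zero_of_natAbs hv h2

theorem Eqv.bit {d d' : Dat} (h : Eqv K d d') (hd : d ∈ tbl) (hd' : d' ∈ tbl) {x : ℕ × ℕ × ℕ}
    (hb : d'.bit x = true) : ¬ d.BitF x := by
  have h1 := ok1 d hd
  have h1' := ok1 d' hd'
  have h2' := ok2 d' hd'
  unfold Dat.bit at hb
  rintro (⟨hx, h3⟩ | ⟨hx, h3⟩)
  · rw [if_pos hx] at hb
    exact beta_false h3 (h.beta (beta_true (K := K) h1' hb))
  · rw [if_neg hx] at hb
    exact delta_false h1 h3 (h.delta (delta_true (K := K) h1' h2' hb))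

theorem Eqv.bit_le {d d' : Dat} (h : Eqv K d d') (hd : d ∈ tbl) (hd' : d' ∈ tbl) {i : ℕ}
    (hi : i < 17) (hb : d'.bit (Dat.Q.getD i (0, 0, 0)) = true) :
    d.bit (Dat.Q.getD i (0, 0, 0)) = true := by
  by_contra hf
  apply h.bit hd hd' hb
  obtain ⟨h5, h6⟩ := ok5 d hd
  apply h6
  rw [h5, List.mem_filter]
  exact ⟨List.mem_range.2 hi, by simpa using hf⟩

theorem Eqv.bt_eq {d d' : Dat} (h : Eqv K d d') (hd : d ∈ tbl) (hd' : d' ∈ tbl) :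
    d.bt = d'.bt := by
  rw [(ok5 d hd).1, (ok5 d' hd').1]
  apply List.filter_congr
  intro i hi
  rw [List.mem_range] at hi
  congr 1
  rw [Bool.eq_iff_iff]
  exact ⟨h.symm.bit_le hd' hd hi, h.bit_le hd hd' hi⟩

theorem d42 : (D 42).P 0 = 5 ∧ (D 42).P 1 = 3 ∧ (D 42).P 2 = 1 ∧
    (D 42).q 0 = [(1, 2, 0), (1, 1, 1)] ∧ (D 42).q 1 = [(-1, 2, 0), (1, 0, 2)] := by
  decide +kernel

theorem d43 : (D 43).coef 0 3 [(1, 1, 0), (-1, 0, 1)] = 1 ∧ ∀ j < 3, ∀ c < 5,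
    (D 43).val (sc 1 1 [(1, 1, 0), (-1, 0, 1)]) (sc 1 c ((D 43).q j)) = 0 := by
  decide +kernel

theorem theta_true : ThetaP K (D 42) := by
  obtain ⟨hp0, hp1, hp2, hq0, hq1⟩ := d42
  intro v hv
  have e1 := hv 0 0
  have e2 := hv 1 0
  have e3 := hv 0 1
  rw [hq0] at e1 e3
  rw [hq1] at e2
  simp only [sc, List.map_cons, List.map_nil, ev_cons, ev_nil, crd_T] at e1 e2 e3
  have n1 : crd K (D 42) 2 1 v = 0 := crd_null v (by omega)
  have n2 : crd K (D 42) 1 3 v = 0 := crd_null v (by omega)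
  norm_num [n1, n2] at e1 e2 e3
  apply VS_ext
  intro i a
  rw [crd_Tpow, map_zero]
  by_cases hi : i = 0
  · subst hi
    by_cases ha : a = 0
    · subst ha; exact e2
    · by_cases ha : a = 1
      · subst ha; exact e3
      · exact crd_null v (by omega)
  · by_cases hi : i = 1
    · subst hi
      exact crd_null v (by omega)
    · by_cases hi : i = 2
      · subst hi
        exact crd_null v (by omega)
      · exact crd_null v (by rw [P_ge (by omega)]; omega)

theorem theta_false : ¬ ThetaP K (D 43) := by
  intro h
  have h2 := h (evT (TD K _) (gD K _) [(1, 1, 0), (-1, 0, 1)]) (by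
    apply mem_UD_of (ok1 _ (D_mem (by norm_num)))
    intro j hj c hc
    have h3 := evT_sc (TD K (D 43)) (gD K _) 1 1 [(1, 1, 0), (-1, 0, 1)]
    rw [one_smul, pow_one] at h3
    rw [← h3, ev_crd_ev, d43.2 j hj c hc, Int.cast_zero])
  have h3 := congrArg (crd K (D 43) 0 0) h2
  rw [crd_Tpow, map_zero, zero_add, crd_ev, d43.1, Int.cast_one] at h3
  exact one_ne_zero h3

theorem Eqv.eq {i j : ℕ} (hi : i < 50) (hj : j < 50) (h : Eqv K (D i) (D j)) : i = j := by
  rcases bt_inj i hi j hj (h.bt_eq (D_mem hi) (D_mem hj)) with h' | ⟨rfl, rfl⟩ | ⟨rfl, rfl⟩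
  · exact h'
  · exact (theta_false (h.symm.theta theta_true)).elim
  · exact (theta_false (h.theta theta_true)).elim

theorem final (K : Type v) [Field K] {n N : ℕ} (hN : N ≤ 50) (hn : n ≤ 5)
    (hsz : ∀ i < 50, i < N ↔ ∀ r < 3, (D i).P r ≤ n) :
    ∃ X : Fin N → SObj K n, (∀ i, (X i).Indec) ∧ (∀ i j, (X i).Iso (X j) → i = j) ∧
      ∀ Y : SObj K n, Y.Indec → ∃ i, Y.Iso (X i) := by
  have hlt : ∀ i : Fin N, (i : ℕ) < 50 := fun i => by have := i.2; omega
  refine ⟨fun i => obj K n (D i) ((hsz i (hlt i)).1 i.2), fun i => ?_, fun i j h => ?_,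
    fun Y hY => ?_⟩
  · exact obj_indec _ (ok1 _ (D_mem (hlt i))) (ok3 _ (D_mem (hlt i)))
  · obtain ⟨e, h1, h2⟩ := h
    apply Fin.ext
    apply Eqv.eq (K := K) (hlt i) (hlt j)
    change VS K (D i) ≃ₗ[K] VS K (D j) at e
    change (UD K (D i)).map e.toLinearMap = UD K (D j) at h2
    refine ⟨e, h1, fun v => ?_⟩
    rw [← h2]
    constructor
    · intro hv
      exact Submodule.mem_map_of_mem (f := e.toLinearMap) hv
    · rintro ⟨w, hw, hwv⟩
      rw [← e.injective hwv]
      exact hw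
  · have hT : Y.T ^ 5 = 0 := by
      exact pow_eq_zero_of_le hn Y.pow_eq_zero
    obtain ⟨i, hi, e, h1, h2⟩ := complete Y hT hY
    have hP : ∀ r < 3, (D i).P r ≤ n := by
      intro r hr
      by_contra hlt
      have h3 := comm_pow (f := e.toLinearMap) h1 n (e.symm (gD K (D i) r))
      rw [Y.pow_eq_zero] at h3
      simp only [LinearMap.zero_apply, map_zero, LinearEquiv.coe_coe,
        LinearEquiv.apply_symm_apply] at h3
      have h4 := congrArg (crd K (D i) r ((D i).P r - 1 - n)) h3
      rw [map_zero, crd_Tpow, crd_g, if_pos ⟨rfl, by omega⟩] at h4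
      exact zero_ne_one h4
    exact ⟨⟨i, (hsz i hi).2 hP⟩, e, h1, h2⟩

end NonIso

end SClass


/-- (Section 6) For `1 ≤ n ≤ 5`, the category `S_k(n)` has exactly
`2 + 2(n−1)·6/(6−n)` isomorphism classes of indecomposable objects
(that is `2, 5, 10, 20, 50` for `n = 1, 2, 3, 4, 5`); in particular finitely many. -/
theorem stmt12 (k : Type u) [Field k] (n : ℕ) (h1 : 1 ≤ n) (h5 : n ≤ 5) :
    ∃ X : Fin (2 + 2 * (n - 1) * 6 / (6 - n)) → SObj k n,
      (∀ i, (X i).Indec) ∧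
      (∀ i j, (X i).Iso (X j) → i = j) ∧
      ∀ Y : SObj k n, Y.Indec → ∃ i, Y.Iso (X i) := by
  rcases (show n = 1 ∨ n = 2 ∨ n = 3 ∨ n = 4 ∨ n = 5 by omega) with
    rfl | rfl | rfl | rfl | rfl
  · exact SClass.final k (N := 2) (by norm_num) (by norm_num) fun i hi => (SClass.sizes i hi).1
  · exact SClass.final k (N := 5) (by norm_num) (by norm_num) fun i hi => (SClass.sizes i hi).2.1
  · exact SClass.final k (N := 10) (by norm_num) (by norm_num)
      fun i hi => (SClass.sizes i hi).2.2.1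
  · exact SClass.final k (N := 20) (by norm_num) (by norm_num)
      fun i hi => (SClass.sizes i hi).2.2.2
  · exact SClass.final k (N := 50) (by norm_num) (by norm_num) fun i hi =>
      ⟨fun _ r _ => SClass.P_le (SClass.ok1 _ (SClass.D_mem hi)) r, fun _ => hi⟩
end

section
/- Let k be a field. For every integer f ≥ 1 there exist indecomposable objects of S_k(7) with dimension pair (13f, 6f), and also indecomposable objects of S_k(7) with dimension pair (13f, 7f). Consequently, for every n ≥ 7 and every constant C, the dimension pairs (v,u) of indecomposable objects of S_k(n) are not all contained in the stripe {(v,u) : |v − 2u| ≤ C}; in other words, |v − 2u| is unbounded on the indecomposables of S_k(n). -/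
universe u

namespace SObj

variable {k : Type u} [Field k] {n : ℕ}

/-- Every idempotent endomorphism is trivial. -/
def IdemTriv (X : SObj k n) : Prop :=
  ∀ e : X.carrier →ₗ[k] X.carrier, (∀ v, e (X.T v) = X.T (e v)) → (∀ x ∈ X.U, e x ∈ X.U) →
    (∀ v, e (e v) = e v) → (∀ v, e v = 0) ∨ (∀ v, e v = v)

theorem indec_of_idemTriv (X : SObj k n) (h0 : ∃ v : X.carrier, v ≠ 0) (h : X.IdemTriv) :
    X.Indec := by
  refine ⟨h0, ?_⟩
  rintro ⟨V₁, V₂, h1, h2, hc, hT1, hT2, hU⟩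
  have key : ∀ v : X.carrier, ∃ a ∈ V₁, ∃ b ∈ V₂, v = a + b := by
    intro v
    have hv : v ∈ V₁ ⊔ V₂ := by rw [hc.sup_eq_top]; trivial
    obtain ⟨a, ha, b, hb, hab⟩ := Submodule.mem_sup.1 hv
    exact ⟨a, ha, b, hb, hab.symm⟩
  let e : X.carrier →ₗ[k] X.carrier := V₁.subtype ∘ₗ Submodule.projectionOnto V₁ V₂ hc
  have e1 : ∀ v ∈ V₁, e v = v := by
    intro v hv
    have := Submodule.projectionOnto_apply_left hc ⟨v, hv⟩
    simp only [e, LinearMap.comp_apply]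
    exact congrArg V₁.subtype this
  have e2 : ∀ v ∈ V₂, e v = 0 := by
    intro v hv
    have := Submodule.projectionOnto_apply_right hc ⟨v, hv⟩
    simp only [e, LinearMap.comp_apply]
    exact congrArg V₁.subtype this
  refine (h e ?_ ?_ ?_).elim (fun he => ?_) (fun he => ?_)
  rotate_left 3
  · obtain ⟨v, hv, hv0⟩ := V₁.ne_bot_iff.1 h1
    exact hv0 (by rw [← e1 v hv, he])
  · obtain ⟨v, hv, hv0⟩ := V₂.ne_bot_iff.1 h2
    exact hv0 (by rw [← he v, e2 v hv])
  · intro v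
    obtain ⟨a, ha, b, hb, rfl⟩ := key v
    rw [map_add, map_add, map_add, e1 _ (hT1 _ ha), e2 _ (hT2 _ hb), e1 _ ha, e2 _ hb]
    simp
  · intro x hx
    rw [hU] at hx
    obtain ⟨a, ha, b, hb, rfl⟩ := Submodule.mem_sup.1 hx
    rw [map_add, e1 _ ha.2, e2 _ hb.2, add_zero]
    exact ha.1
  · intro v
    obtain ⟨a, ha, b, hb, rfl⟩ := key v
    rw [map_add, e1 _ ha, e2 _ hb, add_zero, e1 _ ha]

/-- The dual object. -/
noncomputable def dual (X : SObj k n) : SObj k n where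
  carrier := Module.Dual k X.carrier
  U := X.U.dualAnnihilator
  T := X.T.dualMap
  pow_eq_zero := by
    have h : ∀ m : ℕ, X.T.dualMap ^ m = (X.T ^ m).dualMap := by
      intro m
      induction m with
      | zero => ext; simp
      | succ m ih =>
        rw [pow_succ, ih, pow_succ']
        ext; simp
    rw [h, X.pow_eq_zero]
    ext; simp
  maps_U := by
    intro x hx
    rw [Submodule.mem_dualAnnihilator] at hx ⊢
    intro w hw
    exact hx _ (X.maps_U w hw)

theorem dual_idemTriv (X : SObj k n) (h : X.IdemTriv) : X.dual.IdemTriv := by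
  intro E hT hU hE
  change Module.Dual k X.carrier →ₗ[k] Module.Dual k X.carrier at E
  let e : X.carrier →ₗ[k] X.carrier :=
    (Module.evalEquiv k X.carrier).symm.toLinearMap ∘ₗ E.dualMap ∘ₗ
      (Module.evalEquiv k X.carrier).toLinearMap
  have he : ∀ (g : Module.Dual k X.carrier) (v : X.carrier), g (e v) = E g v := by
    intro g v
    simp [e]
  have ext' : ∀ v w : X.carrier, (∀ g : Module.Dual k X.carrier, g v = g w) → v = w := by
    intro v w hvw
    apply (Module.evalEquiv k X.carrier).injective
    ext g
    simpa using hvw g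
  refine (h e ?_ ?_ ?_).elim (fun h => ?_) (fun h => ?_)
  rotate_left 3
  · left
    intro g
    change Module.Dual k X.carrier at g
    apply LinearMap.ext
    intro v
    have := he g v
    rw [h v, map_zero] at this
    exact this.symm
  · right
    intro g
    change Module.Dual k X.carrier at g
    apply LinearMap.ext
    intro v
    have := he g v
    rw [h v] at this
    exact this.symm
  · intro v
    apply ext'
    intro g
    rw [he]
    have h1 := LinearMap.congr_fun (hT g) v
    have h2 := he (X.T.dualMap g) v
    exact h1.symm.trans h2.symm
  · intro x hx
    rw [← Subspace.dualAnnihilator_dualCoannihilator_eq (W := X.U),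
      Submodule.mem_dualCoannihilator]
    intro g hg
    rw [he]
    exact (Submodule.mem_dualAnnihilator _).1 (hU g hg) x hx
  · intro v
    apply ext'
    intro g
    rw [he, he, he]
    exact LinearMap.congr_fun (hE g) v

end SObj

section Family

variable (k : Type u) [Field k] (f : ℕ)

/-- The nilpotent Jordan block. -/
def jordJ : (Fin f → k) →ₗ[k] (Fin f → k) where
  toFun w i := if h : i.1 + 1 < f then w ⟨i.1 + 1, h⟩ else 0
  map_add' v w := by ext i; by_cases h : i.1 + 1 < f <;> simp [h]
  map_smul' c w := by ext i; by_cases h : i.1 + 1 < f <;> simp [h]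

theorem jordJ_pow (m : ℕ) (w : Fin f → k) (i : Fin f) :
    (jordJ k f ^ m) w i = if h : i.1 + m < f then w ⟨i.1 + m, h⟩ else 0 := by
  induction m generalizing i with
  | zero => simp
  | succ m ih =>
    rw [pow_succ', Module.End.mul_apply]
    change (if h : i.1 + 1 < f then (jordJ k f ^ m) w ⟨i.1 + 1, h⟩ else 0) = _
    by_cases h : i.1 + 1 < f
    · rw [dif_pos h, ih]
      have : i.1 + 1 + m = i.1 + (m + 1) := by omega
      simp only [this]
    · rw [dif_neg h, dif_neg (by omega)]

/-- Nonzero invariant: some power lands in a nonzero kernel vector. -/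
theorem jordJ_ker (w : Fin f → k) (hw : w ≠ 0) :
    ∃ m, (jordJ k f ^ m) w ≠ 0 ∧ jordJ k f ((jordJ k f ^ m) w) = 0 := by
  classical
  have hex : ∃ m, (jordJ k f ^ m) w = 0 := by
    refine ⟨f, ?_⟩
    ext i
    rw [jordJ_pow, dif_neg (by omega)]
    rfl
  have h0 : Nat.find hex ≠ 0 := by
    intro h
    have := Nat.find_spec hex
    rw [h] at this
    exact hw (by simpa using this)
  refine ⟨Nat.find hex - 1, Nat.find_min hex (by omega), ?_⟩
  rw [← Module.End.mul_apply, ← pow_succ']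
  have : Nat.find hex - 1 + 1 = Nat.find hex := by omega
  rw [this]
  exact Nat.find_spec hex

theorem jordJ_ker_coord (w : Fin f → k) (hw : jordJ k f w = 0) (i : Fin f) (hi : i.1 ≠ 0) :
    w i = 0 := by
  have h := congrFun hw ⟨i.1 - 1, by omega⟩
  change (if h : i.1 - 1 + 1 < f then w ⟨i.1 - 1 + 1, h⟩ else 0) = 0 at h
  have h1 : i.1 - 1 + 1 = i.1 := by omega
  rw [dif_pos (by omega)] at h
  rw [← h]
  congr 1
  ext
  exact h1.symm

theorem jordJ_idem (a : (Fin f → k) →ₗ[k] (Fin f → k))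
    (hJ : ∀ w, a (jordJ k f w) = jordJ k f (a w)) (ha : ∀ w, a (a w) = a w) :
    (∀ w, a w = 0) ∨ (∀ w, a w = w) := by
  by_contra hcon
  push Not at hcon
  obtain ⟨⟨w, hw⟩, ⟨v, hv⟩⟩ := hcon
  have hp : ∀ m w, a ((jordJ k f ^ m) w) = (jordJ k f ^ m) (a w) := by
    intro m
    induction m with
    | zero => intro w; simp
    | succ m ih =>
      intro w
      rw [pow_succ, Module.End.mul_apply, Module.End.mul_apply, ih, hJ]
  obtain ⟨m, hm0, hm⟩ := jordJ_ker k f (a w) hw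
  obtain ⟨l, hl0, hl⟩ := jordJ_ker k f (a v - v) (sub_ne_zero.2 hv)
  set p := (jordJ k f ^ m) (a w) with hpdef
  set q := (jordJ k f ^ l) (a v - v) with hqdef
  have hap : a p = p := by rw [hpdef, hp, ha]
  have haq : a q = 0 := by rw [hqdef, hp, map_sub, ha, sub_self, map_zero]
  have cp := jordJ_ker_coord k f p hm
  have cq := jordJ_ker_coord k f q hl
  obtain ⟨i, hi⟩ := Function.ne_iff.1 hl0
  have hi0 : i.1 = 0 := by
    by_contra h
    exact hi (cq i h)
  have hpq : q i • p = p i • q := by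
    ext j
    by_cases hj : j.1 = 0
    · have : j = i := by ext; omega
      subst this
      simp [mul_comm]
    · simp [cp j hj, cq j hj]
  have h3 := congrArg a hpq
  rw [map_smul, map_smul, hap, haq, smul_zero] at h3
  rcases smul_eq_zero.1 h3 with h | h
  · exact hi h
  · exact hm0 h

/-- Shift operator for Jordan type (7,4,2). -/
def famT : (Fin 13 → Fin f → k) →ₗ[k] (Fin 13 → Fin f → k) :=
  LinearMap.pi ![0, LinearMap.proj 0, LinearMap.proj 1, LinearMap.proj 2, LinearMap.proj 3,
    LinearMap.proj 4, LinearMap.proj 5, 0, LinearMap.proj 7, LinearMap.proj 8, LinearMap.proj 9,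
    0, LinearMap.proj 11]

theorem famT_eq (v : Fin 13 → Fin f → k) :
    famT k f v = ![0, v 0, v 1, v 2, v 3, v 4, v 5, 0, v 7, v 8, v 9, 0, v 11] := by
  funext i
  fin_cases i <;> rfl

/-- The invariant subspace. -/
def famU : Submodule k (Fin 13 → Fin f → k) where
  carrier := {v | v 0 = 0 ∧ v 1 = 0 ∧ v 2 = 0 ∧ v 7 = 0 ∧ v 8 = v 3 ∧ v 11 = v 3 ∧
    v 12 = v 4 + jordJ k f (v 9 - v 4)}
  zero_mem' := by simp
  add_mem' := by
    rintro a b ⟨a0, a1, a2, a7, a8, a11, a12⟩ ⟨b0, b1, b2, b7, b8, b11, b12⟩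
    refine ⟨?_, ?_, ?_, ?_, ?_, ?_, ?_⟩ <;> simp only [Pi.add_apply, *, add_zero]
    simp only [map_add, map_sub]
    abel
  smul_mem' := by
    rintro c a ⟨a0, a1, a2, a7, a8, a11, a12⟩
    refine ⟨?_, ?_, ?_, ?_, ?_, ?_, ?_⟩ <;> simp only [Pi.smul_apply, *, smul_zero]
    simp only [map_sub, smul_add, smul_sub, map_smul]

theorem mem_famU (v : Fin 13 → Fin f → k) : v ∈ famU k f ↔
    (v 0 = 0 ∧ v 1 = 0 ∧ v 2 = 0 ∧ v 7 = 0 ∧ v 8 = v 3 ∧ v 11 = v 3 ∧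
    v 12 = v 4 + jordJ k f (v 9 - v 4)) := Iff.rfl

/-- Coordinates on the invariant subspace. -/
def famUEquiv : famU k f ≃ₗ[k] (Fin 6 → Fin f → k) where
  toFun v := ![v.1 3, v.1 4, v.1 5, v.1 6, v.1 9, v.1 10]
  invFun c := ⟨![0, 0, 0, c 0, c 1, c 2, c 3, 0, c 0, c 4, c 5, c 0,
    c 1 + jordJ k f (c 4 - c 1)], ⟨rfl, rfl, rfl, rfl, rfl, rfl, rfl⟩⟩
  map_add' v w := by funext i; fin_cases i <;> rfl
  map_smul' c v := by funext i; fin_cases i <;> rfl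
  left_inv := by
    rintro ⟨v, a0, a1, a2, a7, a8, a11, a12⟩
    apply Subtype.ext
    funext i
    fin_cases i
    exacts [a0.symm, a1.symm, a2.symm, rfl, rfl, rfl, rfl, a7.symm, a8.symm, rfl, rfl, a11.symm,
      a12.symm]
  right_inv c := by funext i; fin_cases i <;> rfl

theorem famT_pow : famT k f ^ 7 = 0 := by
  apply LinearMap.ext
  intro v
  change famT k f (famT k f (famT k f (famT k f (famT k f (famT k f (famT k f v)))))) = 0
  funext i
  fin_cases i <;> rfl

/-- The family. -/
def fam (n : ℕ) (hn : 7 ≤ n) : SObj k n where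
  carrier := Fin 13 → Fin f → k
  U := famU k f
  T := famT k f
  pow_eq_zero := pow_eq_zero_of_le hn (famT_pow k f)
  maps_U := by
    rintro v ⟨a0, a1, a2, a7, a8, a11, a12⟩
    refine ⟨rfl, a0, a1, rfl, a7.trans a2.symm, a2.symm, ?_⟩
    change v 11 = v 3 + jordJ k f (v 8 - v 3)
    rw [a8, a11, sub_self, map_zero, add_zero]

theorem fam_dimPair (n : ℕ) (hn : 7 ≤ n) : (fam k f n hn).dimPair = (13 * f, 6 * f) := by
  have h1 : Module.finrank k (Fin 13 → Fin f → k) = 13 * f := by simp [Module.finrank_pi_fintype]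
  have h2 : Module.finrank k (famU k f) = 6 * f := by
    rw [(famUEquiv k f).finrank_eq]; simp [Module.finrank_pi_fintype]
  exact Prod.ext h1 h2

theorem fam_dual_dimPair (n : ℕ) (hn : 7 ≤ n) :
    (fam k f n hn).dual.dimPair = (13 * f, 7 * f) := by
  have h1 : Module.finrank k (Fin 13 → Fin f → k) = 13 * f := by simp [Module.finrank_pi_fintype]
  have h2 : Module.finrank k (famU k f) = 6 * f := by
    rw [(famUEquiv k f).finrank_eq]; simp [Module.finrank_pi_fintype]
  have h3 := Subspace.finrank_add_finrank_dualAnnihilator_eq (famU k f)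
  refine Prod.ext (Subspace.dual_finrank_eq.trans h1) ?_
  change Module.finrank k (famU k f).dualAnnihilator = 7 * f
  omega

/-- First generator inclusion. -/
def gx : (Fin f → k) →ₗ[k] (Fin 13 → Fin f → k) :=
  LinearMap.pi ![LinearMap.id, 0, 0, 0, 0, 0, 0, 0, 0, 0, 0, 0, 0]

/-- Second generator inclusion. -/
def gy : (Fin f → k) →ₗ[k] (Fin 13 → Fin f → k) :=
  LinearMap.pi ![0, 0, 0, 0, 0, 0, 0, LinearMap.id, 0, 0, 0, 0, 0]

/-- Third generator inclusion. -/
def gz : (Fin f → k) →ₗ[k] (Fin 13 → Fin f → k) :=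
  LinearMap.pi ![0, 0, 0, 0, 0, 0, 0, 0, 0, 0, 0, LinearMap.id, 0]

theorem fam_decomp (v : Fin 13 → Fin f → k) : ∃ v', v = gx k f (v 0) + gy k f (v 7) +
    gz k f (v 11) + famT k f v' := by
  refine ⟨![v 1, v 2, v 3, v 4, v 5, v 6, 0, v 8, v 9, v 10, 0, v 12, 0], ?_⟩
  funext i
  fin_cases i <;> simp [gx, gy, gz, famT]

/-- An idempotent endomorphism vanishing on the top is zero. -/
theorem fam_zero (e : (Fin 13 → Fin f → k) →ₗ[k] (Fin 13 → Fin f → k))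
    (hT : ∀ v, e (famT k f v) = famT k f (e v)) (hE : ∀ v, e (e v) = e v)
    (hx : ∀ w, e (gx k f w) 0 = 0) (hy0 : ∀ w, e (gy k f w) 0 = 0)
    (hz0 : ∀ w, e (gz k f w) 0 = 0) (hy : ∀ w, e (gy k f w) 7 = 0)
    (hz7 : ∀ w, e (gz k f w) 7 = 0) (hz : ∀ w, e (gz k f w) 11 = 0) : ∀ v, e v = 0 := by
  have t0 : ∀ v, famT k f v 0 = 0 := fun v => rfl
  have t7 : ∀ v, famT k f v 7 = 0 := fun v => rfl
  have t11 : ∀ v, famT k f v 11 = 0 := fun v => rfl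
  have c0 : ∀ v, e v 0 = 0 := by
    intro v
    obtain ⟨v', hv⟩ := fam_decomp k f v
    rw [hv]
    simp only [map_add, hT, Pi.add_apply, hx, hy0, hz0, t0, add_zero]
  have c7 : ∀ v, e v 7 = 0 := by
    intro v
    rw [← hE]
    obtain ⟨v', hv⟩ := fam_decomp k f (e v)
    rw [hv, c0]
    simp only [map_add, hT, Pi.add_apply, hy, hz7, t7, add_zero, map_zero, Pi.zero_apply]
  have c11 : ∀ v, e v 11 = 0 := by
    intro v
    rw [← hE]
    obtain ⟨v', hv⟩ := fam_decomp k f (e v)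
    rw [hv, c0, c7]
    simp only [map_add, hT, Pi.add_apply, hz, t11, add_zero, map_zero, Pi.zero_apply]
  have r : ∀ v, ∃ v', e v = famT k f v' := by
    intro v
    obtain ⟨v', hv⟩ := fam_decomp k f (e v)
    refine ⟨v', ?_⟩
    rw [c0, c7, c11] at hv
    simpa using hv
  have hTp : ∀ m v, e ((famT k f ^ m) v) = (famT k f ^ m) (e v) := by
    intro m
    induction m with
    | zero => intro v; simp
    | succ m ih =>
      intro v
      rw [pow_succ, Module.End.mul_apply, Module.End.mul_apply, ih, hT]
  have rm : ∀ m v, ∃ v', e v = (famT k f ^ m) v' := by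
    intro m
    induction m with
    | zero => intro v; exact ⟨e v, by simp⟩
    | succ m ih =>
      intro v
      obtain ⟨v', hv⟩ := ih v
      obtain ⟨v'', hv'⟩ := r v'
      refine ⟨v'', ?_⟩
      rw [← hE, hv, hTp, hv', pow_succ, Module.End.mul_apply]
  intro v
  obtain ⟨v', hv⟩ := rm 7 v
  rw [hv, famT_pow]
  rfl

theorem fam_idemTriv (n : ℕ) (hn : 7 ≤ n) : (fam k f n hn).IdemTriv := by
  intro e hT hU hE
  change (Fin 13 → Fin f → k) →ₗ[k] (Fin 13 → Fin f → k) at e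
  change ∀ v : Fin 13 → Fin f → k, e (famT k f v) = famT k f (e v) at hT
  change ∀ x ∈ famU k f, e x ∈ famU k f at hU
  change ∀ v : Fin 13 → Fin f → k, e (e v) = e v at hE
  change (∀ v : Fin 13 → Fin f → k, e v = 0) ∨ (∀ v : Fin 13 → Fin f → k, e v = v)
  set T := famT k f with hTdef
  have hy4 : ∀ w, T (T (T (T (e (gy k f w))))) = 0 := by
    intro w
    rw [← hT, ← hT, ← hT, ← hT]
    have : T (T (T (T (gy k f w)))) = 0 := by
      funext i; fin_cases i <;> rfl
    rw [this, map_zero]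
  have hz2 : ∀ w, T (T (e (gz k f w))) = 0 := by
    intro w
    rw [← hT, ← hT]
    have : T (T (gz k f w)) = 0 := by
      funext i; fin_cases i <;> rfl
    rw [this, map_zero]
  have y0 : ∀ w, e (gy k f w) 0 = 0 := fun w => congrFun (hy4 w) 4
  have y2 : ∀ w, e (gy k f w) 2 = 0 := fun w => congrFun (hy4 w) 6
  have z0 : ∀ w, e (gz k f w) 0 = 0 := fun w => congrFun (hz2 w) 2
  have z3 : ∀ w, e (gz k f w) 3 = 0 := fun w => congrFun (hz2 w) 5
  have z7 : ∀ w, e (gz k f w) 7 = 0 := fun w => congrFun (hz2 w) 9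
  have z8 : ∀ w, e (gz k f w) 8 = 0 := fun w => congrFun (hz2 w) 10
  -- the generators of U
  have u1 : ∀ w, e (gx k f w) 0 = e (gy k f w) 7 ∧ e (gx k f w) 0 = e (gz k f w) 11 := by
    intro w
    have hm : T (T (T (gx k f w))) + T (gy k f w) + gz k f w ∈ famU k f := by
      rw [mem_famU]
      simp [hTdef, famT, gx, gy, gz]
    have h := hU _ hm
    rw [map_add, map_add, hT, hT, hT, hT, mem_famU] at h
    obtain ⟨-, -, -, -, h8, h11, -⟩ := h
    change 0 + e (gy k f w) 7 + e (gz k f w) 8 =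
      e (gx k f w) 0 + e (gy k f w) 2 + e (gz k f w) 3 at h8
    change 0 + 0 + e (gz k f w) 11 =
      e (gx k f w) 0 + e (gy k f w) 2 + e (gz k f w) 3 at h11
    rw [z8, y2, z3] at h8
    rw [y2, z3] at h11
    simp only [zero_add, add_zero] at h8 h11
    exact ⟨h8.symm, h11.symm⟩
  have u2 : ∀ w, e (gz k f (jordJ k f w)) 11 = jordJ k f (e (gy k f w) 7) := by
    intro w
    have hm : T (T (gy k f w)) + T (gz k f (jordJ k f w)) ∈ famU k f := by
      rw [mem_famU]
      simp [hTdef, famT, gy, gz]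
    have h := hU _ hm
    rw [map_add, hT, hT, hT, mem_famU] at h
    obtain ⟨-, -, -, -, -, -, h12⟩ := h
    change 0 + e (gz k f (jordJ k f w)) 11 =
      (e (gy k f w) 2 + e (gz k f (jordJ k f w)) 3) +
        jordJ k f ((e (gy k f w) 7 + e (gz k f (jordJ k f w)) 8) -
          (e (gy k f w) 2 + e (gz k f (jordJ k f w)) 3)) at h12
    rw [y2, z3, z8] at h12
    simpa only [zero_add, add_zero, sub_zero] using h12
  let a : (Fin f → k) →ₗ[k] (Fin f → k) := LinearMap.proj 0 ∘ₗ e ∘ₗ gx k f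
  have ha : ∀ w, a w = e (gx k f w) 0 := fun w => rfl
  have hc0 : ∀ v, e v 0 = a (v 0) := by
    intro v
    obtain ⟨v', hv⟩ := fam_decomp k f v
    have t0 : T (e v') 0 = 0 := rfl
    conv_lhs => rw [hv]
    rw [map_add, map_add, map_add, hT]
    simp only [Pi.add_apply, y0, z0, t0, add_zero, ha]
  have haa : ∀ w, a (a w) = a w := by
    intro w
    rw [ha w, ← hc0, hE]
  have haJ : ∀ w, a (jordJ k f w) = jordJ k f (a w) := by
    intro w
    rw [ha, ha, (u1 _).2, u2, (u1 w).1]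
  rcases jordJ_idem k f a haJ haa with h | h
  · left
    refine fam_zero k f e hT hE (fun w => h w) y0 z0 (fun w => ?_) z7 (fun w => ?_)
    · rw [← (u1 w).1]; exact h w
    · rw [← (u1 w).2]; exact h w
  · right
    have hz := fam_zero k f (LinearMap.id - e) (fun v => ?_) (fun v => ?_) (fun w => ?_)
      (fun w => ?_) (fun w => ?_) (fun w => ?_) (fun w => ?_) (fun w => ?_)
    · intro v
      have := hz v
      rw [LinearMap.sub_apply, LinearMap.id_apply, sub_eq_zero] at this
      exact this.symm
    · simp only [LinearMap.sub_apply, LinearMap.id_apply, map_sub]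
      rw [← hTdef, hT]
    · simp only [LinearMap.sub_apply, LinearMap.id_apply, map_sub, hE]
      simp
    · change gx k f w 0 - e (gx k f w) 0 = 0
      rw [← ha, h]; exact sub_self w
    · change gy k f w 0 - e (gy k f w) 0 = 0
      rw [y0]; exact sub_self 0
    · change gz k f w 0 - e (gz k f w) 0 = 0
      rw [z0]; exact sub_self 0
    · change gy k f w 7 - e (gy k f w) 7 = 0
      rw [← (u1 w).1, ← ha, h]; exact sub_self w
    · change gz k f w 7 - e (gz k f w) 7 = 0
      rw [z7]; exact sub_self 0
    · change gz k f w 11 - e (gz k f w) 11 = 0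
      rw [← (u1 w).2, ← ha, h]; exact sub_self w

theorem nonzero_of_dimPair {k : Type u} [Field k] {n : ℕ} (X : SObj k n)
    (h : 0 < X.dimPair.1) : ∃ v : X.carrier, v ≠ 0 := by
  have : Nontrivial X.carrier := Module.nontrivial_of_finrank_pos (R := k) h
  exact exists_ne 0

end Family

/-- (7.3.1) For every `f ≥ 1` there are indecomposable objects of `S_k(7)` with dimension
pairs `(13f,6f)` and `(13f,7f)`; consequently for every `n ≥ 7` the quantity `|v − 2u|` is
unbounded on the dimension pairs of indecomposable objects of `S_k(n)`. -/
theorem stmt13 (k : Type u) [Field k] :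
    (∀ f : ℕ, 1 ≤ f →
      (∃ X : SObj k 7, X.Indec ∧ X.dimPair = (13 * f, 6 * f)) ∧
      (∃ X : SObj k 7, X.Indec ∧ X.dimPair = (13 * f, 7 * f))) ∧
    ∀ n : ℕ, 7 ≤ n → ∀ C : ℤ,
      ∃ X : SObj k n, X.Indec ∧
        C < |(X.dimPair.1 : ℤ) - 2 * (X.dimPair.2 : ℤ)| := by
  refine ⟨fun f hf => ⟨⟨fam k f 7 le_rfl, ?_, fam_dimPair k f 7 le_rfl⟩,
    ⟨(fam k f 7 le_rfl).dual, ?_, fam_dual_dimPair k f 7 le_rfl⟩⟩, fun n hn C => ?_⟩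
  · refine SObj.indec_of_idemTriv _ (nonzero_of_dimPair _ ?_) (fam_idemTriv k f 7 le_rfl)
    rw [fam_dimPair]; dsimp only; omega
  · refine SObj.indec_of_idemTriv _ (nonzero_of_dimPair _ ?_)
      (SObj.dual_idemTriv _ (fam_idemTriv k f 7 le_rfl))
    rw [fam_dual_dimPair]; dsimp only; omega
  · refine ⟨fam k (C.toNat + 1) n hn,
      SObj.indec_of_idemTriv _ (nonzero_of_dimPair _ ?_) (fam_idemTriv k _ n hn), ?_⟩
    · rw [fam_dimPair]; dsimp only; omega
    · rw [fam_dimPair]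
      refine lt_of_lt_of_le ?_ (le_abs_self _)
      push_cast
      have := Int.self_le_toNat C
      linarith
end

section
/- Let k be a field and let n ≥ 7 be a natural number. Then for every natural number N there exists an indecomposable object M of S_k(ñ) whose total-space support has more than N elements, i.e. #{i ∈ ℤ : M_i ≠ 0} > N. In particular, the supports of indecomposable objects of S_k(ñ) are not contained in intervals of bounded length. -/
universe u

/-- An object of the covering category `S_k(ñ)`, encoded as an object `(V,U,T)` of
`S_k(n)` together with a ℤ-grading `V = ⊕_{i∈ℤ} V_i` (finitely many nonzero pieces)
such that `T(V_i) ⊆ V_{i−1}` and `U = ⊕_i (U ∩ V_i)`.  Here `V_i` plays the role of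
the vector space `M_i` and `U ∩ V_i` the role of (the image under the inclusion
`β_i` of) the vector space `M_{i'}`. -/
structure SCovObj (k : Type u) [Field k] (n : ℕ) extends SObj k n where
  grading : ℤ → Submodule k carrier
  indep : iSupIndep grading
  iSup_grading : (⨆ i, grading i) = ⊤
  finite_support : {i : ℤ | grading i ≠ ⊥}.Finite
  T_grading : ∀ i : ℤ, ∀ x ∈ grading i, T x ∈ grading (i - 1)
  U_grading : U = ⨆ i : ℤ, U ⊓ grading i

namespace SCovObj

variable {k : Type u} [Field k] {n : ℕ}

/-- Indecomposability in the covering category: the object is nonzero and admits no direct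
decomposition into two nonzero graded subobjects compatible with `T` and `U`. -/
def Indec (M : SCovObj k n) : Prop :=
  (∃ v : M.carrier, v ≠ 0) ∧
    ¬∃ V₁ V₂ : Submodule k M.carrier,
        V₁ ≠ ⊥ ∧ V₂ ≠ ⊥ ∧ IsCompl V₁ V₂ ∧
          (∀ x ∈ V₁, M.T x ∈ V₁) ∧ (∀ x ∈ V₂, M.T x ∈ V₂) ∧
            M.U = M.U ⊓ V₁ ⊔ M.U ⊓ V₂ ∧
            V₁ = (⨆ j, V₁ ⊓ M.grading j) ∧ V₂ = (⨆ j, V₂ ⊓ M.grading j)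

/-- `x_i = dim_k M_i`, the total-space part of the dimension vector, as an integer. -/
noncomputable def a (M : SCovObj k n) (i : ℤ) : ℤ :=
  (Module.finrank k (M.grading i) : ℤ)

/-- `x_{i'} = dim_k M_{i'}`, the subspace part of the dimension vector, as an integer. -/
noncomputable def b (M : SCovObj k n) (i : ℤ) : ℤ :=
  (Module.finrank k ↥(M.U ⊓ M.grading i) : ℤ)

/-- The quadratic form `χ` (for `n = 6`) evaluated at the dimension vector of `M`. -/
noncomputable def chi (M : SCovObj k n) : ℤ :=
  ∑ᶠ i : ℤ,
    (M.a i ^ 2 + M.b i ^ 2 - M.a i * M.a (i + 1) - M.b i * M.b (i + 1)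
      - M.b i * M.a i + M.a i * M.a (i + 6) + M.b i * M.b (i + 6) + M.b (i + 1) * M.a i)

/-- `π(x)`, first component: `Σ_i dim_k M_i`. -/
noncomputable def piV (M : SCovObj k n) : ℕ :=
  ∑ᶠ i : ℤ, Module.finrank k (M.grading i)

/-- `π(x)`, second component: `Σ_i dim_k M_{i'}`. -/
noncomputable def piU (M : SCovObj k n) : ℕ :=
  ∑ᶠ i : ℤ, Module.finrank k ↥(M.U ⊓ M.grading i)

/-- `t(x) = #{i ∈ ℤ : M_i ≠ 0}`, the size of the support of the total space. -/
noncomputable def tsupp (M : SCovObj k n) : ℕ :=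
  {i : ℤ | M.grading i ≠ ⊥}.ncard

end SCovObj

namespace Stmt14

/-- `0` at the starting positions of the three bars (of lengths 7, 5, 2), `1` elsewhere. -/
def sw (k : Type u) [Field k] (q : Fin 14) : k :=
  if q = 0 ∨ q = 7 ∨ q = 12 then 0 else 1

def off (q : Fin 14) : ℤ := if q < 7 then 1 else if q < 12 then 7 else 11

def deg {m : ℕ} (x : Fin m × Fin 14) : ℤ := off x.2 - (x.1.val : ℤ) - (x.2.val : ℤ)

variable {k : Type u} [Field k] {m : ℕ}

/-- The shift operator on `m` triples of bars of lengths 7, 5, 2. -/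
def T (k : Type u) [Field k] (m : ℕ) : (Fin m × Fin 14 → k) →ₗ[k] (Fin m × Fin 14 → k) where
  toFun v x := sw k x.2 * v (x.1, x.2 - 1)
  map_add' v w := by ext x; simp [mul_add]
  map_smul' c v := by ext x; simp; ring

theorem T_apply (v : Fin m × Fin 14 → k) (j : Fin m) (q : Fin 14) :
    T k m v (j, q) = sw k q * v (j, q - 1) := rfl

theorem T_pow_seven : (T k m) ^ 7 = 0 := by
  refine LinearMap.ext fun v => funext fun x => ?_
  obtain ⟨j, q⟩ := x
  fin_cases q <;> simp [pow_succ, T_apply, sw, Module.End.mul_apply]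

/-- The coordinate projection onto degree `d`. -/
def pr (k : Type u) [Field k] (m : ℕ) (d : ℤ) :
    (Fin m × Fin 14 → k) →ₗ[k] (Fin m × Fin 14 → k) where
  toFun v x := if deg x = d then v x else 0
  map_add' v w := by ext x; by_cases h : deg x = d <;> simp [h]
  map_smul' c v := by ext x; by_cases h : deg x = d <;> simp [h]

theorem pr_apply (d : ℤ) (v : Fin m × Fin 14 → k) (x : Fin m × Fin 14) :
    pr k m d v x = if deg x = d then v x else 0 := rfl

/-- The grading by coordinate degree. -/
def gr (k : Type u) [Field k] (m : ℕ) (d : ℤ) : Submodule k (Fin m × Fin 14 → k) where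
  carrier := {v | ∀ x, deg x ≠ d → v x = 0}
  add_mem' {v w} hv hw x hx := by simp [hv x hx, hw x hx]
  zero_mem' x _ := rfl
  smul_mem' c v hv x hx := by simp [hv x hx]

theorem mem_gr {d : ℤ} {v : Fin m × Fin 14 → k} :
    v ∈ gr k m d ↔ ∀ x, deg x ≠ d → v x = 0 := Iff.rfl

theorem pr_mem (d : ℤ) (v : Fin m × Fin 14 → k) : pr k m d v ∈ gr k m d := by
  intro x hx
  simp [pr_apply, hx]

theorem pr_of_mem {d : ℤ} {v : Fin m × Fin 14 → k} (hv : v ∈ gr k m d) : pr k m d v = v := by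
  ext x
  by_cases h : deg x = d
  · simp [pr_apply, h]
  · simp [pr_apply, h, hv x h]

theorem pr_of_mem_ne {d d' : ℤ} (hd : d' ≠ d) {v : Fin m × Fin 14 → k} (hv : v ∈ gr k m d') :
    pr k m d v = 0 := by
  ext x
  by_cases h : deg x = d
  · simp [pr_apply, hv x (by rw [h]; exact hd.symm)]
  · simp [pr_apply, h]

theorem sum_pr (v : Fin m × Fin 14 → k) :
    v = ∑ d ∈ Finset.univ.image (deg (m := m)), pr k m d v := by
  ext x
  rw [Finset.sum_apply]
  simp only [pr_apply]
  rw [Finset.sum_ite_eq]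
  simp

/-- The invariant subspace. -/
def U (k : Type u) [Field k] (m : ℕ) : Submodule k (Fin m × Fin 14 → k) where
  carrier := {v | (∀ j, v (j, 0) = 0 ∧ v (j, 1) = 0 ∧ v (j, 7) = 0 ∧ v (j, 8) = v (j, 2) ∧
      v (j, 12) = v (j, 2) ∧ v (j, 9) = v (j, 3)) ∧
    (∀ j : Fin m, j.val = 0 → v (j, 13) = v (j, 3)) ∧
    (∀ i j : Fin m, j.val = i.val + 1 → v (j, 13) = v (i, 10) - v (i, 4) + v (j, 3))}
  add_mem' {v w} hv hw := by
    obtain ⟨h1, h2, h3⟩ := hv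
    obtain ⟨g1, g2, g3⟩ := hw
    refine ⟨fun j => ?_, fun j hj => ?_, fun i j hj => ?_⟩
    · obtain ⟨a1, a2, a3, a4, a5, a6⟩ := h1 j
      obtain ⟨b1, b2, b3, b4, b5, b6⟩ := g1 j
      simp [*]
    · simp [h2 j hj, g2 j hj]
    · simp only [Pi.add_apply, h3 i j hj, g3 i j hj]; ring
  zero_mem' := by simp
  smul_mem' c v hv := by
    obtain ⟨h1, h2, h3⟩ := hv
    refine ⟨fun j => ?_, fun j hj => ?_, fun i j hj => ?_⟩
    · obtain ⟨a1, a2, a3, a4, a5, a6⟩ := h1 j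
      simp [*]
    · simp [h2 j hj]
    · simp only [Pi.smul_apply, h3 i j hj, smul_eq_mul]; ring

theorem mem_U {v : Fin m × Fin 14 → k} : v ∈ U k m ↔
    (∀ j, v (j, 0) = 0 ∧ v (j, 1) = 0 ∧ v (j, 7) = 0 ∧ v (j, 8) = v (j, 2) ∧
      v (j, 12) = v (j, 2) ∧ v (j, 9) = v (j, 3)) ∧
    (∀ j : Fin m, j.val = 0 → v (j, 13) = v (j, 3)) ∧
    (∀ i j : Fin m, j.val = i.val + 1 → v (j, 13) = v (i, 10) - v (i, 4) + v (j, 3)) := Iff.rfl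

theorem T_mem_U {v : Fin m × Fin 14 → k} (hv : v ∈ U k m) : T k m v ∈ U k m := by
  obtain ⟨h1, h2, h3⟩ := hv
  refine ⟨fun j => ?_, fun j hj => ?_, fun i j hj => ?_⟩
  · obtain ⟨a1, a2, a3, a4, a5, a6⟩ := h1 j
    simp [T_apply, sw, *]
  · obtain ⟨a1, a2, a3, a4, a5, a6⟩ := h1 j
    simp [T_apply, sw, *]
  · obtain ⟨a1, a2, a3, a4, a5, a6⟩ := h1 j
    obtain ⟨b1, b2, b3, b4, b5, b6⟩ := h1 i
    simp [T_apply, sw, *]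

theorem pr_mem_U (d : ℤ) {v : Fin m × Fin 14 → k} (hv : v ∈ U k m) : pr k m d v ∈ U k m := by
  obtain ⟨h1, h2, h3⟩ := hv
  refine ⟨fun j => ?_, fun j hj => ?_, fun i j hj => ?_⟩
  · obtain ⟨a1, a2, a3, a4, a5, a6⟩ := h1 j
    have e1 : deg (j, (8 : Fin 14)) = deg (j, (2 : Fin 14)) := by simp [deg, off]; ring
    have e2 : deg (j, (12 : Fin 14)) = deg (j, (2 : Fin 14)) := by simp [deg, off]; ring
    have e3 : deg (j, (9 : Fin 14)) = deg (j, (3 : Fin 14)) := by simp [deg, off]; ring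
    simp [pr_apply, *]
  · have e1 : deg (j, (13 : Fin 14)) = deg (j, (3 : Fin 14)) := by simp [deg, off]; ring
    simp [pr_apply, e1, h2 j hj]
  · have e1 : deg (j, (13 : Fin 14)) = deg (j, (3 : Fin 14)) := by simp [deg, off]; ring
    have e2 : deg (i, (10 : Fin 14)) = deg (j, (3 : Fin 14)) := by simp [deg, off, hj]; ring
    have e3 : deg (i, (4 : Fin 14)) = deg (j, (3 : Fin 14)) := by simp [deg, off, hj]; ring
    simp only [pr_apply, e1, e2, e3, h3 i j hj]
    split_ifs <;> simp

theorem T_gr (d : ℤ) {v : Fin m × Fin 14 → k} (hv : v ∈ gr k m d) :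
    T k m v ∈ gr k m (d - 1) := by
  rintro ⟨j, q⟩ hx
  by_cases hs : q = 0 ∨ q = 7 ∨ q = 12
  · simp [T_apply, sw, hs]
  · rw [T_apply, hv (j, q - 1), mul_zero]
    intro h
    apply hx
    rw [← h]
    clear hx h
    fin_cases q <;> simp [deg, off] at hs ⊢ <;> ring

theorem gr_indep : iSupIndep (gr k m) := by
  intro d
  rw [Submodule.disjoint_def]
  intro v hv hv'
  have h0 : ∀ w ∈ ⨆ j, ⨆ (_ : j ≠ d), gr k m j, pr k m d w = 0 := by
    intro w hw
    have : (⨆ j, ⨆ (_ : j ≠ d), gr k m j) ≤ LinearMap.ker (pr k m d) :=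
      iSup₂_le fun j hj u hu => LinearMap.mem_ker.2 (pr_of_mem_ne hj hu)
    exact LinearMap.mem_ker.1 (this hw)
  rw [← pr_of_mem hv]
  exact h0 v hv'

theorem gr_iSup : (⨆ d, gr k m d) = ⊤ := by
  rw [eq_top_iff]
  intro v _
  rw [sum_pr v]
  exact Submodule.sum_mem _ fun d _ => Submodule.mem_iSup_of_mem d (pr_mem d v)

theorem U_gr : U k m = ⨆ d : ℤ, U k m ⊓ gr k m d := by
  apply le_antisymm
  · intro v hv
    rw [sum_pr v]
    exact Submodule.sum_mem _ fun d _ =>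
      Submodule.mem_iSup_of_mem d ⟨pr_mem_U d hv, pr_mem d v⟩
  · exact iSup_le fun d => inf_le_left

/-- The standard basis vectors. -/
def e (k : Type u) [Field k] {m : ℕ} (j : Fin m) (q : Fin 14) : Fin m × Fin 14 → k :=
  Pi.single (j, q) 1

theorem e_apply (j i : Fin m) (q p : Fin 14) :
    e k j q (i, p) = if i = j ∧ p = q then 1 else 0 := by
  simp [e, Pi.single_apply]

theorem e_gr (j : Fin m) (q : Fin 14) : e k j q ∈ gr k m (deg (j, q)) := by
  rintro ⟨i, p⟩ h
  rw [e_apply, if_neg]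
  rintro ⟨rfl, rfl⟩
  exact h rfl

theorem gr_ne_bot (x : Fin m × Fin 14) : gr k m (deg x) ≠ ⊥ := by
  intro h
  have := e_gr (k := k) x.1 x.2
  rw [h, Submodule.mem_bot] at this
  have h2 : e k x.1 x.2 (x.1, x.2) = 0 := by rw [this]; rfl
  rw [e_apply] at h2
  simp at h2

theorem support_eq : {d : ℤ | gr k m d ≠ ⊥} = Set.range (deg (m := m)) := by
  ext d
  constructor
  · intro h
    by_contra hd
    apply h
    rw [eq_bot_iff]
    intro v hv
    rw [Submodule.mem_bot]
    ext x
    exact hv x fun hx => hd ⟨x, hx⟩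
  · rintro ⟨x, rfl⟩
    exact gr_ne_bot x

theorem T_e (j : Fin m) (q : Fin 14) :
    T k m (e k j q) = if q = 6 ∨ q = 11 ∨ q = 13 then 0 else e k j (q + 1) := by
  ext ⟨i, p⟩
  rw [T_apply, e_apply]
  by_cases hij : i = j
  · subst hij
    split_ifs with h1 h2 h2
    · obtain ⟨-, rfl⟩ := h1
      rcases h2 with h | h | h
      · obtain rfl : p = 7 := by revert p; decide
        simp [sw]
      · obtain rfl : p = 12 := by revert p; decide
        simp [sw]
      · obtain rfl : p = 0 := by revert p; decide
        simp [sw]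
    · obtain ⟨-, rfl⟩ := h1
      have : ¬ (p = 0 ∨ p = 7 ∨ p = 12) := by revert p; decide
      simp [sw, this, e_apply]
    · simp
    · have : p ≠ q + 1 := by
        rintro rfl
        exact h1 ⟨rfl, by simp⟩
      simp [e_apply, this]
  · split_ifs with h1 h2 h2
    · exact absurd h1.1 hij
    · exact absurd h1.1 hij
    · simp
    · simp [e_apply, hij]

section endo

variable (f : (Fin m × Fin 14 → k) →ₗ[k] (Fin m × Fin 14 → k))

theorem f_shift (hT : ∀ v, f (T k m v) = T k m (f v)) (i j : Fin m) (q p : Fin 14)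
    (hq : ¬(q = 6 ∨ q = 11 ∨ q = 13)) :
    f (e k j (q + 1)) (i, p) = sw k p * f (e k j q) (i, p - 1) := by
  have h := congrFun (hT (e k j q)) (i, p)
  rw [T_e, if_neg hq, T_apply] at h
  exact h

theorem f_end (hT : ∀ v, f (T k m v) = T k m (f v)) (i j : Fin m) (q p : Fin 14)
    (hq : q = 6 ∨ q = 11 ∨ q = 13) :
    sw k p * f (e k j q) (i, p - 1) = 0 := by
  have h := congrFun (hT (e k j q)) (i, p)
  rw [T_e, if_pos hq, T_apply, map_zero] at h
  exact h.symm

/-- Maps out of the bar of length 2. -/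
theorem c_zero (hT : ∀ v, f (T k m v) = T k m (f v)) (i j : Fin m) (p : Fin 14)
    (hp : sw k (p + 1) = 1) (hp' : sw k (p + 2) = 1) : f (e k j 12) (i, p) = 0 := by
  have h1 := f_end f hT i j 13 (p + 2) (by decide)
  have h2 := f_shift f hT i j 12 (p + 1) (by decide)
  have e1 : p + 2 - 1 = p + 1 := by clear h1 h2 hp hp'; revert p; decide
  have e2 : p + 1 - 1 = p := by simp
  rw [e1, hp', one_mul] at h1
  rw [e2, hp, one_mul] at h2
  rw [← h2]
  exact h1

/-- Maps out of the bar of length 5. -/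
theorem b_zero (hT : ∀ v, f (T k m v) = T k m (f v)) (i j : Fin m) (p : Fin 14)
    (hp1 : p = 0 ∨ p = 1) : f (e k j 7) (i, p) = 0 := by
  have h5 := f_end f hT i j 11 (p + 5) (by decide)
  have h4 := f_shift f hT i j 10 (p + 4) (by decide)
  have h3 := f_shift f hT i j 9 (p + 3) (by decide)
  have h2 := f_shift f hT i j 8 (p + 2) (by decide)
  have h1 := f_shift f hT i j 7 (p + 1) (by decide)
  rcases hp1 with rfl | rfl <;> simp [sw] at h1 h2 h3 h4 h5 <;> simp_all

theorem u_mem (j : Fin m) : e k j 2 + e k j 8 + e k j 12 ∈ U k m := by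
  refine ⟨fun i => ?_, fun i hi => ?_, fun i i' hi => ?_⟩ <;>
    simp [e_apply]

theorem v_mem (i j : Fin m) (hij : j.val = i.val + 1) : e k i 10 + e k j 13 ∈ U k m := by
  refine ⟨fun i => ?_, fun i' hi => ?_, fun i' j' hi => ?_⟩
  · simp [e_apply]
  · have : i' ≠ j := by rintro rfl; omega
    simp [e_apply, this]
  · have : (j' = j) ↔ (i' = i) := by rw [Fin.ext_iff, Fin.ext_iff]; omega
    simp [e_apply, this]

theorem diag_u (hT : ∀ v, f (T k m v) = T k m (f v)) (hU : ∀ v ∈ U k m, f v ∈ U k m)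
    (j : Fin m) : f (e k j 7) (j, 7) = f (e k j 0) (j, 0) ∧
      f (e k j 12) (j, 12) = f (e k j 0) (j, 0) := by
  have h := ((mem_U.1 (hU _ (u_mem j))).1 j).2.2.2
  obtain ⟨h1, h2, -⟩ := h
  have a1 (p : Fin 14) := f_shift f hT j j 0 p (by decide)
  have a2 (p : Fin 14) := f_shift f hT j j 1 p (by decide)
  have b1 (p : Fin 14) := f_shift f hT j j 7 p (by decide)
  have z1 := b_zero f hT j j 1 (by decide)
  have z2 := c_zero f hT j j 2 (by simp [sw]) (by simp [sw])
  have z3 := c_zero f hT j j 8 (by simp [sw]) (by simp [sw])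
  have a22 : f (e k j 2) (j, 2) = f (e k j 0) (j, 0) := by
    have := a1 1; have := a2 2; simp_all [sw]
  have a28 : f (e k j 2) (j, 8) = 0 := by
    have := a1 7; have := a2 8; simp_all [sw]
  have a212 : f (e k j 2) (j, 12) = 0 := by
    have := a2 12; simp_all [sw]
  have b2 : f (e k j 8) (j, 2) = 0 := by
    have := b1 2; simp_all [sw]
  have b8 : f (e k j 8) (j, 8) = f (e k j 7) (j, 7) := by
    have := b1 8; simp_all [sw]
  have b12 : f (e k j 8) (j, 12) = 0 := by
    have := b1 12; simp_all [sw]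
  simp only [map_add, Pi.add_apply, a22, a28, a212, b2, b8, b12, z2, z3] at h1 h2
  simp only [zero_add, add_zero] at h1 h2
  exact ⟨h1, h2⟩

theorem diag_v (hT : ∀ v, f (T k m v) = T k m (f v)) (hU : ∀ v ∈ U k m, f v ∈ U k m)
    (i j : Fin m) (hij : j.val = i.val + 1) :
    f (e k j 12) (j, 12) = f (e k i 7) (i, 7) := by
  have h := (mem_U.1 (hU _ (v_mem i j hij))).2.2 i j hij
  have b1 (l : Fin m) (p : Fin 14) := f_shift f hT l i 7 p (by decide)
  have b2 (l : Fin m) (p : Fin 14) := f_shift f hT l i 8 p (by decide)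
  have b3 (l : Fin m) (p : Fin 14) := f_shift f hT l i 9 p (by decide)
  have c1 (l : Fin m) (p : Fin 14) := f_shift f hT l j 12 p (by decide)
  have x1 : f (e k i 10) (j, 13) = 0 := by
    have h1 := b3 j 13
    have h2 := b2 j 12
    simp [sw] at h1 h2
    rw [h1, h2]
  have x2 : f (e k j 13) (j, 13) = f (e k j 12) (j, 12) := by
    have h1 := c1 j 13
    simpa [sw] using h1
  have x3 : f (e k i 10) (i, 10) = f (e k i 7) (i, 7) := by
    have h1 := b3 i 10
    have h2 := b2 i 9
    have h3 := b1 i 8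
    simp [sw] at h1 h2 h3
    rw [h1, h2, h3]
  have x4 : f (e k j 13) (i, 10) = 0 := by
    have h1 := c1 i 10
    have h2 := c_zero f hT i j 9 (by simp [sw]) (by simp [sw])
    simp [sw] at h1
    rw [h1, h2]
  have x5 : f (e k i 10) (i, 4) = 0 := by
    have h1 := b3 i 4
    have h2 := b2 i 3
    have h3 := b1 i 2
    have h4 := b_zero f hT i i 1 (by decide)
    simp [sw] at h1 h2 h3
    rw [h1, h2, h3, h4]
  have x6 : f (e k j 13) (i, 4) = 0 := by
    have h1 := c1 i 4
    have h2 := c_zero f hT i j 3 (by simp [sw]) (by simp [sw])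
    simp [sw] at h1
    rw [h1, h2]
  have x7 : f (e k i 10) (j, 3) = 0 := by
    have h1 := b3 j 3
    have h2 := b2 j 2
    have h3 := b1 j 1
    have h4 := b_zero f hT j i 0 (by decide)
    simp [sw] at h1 h2 h3
    rw [h1, h2, h3, h4]
  have x8 : f (e k j 13) (j, 3) = 0 := by
    have h1 := c1 j 3
    have h2 := c_zero f hT j j 2 (by simp [sw]) (by simp [sw])
    simp [sw] at h1
    rw [h1, h2]
  simp only [map_add, Pi.add_apply, x1, x2, x3, x4, x5, x6, x7, x8] at h
  simpa using h

/-- All the diagonal coefficients at the tops of the bars agree. -/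
theorem diag_all (hm : 0 < m) (hT : ∀ v, f (T k m v) = T k m (f v))
    (hU : ∀ v ∈ U k m, f v ∈ U k m) : ∃ c : k, ∀ j : Fin m,
      f (e k j 0) (j, 0) = c ∧ f (e k j 7) (j, 7) = c ∧ f (e k j 12) (j, 12) = c := by
  refine ⟨f (e k ⟨0, hm⟩ 0) (⟨0, hm⟩, 0), ?_⟩
  have key : ∀ (n : ℕ) (hn : n < m),
      f (e k ⟨n, hn⟩ 0) (⟨n, hn⟩, 0) = f (e k ⟨0, hm⟩ 0) (⟨0, hm⟩, 0) := by
    intro n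
    induction n with
    | zero => intro hn; rfl
    | succ n ih =>
      intro hn
      have h1 := diag_u f hT hU ⟨n, by omega⟩
      have h2 := diag_u f hT hU ⟨n + 1, hn⟩
      have h3 := diag_v f hT hU ⟨n, by omega⟩ ⟨n + 1, hn⟩ rfl
      rw [← h2.2, h3, h1.1, ih]
  intro j
  have h1 := diag_u f hT hU j
  have h2 := key j.val j.isLt
  simp only [Fin.eta] at h2
  exact ⟨h2, h1.1.trans h2, h1.2.trans h2⟩

/-- A coordinate of `f v` expanded in the standard basis. -/
theorem f_expand (v : Fin m × Fin 14 → k) (y : Fin m × Fin 14) :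
    f v y = ∑ x : Fin m × Fin 14, v x * f (e k x.1 x.2) y := by
  have hv : v = ∑ x : Fin m × Fin 14, v x • e k x.1 x.2 := by
    ext ⟨i, p⟩
    rw [Finset.sum_apply, Finset.sum_eq_single (i, p)]
    · simp [e_apply]
    · rintro ⟨i', p'⟩ - hne
      rw [Pi.smul_apply, e_apply, if_neg, smul_zero]
      rintro ⟨rfl, rfl⟩
      exact hne rfl
    · simp
  conv_lhs => rw [hv]
  rw [map_sum, Finset.sum_apply]
  refine Finset.sum_congr rfl fun x _ => ?_
  rw [map_smul, Pi.smul_apply, smul_eq_mul]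

/-- A top coordinate only sees top basis vectors. -/
theorem f_top (hT : ∀ v, f (T k m v) = T k m (f v)) (i j : Fin m) (p q : Fin 14)
    (hp : p = 0 ∨ p = 7 ∨ p = 12) (hq : ¬(q = 0 ∨ q = 7 ∨ q = 12)) :
    f (e k j q) (i, p) = 0 := by
  have hq' : ¬(q - 1 = 6 ∨ q - 1 = 11 ∨ q - 1 = 13) := by
    clear hp; revert q; decide
  have h := f_shift f hT i j (q - 1) p hq'
  have e1 : q - 1 + 1 = q := by simp
  rw [e1] at h
  rw [h]
  simp [sw, hp]

theorem nilp (hT : ∀ v, f (T k m v) = T k m (f v))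
    (hG : ∀ (i j : Fin m) (p q : Fin 14), deg (i, p) ≠ deg (j, q) → f (e k j q) (i, p) = 0)
    (c : k) (hc : ∀ j : Fin m,
      f (e k j 0) (j, 0) = c ∧ f (e k j 7) (j, 7) = c ∧ f (e k j 12) (j, 12) = c) :
    (f - c • LinearMap.id) ^ 21 = 0 := by
  set g := f - c • LinearMap.id with hg
  have hgT : ∀ v, g (T k m v) = T k m (g v) := by
    intro v; simp [hg, hT]
  have hge : ∀ (v : Fin m × Fin 14 → k) y, g v y = f v y - c * v y := by
    intro v y; simp [hg]
  have hgtop : ∀ (i j : Fin m) (p : Fin 14), p = 0 ∨ p = 7 ∨ p = 12 →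
      g (e k j p) (i, p) = 0 := by
    intro i j p hp
    rw [hge, e_apply]
    by_cases hij : i = j
    · subst hij
      rcases hp with rfl | rfl | rfl
      · simp [(hc i).1]
      · simp [(hc i).2.1]
      · simp [(hc i).2.2]
    · rw [hG, if_neg (fun h => hij h.1)]
      · simp
      · simp only [deg]
        intro h
        apply hij
        rw [Fin.ext_iff]
        omega
  have z1 : ∀ (i j : Fin m), g (e k j 7) (i, 0) = 0 := fun i j =>
    b_zero g hgT i j 0 (by decide)
  have z2 : ∀ (i j : Fin m), g (e k j 12) (i, 0) = 0 := fun i j =>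
    c_zero g hgT i j 0 (by simp [sw]) (by simp [sw])
  have z3 : ∀ (i j : Fin m), g (e k j 12) (i, 7) = 0 := fun i j =>
    c_zero g hgT i j 7 (by simp [sw]) (by simp [sw])
  have topA : ∀ v (i : Fin m), g v (i, 0) = 0 := by
    intro v i
    rw [f_expand g]
    refine Finset.sum_eq_zero ?_
    rintro ⟨j, q⟩ -
    by_cases hq : q = 0 ∨ q = 7 ∨ q = 12
    · rcases hq with rfl | rfl | rfl
      · simp [hgtop i j 0 (by decide)]
      · simp [z1]
      · simp [z2]
    · simp [f_top g hgT i j 0 q (by decide) hq]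
  have topB : ∀ v, (∀ j, v (j, 0) = 0) → ∀ (i : Fin m), g v (i, 7) = 0 := by
    intro v hv i
    rw [f_expand g]
    refine Finset.sum_eq_zero ?_
    rintro ⟨j, q⟩ -
    by_cases hq : q = 0 ∨ q = 7 ∨ q = 12
    · rcases hq with rfl | rfl | rfl
      · simp [hv]
      · simp [hgtop i j 7 (by decide)]
      · simp [z3]
    · simp [f_top g hgT i j 7 q (by decide) hq]
  have topC : ∀ v, (∀ j, v (j, 0) = 0) → (∀ j, v (j, 7) = 0) →
      ∀ (i : Fin m), g v (i, 12) = 0 := by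
    intro v hv hv' i
    rw [f_expand g]
    refine Finset.sum_eq_zero ?_
    rintro ⟨j, q⟩ -
    by_cases hq : q = 0 ∨ q = 7 ∨ q = 12
    · rcases hq with rfl | rfl | rfl
      · simp [hv]
      · simp [hv']
      · simp [hgtop i j 12 (by decide)]
    · simp [f_top g hgT i j 12 q (by decide) hq]
  have cube : ∀ v, ∃ w, g (g (g v)) = T k m w := by
    intro v
    have A := topA (g (g v))
    have B := topB (g (g v)) (topA (g v))
    have C := topC (g (g v)) (topA (g v)) (topB (g v) (topA v))
    refine ⟨fun x => g (g (g v)) (x.1, x.2 + 1), ?_⟩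
    ext ⟨i, p⟩
    rw [T_apply]
    have e1 : p - 1 + 1 = p := by simp
    simp only [e1]
    by_cases hp : p = 0 ∨ p = 7 ∨ p = 12
    · rcases hp with rfl | rfl | rfl
      · simp [A]
      · simp [B]
      · simp [C]
    · simp [sw, hp]
  have hpT : ∀ (n : ℕ) v, (g ^ n) (T k m v) = T k m ((g ^ n) v) := by
    intro n
    induction n with
    | zero => intro v; simp
    | succ n ih => intro v; rw [pow_succ, Module.End.mul_apply, hgT, ih, Module.End.mul_apply]
  have pw : ∀ (n : ℕ) v, ∃ w, (g ^ (3 * n)) v = ((T k m) ^ n) w := by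
    intro n
    induction n with
    | zero => intro v; exact ⟨v, by simp⟩
    | succ n ih =>
      intro v
      obtain ⟨w, hw⟩ := cube v
      obtain ⟨w', hw'⟩ := ih w
      refine ⟨w', ?_⟩
      have e1 : g ^ (3 * (n + 1)) = g ^ (3 * n) * (g * (g * g)) := by
        rw [show 3 * (n + 1) = 3 * n + 3 by ring, pow_add]
        simp [pow_succ, mul_assoc]
      rw [e1, Module.End.mul_apply, Module.End.mul_apply, Module.End.mul_apply, hw, hpT, hw',
        pow_succ' (T k m) n, Module.End.mul_apply]
  refine LinearMap.ext fun v => ?_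
  obtain ⟨w, hw⟩ := pw 7 v
  rw [show (21 : ℕ) = 3 * 7 by norm_num, hw, T_pow_seven]
  rfl

/-- A graded idempotent endomorphism is `0` or the identity. -/
theorem idem (hm : 0 < m) (hT : ∀ v, f (T k m v) = T k m (f v))
    (hU : ∀ v ∈ U k m, f v ∈ U k m)
    (hG : ∀ d v, f (pr k m d v) = pr k m d (f v))
    (hI : ∀ v, f (f v) = f v) : (∀ v, f v = 0) ∨ (∀ v, f v = v) := by
  obtain ⟨c, hc⟩ := diag_all f hm hT hU
  have hG' : ∀ (i j : Fin m) (p q : Fin 14), deg (i, p) ≠ deg (j, q) →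
      f (e k j q) (i, p) = 0 := by
    intro i j p q h
    rw [← pr_of_mem (e_gr (k := k) j q), hG]
    exact pr_mem _ _ _ h
  have hn := nilp f hT hG' c hc
  obtain ⟨g, hg⟩ : ∃ g : Module.End k (Fin m × Fin 14 → k), g = f - c • LinearMap.id := ⟨_, rfl⟩
  have hgv : ∀ v, g v = f v - c • v := by
    intro v
    rw [hg]
    rfl
  rw [← hg] at hn
  have h1 : ∀ (n : ℕ) v, (g ^ n) (f v) = (1 - c) ^ n • f v := by
    intro n
    induction n with
    | zero => intro v; simp
    | succ n ih =>
      intro v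
      have : g (f v) = (1 - c) • f v := by
        rw [hgv, hI, sub_smul, one_smul]
      rw [pow_succ, Module.End.mul_apply, this, map_smul, ih, smul_smul, pow_succ, mul_comm]
  have h2 : ∀ (n : ℕ) v, (g ^ n) (v - f v) = (-c) ^ n • (v - f v) := by
    intro n
    induction n with
    | zero => intro v; simp
    | succ n ih =>
      intro v
      have : g (v - f v) = (-c) • (v - f v) := by
        rw [hgv, map_sub, hI, sub_self, zero_sub, neg_smul]
      rw [pow_succ, Module.End.mul_apply, this, map_smul, ih, smul_smul, pow_succ, mul_comm]
  by_cases hc1 : c = 1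
  · right
    intro v
    have h := h2 21 v
    rw [hn, LinearMap.zero_apply] at h
    rcases smul_eq_zero.1 h.symm with h | h
    · exact absurd h (pow_ne_zero _ (by rw [hc1]; exact neg_ne_zero.2 one_ne_zero))
    · exact (sub_eq_zero.1 h).symm
  · left
    intro v
    have h := h1 21 v
    rw [hn, LinearMap.zero_apply] at h
    rcases smul_eq_zero.1 h.symm with h | h
    · exact absurd h (pow_ne_zero _ (sub_ne_zero.2 (Ne.symm hc1)))
    · exact h

end endo

/-- The object. -/
def M (k : Type u) [Field k] (n : ℕ) (hn : 7 ≤ n) (m : ℕ) : SCovObj k n where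
  carrier := Fin m × Fin 14 → k
  U := U k m
  T := T k m
  pow_eq_zero := pow_eq_zero_of_le hn T_pow_seven
  maps_U := fun _ h => T_mem_U h
  grading := gr k m
  indep := gr_indep
  iSup_grading := gr_iSup
  finite_support := by rw [support_eq]; exact Set.finite_range _
  T_grading := fun d _ h => T_gr d h
  U_grading := U_gr

theorem pr_stable (W : Submodule k (Fin m × Fin 14 → k)) (hW : W = ⨆ d, W ⊓ gr k m d) (d : ℤ) :
    ∀ x ∈ W, pr k m d x ∈ W := by
  have : (⨆ d, W ⊓ gr k m d) ≤ W.comap (pr k m d) := by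
    refine iSup_le fun d' x hx => ?_
    rw [Submodule.mem_comap]
    by_cases h : d' = d
    · subst h
      rw [pr_of_mem hx.2]
      exact hx.1
    · rw [pr_of_mem_ne h hx.2]
      exact W.zero_mem
  intro x hx
  rw [hW] at hx
  exact this hx

theorem indec_aux (hm : 0 < m) (V₁ V₂ : Submodule k (Fin m × Fin 14 → k))
    (h1 : V₁ ≠ ⊥) (h2 : V₂ ≠ ⊥) (hc : IsCompl V₁ V₂)
    (hT1 : ∀ x ∈ V₁, T k m x ∈ V₁) (hT2 : ∀ x ∈ V₂, T k m x ∈ V₂)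
    (hU : U k m = U k m ⊓ V₁ ⊔ U k m ⊓ V₂)
    (hG1 : V₁ = ⨆ d, V₁ ⊓ gr k m d) (hG2 : V₂ = ⨆ d, V₂ ⊓ gr k m d) : False := by
  obtain ⟨f, hf1, hf2⟩ : ∃ f : (Fin m × Fin 14 → k) →ₗ[k] (Fin m × Fin 14 → k),
      (∀ x ∈ V₁, f x = x) ∧ (∀ x ∈ V₂, f x = 0) := by
    refine ⟨V₁.subtype ∘ₗ V₁.projectionOnto V₂ hc, fun x hx => ?_, fun x hx => ?_⟩
    · exact congrArg Subtype.val (Submodule.projectionOnto_apply_left hc ⟨x, hx⟩)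
    · exact congrArg Subtype.val (Submodule.projectionOnto_apply_right hc ⟨x, hx⟩)
  have hdec : ∀ v, ∃ x ∈ V₁, ∃ y ∈ V₂, x + y = v := by
    intro v
    have : v ∈ V₁ ⊔ V₂ := by rw [hc.sup_eq_top]; trivial
    exact Submodule.mem_sup.1 this
  have comm : ∀ S : (Fin m × Fin 14 → k) →ₗ[k] (Fin m × Fin 14 → k),
      (∀ x ∈ V₁, S x ∈ V₁) → (∀ x ∈ V₂, S x ∈ V₂) → ∀ v, f (S v) = S (f v) := by
    intro S hS1 hS2 v
    obtain ⟨x, hx, y, hy, rfl⟩ := hdec v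
    rw [map_add, map_add, map_add, hf1 x hx, hf2 y hy, hf1 _ (hS1 x hx), hf2 _ (hS2 y hy),
      add_zero, add_zero]
  have hfU : ∀ v ∈ U k m, f v ∈ U k m := by
    intro v hv
    rw [hU] at hv
    obtain ⟨x, hx, y, hy, rfl⟩ := Submodule.mem_sup.1 hv
    rw [map_add, hf1 x hx.2, hf2 y hy.2, add_zero]
    exact hx.1
  have hI : ∀ v, f (f v) = f v := by
    intro v
    obtain ⟨x, hx, y, hy, rfl⟩ := hdec v
    rw [map_add, hf1 x hx, hf2 y hy, add_zero, hf1 x hx]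
  rcases idem f hm (comm _ hT1 hT2) hfU
    (fun d => comm _ (pr_stable V₁ hG1 d) (pr_stable V₂ hG2 d)) hI with h | h
  · apply h1
    rw [eq_bot_iff]
    intro x hx
    rw [Submodule.mem_bot, ← hf1 x hx, h]
  · apply h2
    rw [eq_bot_iff]
    intro x hx
    rw [Submodule.mem_bot, ← h x, hf2 x hx]

end Stmt14

/-- (7.2.1) For `n ≥ 7` there are indecomposable objects of `S_k(ñ)` with arbitrarily
large total-space support; in particular `S_k(ñ)` is not locally support finite. -/
theorem stmt14 (k : Type u) [Field k] (n : ℕ) (hn : 7 ≤ n) (N : ℕ) :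
    ∃ M : SCovObj k n, M.Indec ∧ N < {i : ℤ | M.grading i ≠ ⊥}.ncard := by
  refine ⟨Stmt14.M k n hn (N + 1), ⟨⟨Stmt14.e k 0 0, ?_⟩, ?_⟩, ?_⟩
  · intro h
    have h2 : Stmt14.e k (0 : Fin (N + 1)) 0 (0, 0) = 0 := congrFun h (0, 0)
    rw [Stmt14.e_apply] at h2
    simp at h2
  · rintro ⟨V₁, V₂, h1, h2, hc, hT1, hT2, hU, hG1, hG2⟩
    exact Stmt14.indec_aux (Nat.succ_pos N) V₁ V₂ h1 h2 hc hT1 hT2 hU hG1 hG2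
  · have hs : {i : ℤ | (Stmt14.M k n hn (N + 1)).grading i ≠ ⊥} =
        Set.range (Stmt14.deg (m := N + 1)) := Stmt14.support_eq
    rw [hs]
    have hsub : Set.range (fun j : Fin (N + 1) => Stmt14.deg (j, (0 : Fin 14))) ⊆
        Set.range (Stmt14.deg (m := N + 1)) := by
      rintro _ ⟨j, rfl⟩
      exact ⟨_, rfl⟩
    have hle := Set.ncard_le_ncard hsub (Set.finite_range _)
    have hinj : Function.Injective (fun j : Fin (N + 1) => Stmt14.deg (j, (0 : Fin 14))) := by
      intro i j h
      simp only [Stmt14.deg] at h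
      rw [Fin.ext_iff]
      omega
    rw [← Set.image_univ, Set.ncard_image_of_injective _ hinj, Set.ncard_univ, Nat.card_fin] at hle
    omega
end

section
/- Let k be a field and let n ≥ 6 be a natural number. Then there are infinitely many isomorphism classes of indecomposable objects of S_k(n). -/
universe u

section Construction

variable {k : Type u} [Field k] {W : Type u} [AddCommGroup W] [Module k W]

/-- The nilpotent operator on `W ^ 12`, with Jordan type `(6,4,2)` tensored with `W`. -/
def bigT : (Fin 12 → W) →ₗ[k] (Fin 12 → W) where
  toFun f := ![0, f 0, f 1, f 2, f 3, f 4, 0, f 6, f 7, f 8, 0, f 10]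
  map_add' f g := by
    funext i; fin_cases i <;> simp
  map_smul' c f := by
    funext i; fin_cases i <;> simp

/-- The invariant subspace, given by equations. -/
def bigU (L : W →ₗ[k] W) : Submodule k (Fin 12 → W) where
  carrier := {f | f 0 = 0 ∧ f 1 = 0 ∧ f 6 = 0 ∧ f 7 = f 2 ∧ f 10 = f 2 ∧
    f 11 = f 3 + L (f 8 - f 3)}
  zero_mem' := by simp
  add_mem' := by
    rintro f g ⟨h1, h2, h3, h4, h5, h6⟩ ⟨g1, g2, g3, g4, g5, g6⟩
    refine ⟨?_, ?_, ?_, ?_, ?_, ?_⟩ <;> simp [*]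
    abel
  smul_mem' := by
    rintro c f ⟨h1, h2, h3, h4, h5, h6⟩
    refine ⟨?_, ?_, ?_, ?_, ?_, ?_⟩ <;> simp [*, smul_sub]

theorem bigT_apply (f : Fin 12 → W) : bigT (k := k) f =
    ![0, f 0, f 1, f 2, f 3, f 4, 0, f 6, f 7, f 8, 0, f 10] := rfl

theorem bigT_pow : (bigT : (Fin 12 → W) →ₗ[k] (Fin 12 → W)) ^ 6 = 0 := by
  apply LinearMap.ext
  intro f
  funext i
  simp only [pow_succ, pow_zero, one_mul, Module.End.mul_apply, bigT_apply]
  fin_cases i <;> simp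

theorem bigT_maps (L : W →ₗ[k] W) (f : Fin 12 → W) (hf : f ∈ bigU L) :
    bigT (k := k) f ∈ bigU L := by
  obtain ⟨h1, h2, h3, h4, h5, h6⟩ := hf
  refine ⟨?_, ?_, ?_, ?_, ?_, ?_⟩ <;> simp [bigT_apply, *]

/-- Inclusion of a coordinate. -/
def inc (i : Fin 12) : W →ₗ[k] (Fin 12 → W) := LinearMap.single k (fun _ => W) i

theorem inc_apply (i j : Fin 12) (w : W) : inc (k := k) i w j = if j = i then w else 0 := by
  simp [inc, Pi.single_apply]

theorem coords (p : (Fin 12 → W) →ₗ[k] (Fin 12 → W))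
    (hT : ∀ v, p (bigT (k := k) v) = bigT (k := k) (p v)) (w : W) :
    (p (inc (k := k) 6 w) 0 = 0 ∧ p (inc (k := k) 6 w) 1 = 0) ∧
    (p (inc (k := k) 10 w) 0 = 0 ∧ p (inc (k := k) 10 w) 1 = 0 ∧
      p (inc (k := k) 10 w) 2 = 0 ∧ p (inc (k := k) 10 w) 3 = 0 ∧
      p (inc (k := k) 10 w) 6 = 0 ∧ p (inc (k := k) 10 w) 7 = 0) := by
  constructor
  · have h : bigT (k := k) (bigT (k := k) (bigT (k := k) (bigT (k := k)
        (inc (k := k) 6 w)))) = 0 := by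
      funext i; fin_cases i <;> simp [bigT_apply, inc_apply]
    have h2 := congrArg p h
    simp only [hT, map_zero] at h2
    have a := congrFun h2 4
    have b := congrFun h2 5
    simp [bigT_apply] at a b
    exact ⟨a, b⟩
  · have h : bigT (k := k) (bigT (k := k) (inc (k := k) 10 w)) = 0 := by
      funext i; fin_cases i <;> simp [bigT_apply, inc_apply]
    have h2 := congrArg p h
    simp only [hT, map_zero] at h2
    have a := congrFun h2 2
    have b := congrFun h2 3
    have c := congrFun h2 4
    have d := congrFun h2 5
    have e := congrFun h2 8
    have f := congrFun h2 9
    simp [bigT_apply] at a b c d e f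
    exact ⟨a, b, c, d, e, f⟩

theorem decomp (v : Fin 12 → W) : ∃ v', v = inc (k := k) 0 (v 0) + inc (k := k) 6 (v 6) +
    inc (k := k) 10 (v 10) + bigT (k := k) v' := by
  refine ⟨![v 1, v 2, v 3, v 4, v 5, 0, v 7, v 8, v 9, 0, v 11, 0], ?_⟩
  funext i; fin_cases i <;> simp [bigT_apply, inc_apply]

theorem diag (L : W →ₗ[k] W) (p : (Fin 12 → W) →ₗ[k] (Fin 12 → W))
    (hT : ∀ v, p (bigT (k := k) v) = bigT (k := k) (p v))
    (hU : ∀ v ∈ bigU L, p v ∈ bigU L) (w : W) :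
    p (inc (k := k) 6 w) 6 = p (inc (k := k) 0 w) 0 ∧
    p (inc (k := k) 10 w) 10 = p (inc (k := k) 0 w) 0 := by
  obtain ⟨⟨y0, y1⟩, z0, z1, z2, z3, z6, z7⟩ := coords p hT w
  have hm : bigT (k := k) (bigT (k := k) (inc (k := k) 0 w)) + bigT (k := k) (inc (k := k) 6 w)
      + inc (k := k) 10 w ∈ bigU L := by
    refine ⟨?_, ?_, ?_, ?_, ?_, ?_⟩ <;> simp [bigT_apply, inc_apply]
  obtain ⟨-, -, -, h4, h5, -⟩ := hU _ hm
  simp only [map_add, hT] at h4 h5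
  simp [bigT_apply, *] at h4 h5
  exact ⟨h4, h5⟩

theorem diag_comm (L : W →ₗ[k] W) (p : (Fin 12 → W) →ₗ[k] (Fin 12 → W))
    (hT : ∀ v, p (bigT (k := k) v) = bigT (k := k) (p v))
    (hU : ∀ v ∈ bigU L, p v ∈ bigU L) (w : W) :
    p (inc (k := k) 0 (L w)) 0 = L (p (inc (k := k) 0 w) 0) := by
  obtain ⟨⟨y0, y1⟩, -⟩ := coords p hT w
  obtain ⟨-, z0, z1, z2, z3, z6, z7⟩ := coords p hT (L w)
  have hm : bigT (k := k) (bigT (k := k) (inc (k := k) 6 w))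
      + bigT (k := k) (inc (k := k) 10 (L w)) ∈ bigU L := by
    refine ⟨?_, ?_, ?_, ?_, ?_, ?_⟩ <;> simp [bigT_apply, inc_apply]
  obtain ⟨-, -, -, -, -, h6⟩ := hU _ hm
  simp only [map_add, hT] at h6
  simp [bigT_apply, *, (diag L p hT hU _).1, (diag L p hT hU _).2] at h6
  exact h6

theorem coord_zero (p : (Fin 12 → W) →ₗ[k] (Fin 12 → W))
    (hT : ∀ v, p (bigT (k := k) v) = bigT (k := k) (p v)) (v : Fin 12 → W) :
    p v 0 = p (inc (k := k) 0 (v 0)) 0 := by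
  obtain ⟨v', hv⟩ := decomp (k := k) v
  have h := congrFun (congrArg p hv) 0
  simp only [map_add, hT] at h
  simpa [hT, bigT_apply, (coords p hT _).1, (coords p hT _).2] using h

theorem eq_zero_of_diag (L : W →ₗ[k] W) (p : (Fin 12 → W) →ₗ[k] (Fin 12 → W))
    (hT : ∀ v, p (bigT (k := k) v) = bigT (k := k) (p v))
    (hU : ∀ v ∈ bigU L, p v ∈ bigU L) (hp : ∀ v, p (p v) = p v)
    (ha : ∀ w, p (inc (k := k) 0 w) 0 = 0) (v : Fin 12 → W) : p v = 0 := by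
  have key : ∀ v, ∃ v', p v = bigT (k := k) v' := by
    intro v
    obtain ⟨v', hv⟩ := decomp (k := k) (p v)
    have e0 : p v 0 = 0 := by rw [coord_zero p hT, ha]
    rw [e0] at hv
    have h6 : p v 6 = 0 := by
      have h := congrFun (congrArg p hv) 6
      rw [hp] at h
      simp only [map_add, map_zero, hT] at h
      simpa [hT, bigT_apply, (coords p hT _).2, (diag L p hT hU _).1, ha] using h
    rw [h6] at hv
    have h10 : p v 10 = 0 := by
      have h := congrFun (congrArg p hv) 10
      rw [hp] at h
      simp only [map_add, map_zero, hT] at h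
      simpa [hT, bigT_apply, (diag L p hT hU _).2, ha] using h
    rw [h10] at hv
    exact ⟨v', by simpa using hv⟩
  have key2 : ∀ j : ℕ, ∀ v, ∃ v', p v = (bigT (k := k) ^ j) v' := by
    intro j
    induction j with
    | zero => exact fun v => ⟨p v, by simp⟩
    | succ j ih =>
      intro v
      obtain ⟨v1, h1⟩ := key v
      obtain ⟨v2, h2⟩ := ih v1
      refine ⟨v2, ?_⟩
      rw [← hp, h1, hT, h2, pow_succ', Module.End.mul_apply]
  obtain ⟨v', h⟩ := key2 6 v
  rw [h, bigT_pow]; rfl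

end Construction

section Shift

variable {k : Type u} [Field k]

/-- The nilpotent Jordan block. -/
def jordan (m : ℕ) : (Fin m → k) →ₗ[k] (Fin m → k) where
  toFun f i := if h : (i : ℕ) + 1 < m then f ⟨i + 1, h⟩ else 0
  map_add' f g := by
    funext i; by_cases h : (i : ℕ) + 1 < m <;> simp [h]
  map_smul' c f := by
    funext i; by_cases h : (i : ℕ) + 1 < m <;> simp [h]

theorem jordan_apply (m : ℕ) (f : Fin m → k) (i : Fin m) :
    jordan m f i = if h : (i : ℕ) + 1 < m then f ⟨i + 1, h⟩ else 0 := rfl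

theorem jordan_pow (m N : ℕ) (f : Fin m → k) (i : Fin m) :
    (jordan m ^ N) f i = if h : (i : ℕ) + N < m then f ⟨i + N, h⟩ else 0 := by
  induction N generalizing i with
  | zero => simp
  | succ N ih =>
    rw [pow_succ', Module.End.mul_apply, jordan_apply]
    by_cases h : (i : ℕ) + 1 < m
    · rw [dif_pos h, ih]
      simp only [Nat.add_assoc, Nat.add_comm 1 N]
    · rw [dif_neg h, dif_neg (by omega)]

/-- A nonzero subspace invariant under the Jordan block contains the socle. -/
theorem socle_mem (m : ℕ) (P : Submodule k (Fin (m + 1) → k))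
    (hP : ∀ x ∈ P, jordan (m + 1) x ∈ P) (f : Fin (m + 1) → k) (hf : f ∈ P) (h0 : f ≠ 0) :
    Pi.single 0 1 ∈ P := by
  have hpow : ∀ N : ℕ, (jordan (m + 1) ^ N) f ∈ P := by
    intro N
    induction N with
    | zero => simpa using hf
    | succ N ih => rw [pow_succ', Module.End.mul_apply]; exact hP _ ih
  have hex : ∃ N : ℕ, (jordan (m + 1) ^ N) f = 0 := by
    refine ⟨m + 1, ?_⟩
    funext i
    rw [jordan_pow, dif_neg (by omega)]; rfl
  classical
  obtain ⟨N, hN, hlt⟩ : ∃ N : ℕ, (jordan (m + 1) ^ (N + 1)) f = 0 ∧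
      (jordan (m + 1) ^ N) f ≠ 0 := by
    have hs := Nat.find_spec hex
    have hmin := fun M => Nat.find_min hex (m := M)
    rcases hM : Nat.find hex with _ | M
    · rw [hM] at hs; exact absurd (by simpa using hs) h0
    · rw [hM] at hs hmin
      exact ⟨M, hs, hmin M (Nat.lt_succ_self M)⟩
  have hg := hpow N
  rw [pow_succ', Module.End.mul_apply] at hN
  generalize (jordan (m + 1) ^ N) f = g at hN hlt hg
  have hz : ∀ i : Fin (m + 1), i ≠ 0 → g i = 0 := by
    intro i hi
    have hi' : (i : ℕ) ≠ 0 := fun h => hi (Fin.ext h)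
    have h := congrFun hN ⟨i - 1, by omega⟩
    rw [jordan_apply, dif_pos (by simp only []; omega)] at h
    have : (⟨(i : ℕ) - 1 + 1, by omega⟩ : Fin (m + 1)) = i := Fin.ext (by simp only []; omega)
    simpa [this] using h
  have hg0 : g 0 ≠ 0 := by
    intro h
    apply hlt
    funext i
    by_cases hi : i = 0
    · rw [hi, h]; rfl
    · exact hz i hi
  have : (Pi.single 0 1 : Fin (m + 1) → k) = (g 0)⁻¹ • g := by
    funext i
    by_cases hi : i = 0
    · subst hi; simp [hg0]
    · simp [hi, hz i hi]
  rw [this]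
  exact P.smul_mem _ hg

theorem idem_jordan (m : ℕ) (a : (Fin (m + 1) → k) →ₗ[k] (Fin (m + 1) → k))
    (hc : ∀ w, a (jordan (m + 1) w) = jordan (m + 1) (a w)) (ha : ∀ w, a (a w) = a w) :
    (∀ w, a w = 0) ∨ (∀ w, w - a w = 0) := by
  by_contra hcon
  push Not at hcon
  obtain ⟨⟨w, hw⟩, w', hw'⟩ := hcon
  have h1 := socle_mem m (LinearMap.ker (LinearMap.id - a)) (by
    intro x hx
    simp only [LinearMap.mem_ker, LinearMap.sub_apply, LinearMap.id_apply, sub_eq_zero] at hx ⊢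
    rw [hc, ← hx]) (a w) (by simp [ha]) hw
  have h2 := socle_mem m (LinearMap.ker a) (by
    intro x hx
    simp only [LinearMap.mem_ker] at hx ⊢
    rw [hc, hx, map_zero]) (w' - a w') (by simp [ha]) hw'
  simp only [LinearMap.mem_ker, LinearMap.sub_apply, LinearMap.id_apply] at h1 h2
  rw [h2, sub_zero] at h1
  simpa using congrFun h1 0

end Shift

/-- The object of dimension pair `(12 (m+1), 6 (m+1))`. -/
def famObj (k : Type u) [Field k] (n : ℕ) (hn : 6 ≤ n) (m : ℕ) : SObj k n where
  carrier := Fin 12 → Fin (m + 1) → k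
  U := bigU (jordan (m + 1))
  T := bigT
  pow_eq_zero := pow_eq_zero_of_le hn bigT_pow
  maps_U := bigT_maps _

theorem proj_props {k : Type u} [Field k] {E : Type u} [AddCommGroup E] [Module k E]
    (T : E →ₗ[k] E) (U V₁ V₂ : Submodule k E) (hc : IsCompl V₁ V₂)
    (h1 : ∀ x ∈ V₁, T x ∈ V₁) (h2 : ∀ x ∈ V₂, T x ∈ V₂) (hU : U = U ⊓ V₁ ⊔ U ⊓ V₂) :
    ∃ p : E →ₗ[k] E, (∀ x ∈ V₁, p x = x) ∧ (∀ x ∈ V₂, p x = 0) ∧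
      (∀ v, p (p v) = p v) ∧ (∀ v, p (T v) = T (p v)) ∧ ∀ v ∈ U, p v ∈ U := by
  obtain ⟨p, hp1, hp2⟩ : ∃ p : E →ₗ[k] E, (∀ x ∈ V₁, p x = x) ∧ (∀ x ∈ V₂, p x = 0) :=
    ⟨Submodule.projection V₁ V₂ hc, fun x hx => Submodule.projection_apply_of_mem_left hc hx,
      fun x hx => (Submodule.projection_apply_eq_zero_iff hc).2 hx⟩
  have hdec : ∀ v, ∃ a ∈ V₁, ∃ b ∈ V₂, a + b = v := fun v =>
    Submodule.mem_sup.1 (hc.sup_eq_top ▸ Submodule.mem_top)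
  refine ⟨p, hp1, hp2, ?_, ?_, ?_⟩
  · intro v
    obtain ⟨a, ha, b, hb, rfl⟩ := hdec v
    simp [hp1 a ha, hp2 b hb]
  · intro v
    obtain ⟨a, ha, b, hb, rfl⟩ := hdec v
    simp [hp1 a ha, hp2 b hb, hp1 _ (h1 a ha), hp2 _ (h2 b hb)]
  · intro v hv
    rw [hU] at hv
    obtain ⟨a, ha, b, hb, rfl⟩ := Submodule.mem_sup.1 hv
    rw [map_add, hp1 a ha.2, hp2 b hb.2, add_zero]
    exact ha.1

theorem famObj_indec (k : Type u) [Field k] (n : ℕ) (hn : 6 ≤ n) (m : ℕ) :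
    (famObj k n hn m).Indec := by
  refine ⟨⟨(fun _ _ => 1 : Fin 12 → Fin (m + 1) → k), fun h => ?_⟩, ?_⟩
  · exact one_ne_zero (congrFun (congrFun h 0) 0 : (1 : k) = 0)
  · rintro ⟨V₁, V₂, n1, n2, hc, h1, h2, hU⟩
    obtain ⟨p, hp1, hp2, hpp, hpT, hpU⟩ := proj_props _ _ _ _ hc h1 h2 hU
    change (Fin 12 → Fin (m + 1) → k) →ₗ[k] (Fin 12 → Fin (m + 1) → k) at p
    change ∀ v, p (bigT v) = bigT (p v) at hpT
    change ∀ v ∈ bigU (jordan (m + 1)), p v ∈ bigU (jordan (m + 1)) at hpU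
    rcases idem_jordan m (LinearMap.proj 0 ∘ₗ p ∘ₗ inc (k := k) 0)
      (fun w => diag_comm _ p hpT hpU w)
      (fun w => by
        change p (inc (k := k) 0 (p (inc (k := k) 0 w) 0)) 0 = p (inc (k := k) 0 w) 0
        rw [← coord_zero p hpT]
        exact congrFun (hpp _) 0) with h | h
    · have hz := eq_zero_of_diag _ p hpT hpU hpp h
      apply n1
      rw [Submodule.eq_bot_iff]
      intro x hx
      rw [← hp1 x hx]; exact hz x
    · have hz := eq_zero_of_diag (jordan (m + 1)) (LinearMap.id - p)
        (fun v => by simp [hpT])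
        (fun v hv => Submodule.sub_mem _ hv (hpU v hv))
        (fun v => by
          have := hpp v
          change p (p v) = p v at this
          simp [this])
        (fun w => by
          have := h w
          simp only [LinearMap.sub_apply, LinearMap.id_apply, Pi.sub_apply]
          rw [inc_apply, if_pos rfl]; exact this)
      apply n2
      rw [Submodule.eq_bot_iff]
      intro x hx
      have h0 : p x = 0 := hp2 x hx
      have h5 : ∀ y : Fin 12 → Fin (m + 1) → k, p y = 0 → y = 0 := by
        intro y hy
        have h4 := hz y
        simpa [hy] using h4
      exact h5 x h0

/-- For `n ≥ 6` there are infinitely many isomorphism classes of indecomposable objects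
of `S_k(n)`. -/
theorem stmt17 (k : Type u) [Field k] (n : ℕ) (hn : 6 ≤ n) :
    ∃ X : ℕ → SObj k n,
      (∀ i, (X i).Indec) ∧ ∀ i j, i ≠ j → ¬(X i).Iso (X j) := by
  refine ⟨famObj k n hn, famObj_indec k n hn, ?_⟩
  rintro i j hij ⟨e, -⟩
  change (Fin 12 → Fin (i + 1) → k) ≃ₗ[k] (Fin 12 → Fin (j + 1) → k) at e
  have h := e.finrank_eq
  simp [Module.finrank_pi_fintype] at h
  exact hij h
end
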